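/- Let d ≥ 2. There exists a function m : (0,1] → (0,1] that is strictly increasing on (0,1], continuously differentiable on (0,1), and satisfies m(1) = 1, lim_{α→1⁻} m(α) = 1 and lim_{α→0⁺} m(α) = 0, such that for every α ∈ (0,1], every open bounded set Ω ⊆ ℝ^d, every g ∈ L^∞_α, and every pair of disjoint open balls B₊, B₋ ⊂ ℝ^d with |B₋| = m(α)·|B₊| > 0, one has |Ω|^{2/d} λ₁^g(Ω) ≥ |B₊ ∪ B₋|^{2/d} λ₁^{χ_α}(B₊ ∪ B₋), where χ_α is the bang-bang function associated with B₋ and α. -/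

import Mathlib

open MeasureTheory Metric Set Filter

open scoped Classical ENNReal

noncomputable section

/-- The Rayleigh quotient of `u : ℝ^d → ℝ`. -/
def rayleigh (d : ℕ) (u : EuclideanSpace ℝ (Fin d) → ℝ) : ℝ :=
  (∫ x, ‖gradient u x‖ ^ 2) / (∫ x, (u x) ^ 2)

/-- A trial function for the Dirichlet eigenvalue on `Ω`: Lipschitz, vanishing outside `Ω`,
and not almost everywhere zero. -/
def IsDirTrial (d : ℕ) (Ω : Set (EuclideanSpace ℝ (Fin d)))
    (u : EuclideanSpace ℝ (Fin d) → ℝ) : Prop :=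
  (∃ K, LipschitzWith K u) ∧ (∀ x ∉ Ω, u x = 0) ∧ ¬ (u =ᵐ[volume] fun _ => (0 : ℝ))

/-- The first Dirichlet eigenvalue of `Ω`. -/
def dirichletEV (d : ℕ) (Ω : Set (EuclideanSpace ℝ (Fin d))) : ℝ :=
  sInf { r | ∃ u, IsDirTrial d Ω u ∧ rayleigh d u = r }

/-- The first twisted eigenvalue of `Ω` with orthogonality constraint `g`. -/
def twistedEV (d : ℕ) (Ω : Set (EuclideanSpace ℝ (Fin d)))
    (g : EuclideanSpace ℝ (Fin d) → ℝ) : ℝ :=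
  sInf { r | ∃ u, IsDirTrial d Ω u ∧ (∫ x, u x * g x) = 0 ∧ rayleigh d u = r }

/-- `u` is a minimizer for the first twisted eigenvalue `λ₁^g(Ω)`. -/
def IsTwistedMin (d : ℕ) (Ω : Set (EuclideanSpace ℝ (Fin d)))
    (g u : EuclideanSpace ℝ (Fin d) → ℝ) : Prop :=
  IsDirTrial d Ω u ∧ (∫ x, u x * g x) = 0 ∧ rayleigh d u = twistedEV d Ω g

/-- The bang-bang function equal to `1` on `Bm` and `α` elsewhere. -/
def chiBang (d : ℕ) (α : ℝ) (Bm : Set (EuclideanSpace ℝ (Fin d))) :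
    EuclideanSpace ℝ (Fin d) → ℝ :=
  fun x => if x ∈ Bm then 1 else α

/-- `m` is a good measure ratio for the parameter `α` (see Theorem 1.1 of the paper). -/
def GoodRatio (d : ℕ) (α m : ℝ) : Prop :=
  ∀ Ω : Set (EuclideanSpace ℝ (Fin d)), IsOpen Ω → Bornology.IsBounded Ω → Ω.Nonempty →
  ∀ g : EuclideanSpace ℝ (Fin d) → ℝ, Measurable g → (∀ᵐ x, α ≤ g x ∧ g x ≤ 1) →
  ∀ (cp cm : EuclideanSpace ℝ (Fin d)) (rp rm : ℝ), 0 < rp → 0 < rm →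
    Disjoint (ball cp rp) (ball cm rm) →
    (volume (ball cm rm)).toReal = m * (volume (ball cp rp)).toReal →
    (volume (ball cp rp ∪ ball cm rm)).toReal ^ ((2 : ℝ) / d) *
        twistedEV d (ball cp rp ∪ ball cm rm) (chiBang d α (ball cm rm)) ≤
      (volume Ω).toReal ^ ((2 : ℝ) / d) * twistedEV d Ω g

open scoped Topology NNReal

section PrekopaLeindler

/-- One-dimensional Brunn–Minkowski inequality. -/
lemma volume_add_volume_le_of_add_mem {A B C : Set ℝ} (hA : MeasurableSet A)
    (hB : MeasurableSet B) (hA' : A.Nonempty) (hB' : B.Nonempty)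
    (hC : ∀ a ∈ A, ∀ b ∈ B, a + b ∈ C) : volume A + volume B ≤ volume C := by
  have tr1 : ∀ K ⊆ A, ∀ b ∈ B, (fun x => x + b) '' K ⊆ C := by
    rintro K hK b hb _ ⟨x, hx, rfl⟩
    exact hC x (hK hx) b hb
  have tr2 : ∀ K ⊆ B, ∀ a ∈ A, (fun x => a + x) '' K ⊆ C := by
    rintro K hK a ha _ ⟨x, hx, rfl⟩
    exact hC a ha x (hK hx)
  have v1 : ∀ (K : Set ℝ) (b : ℝ), volume ((fun x => x + b) '' K) = volume K := by
    intro K b; simp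
  have v2 : ∀ (K : Set ℝ) (b : ℝ), volume ((fun x => b + x) '' K) = volume K := by
    intro K b; simp
  rcases eq_or_ne (volume A) 0 with h0 | h0
  · obtain ⟨a, ha⟩ := hA'
    rw [h0, zero_add, ← v2 B a]
    exact measure_mono (tr2 B subset_rfl a ha)
  rcases eq_or_ne (volume B) 0 with h1 | h1
  · obtain ⟨b, hb⟩ := hB'
    rw [h1, add_zero, ← v1 A b]
    exact measure_mono (tr1 A subset_rfl b hb)
  refine le_of_forall_lt fun c hc => ?_
  obtain ⟨c₁, hc₁, c₂, hc₂, hlt⟩ := ENNReal.exists_lt_add_of_lt_add hc h0 h1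
  obtain ⟨K₁, hK₁A, hK₁, hcK₁⟩ := hA.exists_lt_isCompact hc₁
  obtain ⟨K₂, hK₂B, hK₂, hcK₂⟩ := hB.exists_lt_isCompact hc₂
  have n1 : K₁.Nonempty := by
    rw [nonempty_iff_ne_empty]; rintro rfl; simp at hcK₁
  have n2 : K₂.Nonempty := by
    rw [nonempty_iff_ne_empty]; rintro rfl; simp at hcK₂
  obtain ⟨a, haK, ha⟩ := hK₁.exists_isGreatest n1
  obtain ⟨b, hbK, hb⟩ := hK₂.exists_isLeast n2
  have hinteg : volume ((fun x => x + b) '' K₁ ∩ (fun x => a + x) '' K₂) = 0 := by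
    refine measure_mono_null (t := {a + b}) ?_ (by simp)
    rintro _ ⟨⟨x, hx, rfl⟩, ⟨y, hy, hxy⟩⟩
    have h1 := ha hx
    have h2 := hb hy
    simp only [mem_singleton_iff] at *
    linarith
  calc c < c₁ + c₂ := hlt
    _ ≤ volume K₁ + volume K₂ := by gcongr
    _ = volume ((fun x => x + b) '' K₁) + volume ((fun x => a + x) '' K₂) := by rw [v1, v2]
    _ = volume ((fun x => x + b) '' K₁ ∪ (fun x => a + x) '' K₂) := by
        rw [← measure_union_add_inter ((fun x => x + b) '' K₁)
          (hK₂.image (continuous_const_add a)).measurableSet, hinteg, add_zero]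
    _ ≤ volume C := measure_mono (union_subset (tr1 _ hK₁A b (hK₂B hbK)) (tr2 _ hK₂B a (hK₁A haK)))

lemma volume_setOf_ofReal_lt (c : ℝ≥0∞) :
    volume {s : ℝ | 0 < s ∧ ENNReal.ofReal s < c} = c := by
  rcases eq_or_ne c ∞ with rfl | hc
  · have : {s : ℝ | 0 < s ∧ ENNReal.ofReal s < ∞} = Ioi 0 := by ext; simp
    rw [this, Real.volume_Ioi]
  · have : {s : ℝ | 0 < s ∧ ENNReal.ofReal s < c} = Ioo 0 c.toReal := by
      ext s
      simp only [mem_ofPred_eq, mem_Ioo]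
      exact and_congr_right fun hs => ENNReal.ofReal_lt_iff_lt_toReal hs.le hc
    rw [this, Real.volume_Ioo, sub_zero, ENNReal.ofReal_toReal hc]

/-- Layer cake formula for `ℝ≥0∞`-valued functions. -/
lemma lintegral_eq_lintegral_meas_ofReal_lt {X : Type*} [MeasurableSpace X] (μ : Measure X)
    [SFinite μ] {f : X → ℝ≥0∞} (hf : Measurable f) :
    ∫⁻ x, f x ∂μ = ∫⁻ s in Ioi (0 : ℝ), μ {x | ENNReal.ofReal s < f x} := by
  have hmeas : MeasurableSet {p : X × ℝ | ENNReal.ofReal p.2 < f p.1} :=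
    measurableSet_lt (ENNReal.measurable_ofReal.comp measurable_snd) (hf.comp measurable_fst)
  have h1 : ∀ x, f x = ∫⁻ s in Ioi (0 : ℝ),
      {p : X × ℝ | ENNReal.ofReal p.2 < f p.1}.indicator 1 (x, s) := by
    intro x
    have hm : MeasurableSet {s : ℝ | ENNReal.ofReal s < f x} :=
      measurableSet_lt ENNReal.measurable_ofReal measurable_const
    calc f x = volume {s : ℝ | 0 < s ∧ ENNReal.ofReal s < f x} :=
          (volume_setOf_ofReal_lt _).symm
      _ = (volume.restrict (Ioi 0)) {s : ℝ | ENNReal.ofReal s < f x} := by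
          rw [Measure.restrict_apply hm]
          congr 1; ext s; simp [and_comm]
      _ = _ := (lintegral_indicator_one hm).symm
  calc ∫⁻ x, f x ∂μ = ∫⁻ x, (∫⁻ s in Ioi (0 : ℝ),
      {p : X × ℝ | ENNReal.ofReal p.2 < f p.1}.indicator 1 (x, s)) ∂μ := lintegral_congr h1
    _ = ∫⁻ s in Ioi (0 : ℝ), (∫⁻ x,
      {p : X × ℝ | ENNReal.ofReal p.2 < f p.1}.indicator 1 (x, s) ∂μ) :=
        lintegral_lintegral_swap (f := fun x s =>
          {p : X × ℝ | ENNReal.ofReal p.2 < f p.1}.indicator (1 : X × ℝ → ℝ≥0∞) (x, s))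
          (measurable_one.indicator hmeas).aemeasurable
    _ = _ := by
      refine lintegral_congr fun s => ?_
      have hm : MeasurableSet {x | ENNReal.ofReal s < f x} := measurableSet_lt measurable_const hf
      exact lintegral_indicator_one hm

/-- The Prékopa–Leindler property of a space: the inequality holds for all weights. -/
def PrekopaLeindlerProp (E : Type*) [AddCommGroup E] [Module ℝ E] [MeasureSpace E] : Prop :=
  ∀ (t : ℝ), 0 < t → t < 1 → ∀ f g h : E → ℝ≥0∞, Measurable f → Measurable g → Measurable h →
    (∀ x y, f x ^ (1 - t) * g y ^ t ≤ h ((1 - t) • x + t • y)) →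
    (∫⁻ x, f x) ^ (1 - t) * (∫⁻ x, g x) ^ t ≤ ∫⁻ x, h x

lemma geom_mean_le_arith_mean_ennreal {t : ℝ} (h0 : 0 < t) (h1 : t < 1) (a b : ℝ≥0∞) :
    a ^ (1 - t) * b ^ t ≤ ENNReal.ofReal (1 - t) * a + ENNReal.ofReal t * b := by
  have h1' : 0 < 1 - t := by linarith
  rcases eq_or_ne a ∞ with rfl | ha
  · rw [ENNReal.mul_top (by simpa using h1)]; simp
  rcases eq_or_ne b ∞ with rfl | hb
  · rw [ENNReal.mul_top (by simpa using h0)]; simp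
  lift a to ℝ≥0 using ha
  lift b to ℝ≥0 using hb
  rw [← ENNReal.coe_rpow_of_nonneg _ h1'.le, ← ENNReal.coe_rpow_of_nonneg _ h0.le]
  rw [ENNReal.ofReal, ENNReal.ofReal]
  norm_cast
  have := NNReal.geom_mean_le_arith_mean2_weighted (1 - t).toNNReal t.toNNReal a b
    (by rw [← Real.toNNReal_add h1'.le h0.le]; simp)
  rwa [Real.coe_toNNReal _ h1'.le, Real.coe_toNNReal _ h0.le] at this

lemma prekopaLeindler_real_normalized {t : ℝ} (h0 : 0 < t) (h1 : t < 1) {f g h : ℝ → ℝ≥0∞}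
    (hf : Measurable f) (hg : Measurable g) (hh : Measurable h)
    (hfs : ⨆ x, f x = 1) (hgs : ⨆ x, g x = 1)
    (H : ∀ x y, f x ^ (1 - t) * g y ^ t ≤ h ((1 - t) • x + t • y)) :
    ENNReal.ofReal (1 - t) * (∫⁻ x, f x) + ENNReal.ofReal t * (∫⁻ x, g x) ≤ ∫⁻ x, h x := by
  have h1' : 0 < 1 - t := by linarith
  rw [lintegral_eq_lintegral_meas_ofReal_lt _ hf, lintegral_eq_lintegral_meas_ofReal_lt _ hg,
    lintegral_eq_lintegral_meas_ofReal_lt _ hh, ← lintegral_const_mul' _ _ (by simp),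
    ← lintegral_const_mul' _ _ (by simp), ← lintegral_add_left]
  swap
  · refine Measurable.const_mul ?_ _
    have : Antitone fun s : ℝ => volume {x | ENNReal.ofReal s < f x} := fun a b hab =>
      measure_mono fun x hx => lt_of_le_of_lt (ENNReal.ofReal_le_ofReal hab) hx
    exact this.measurable
  refine setLIntegral_mono' measurableSet_Ioi fun s hs => ?_
  rcases lt_or_ge s 1 with hs1 | hs1
  · have hs1' : ENNReal.ofReal s < 1 := by simpa using hs1
    obtain ⟨x0, hx0⟩ := lt_iSup_iff.1 (hfs ▸ hs1')
    obtain ⟨y0, hy0⟩ := lt_iSup_iff.1 (hgs ▸ hs1')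
    have hmA : MeasurableSet {x | ENNReal.ofReal s < f x} := measurableSet_lt measurable_const hf
    have hmB : MeasurableSet {x | ENNReal.ofReal s < g x} := measurableSet_lt measurable_const hg
    have e1 : ENNReal.ofReal (1 - t) * volume {x | ENNReal.ofReal s < f x}
        = volume ((fun x => (1 - t) * x) '' {x | ENNReal.ofReal s < f x}) := by
      have := Measure.addHaar_image_homothety (volume : Measure ℝ) 0 (1 - t)
        {x | ENNReal.ofReal s < f x}
      rw [Module.finrank_self, pow_one, abs_of_pos h1'] at this
      rw [← this]
      congr 2; ext x; simp [AffineMap.homothety_apply]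
    have e2 : ENNReal.ofReal t * volume {x | ENNReal.ofReal s < g x}
        = volume ((fun x => t * x) '' {x | ENNReal.ofReal s < g x}) := by
      have := Measure.addHaar_image_homothety (volume : Measure ℝ) 0 t
        {x | ENNReal.ofReal s < g x}
      rw [Module.finrank_self, pow_one, abs_of_pos h0] at this
      rw [← this]
      congr 2; ext x; simp [AffineMap.homothety_apply]
    rw [e1, e2]
    refine volume_add_volume_le_of_add_mem ?_ ?_ ⟨_, mem_image_of_mem _ hx0⟩
      ⟨_, mem_image_of_mem _ hy0⟩ ?_
    · exact (measurableEmbedding_mulLeft₀ h1'.ne').measurableSet_image.2 hmA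
    · exact (measurableEmbedding_mulLeft₀ h0.ne').measurableSet_image.2 hmB
    · rintro _ ⟨x, hx, rfl⟩ _ ⟨y, hy, rfl⟩
      refine lt_of_lt_of_le ?_ (H x y)
      have hs0 : ENNReal.ofReal s ≠ 0 := by simpa using hs
      calc ENNReal.ofReal s = ENNReal.ofReal s ^ (1 - t) * ENNReal.ofReal s ^ t := by
            rw [← ENNReal.rpow_add _ _ hs0 ENNReal.ofReal_ne_top]; simp
        _ < f x ^ (1 - t) * g y ^ t :=
          ENNReal.mul_lt_mul (ENNReal.rpow_lt_rpow hx h1') (ENNReal.rpow_lt_rpow hy h0)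
  · have hs1' : 1 ≤ ENNReal.ofReal s := by simpa using hs1
    have e1 : {x | ENNReal.ofReal s < f x} = ∅ := by
      ext x; simpa using (le_iSup f x).trans (hfs.le.trans hs1')
    have e2 : {x | ENNReal.ofReal s < g x} = ∅ := by
      ext x; simpa using (le_iSup g x).trans (hgs.le.trans hs1')
    simp [e1, e2]

lemma prekopaLeindler_real_bounded {t : ℝ} (h0 : 0 < t) (h1 : t < 1) {f g h : ℝ → ℝ≥0∞}
    (hf : Measurable f) (hg : Measurable g) (hh : Measurable h)
    (hfs : ⨆ x, f x ≠ ∞) (hgs : ⨆ x, g x ≠ ∞)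
    (H : ∀ x y, f x ^ (1 - t) * g y ^ t ≤ h ((1 - t) • x + t • y)) :
    (∫⁻ x, f x) ^ (1 - t) * (∫⁻ x, g x) ^ t ≤ ∫⁻ x, h x := by
  have h1' : 0 < 1 - t := by linarith
  set a := ⨆ x, f x with ha
  set b := ⨆ x, g x with hb
  rcases eq_or_ne a 0 with ha0 | ha0
  · have : ∀ x, f x = 0 := fun x => le_antisymm ((le_iSup f x).trans ha0.le) bot_le
    simp [this, h1']
  rcases eq_or_ne b 0 with hb0 | hb0
  · have : ∀ x, g x = 0 := fun x => le_antisymm ((le_iSup g x).trans hb0.le) bot_le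
    simp [this, h0]
  set c := a ^ (1 - t) * b ^ t with hc
  have hc0 : c ≠ 0 := by
    simp only [hc, ne_eq, mul_eq_zero, ENNReal.rpow_eq_zero_iff, not_or, not_and_or]
    simp [ha0, hb0, hfs, hgs]
  have hct : c ≠ ∞ := ENNReal.mul_ne_top (ENNReal.rpow_ne_top_of_nonneg h1'.le hfs)
    (ENNReal.rpow_ne_top_of_nonneg h0.le hgs)
  have key := prekopaLeindler_real_normalized (f := fun x => a⁻¹ * f x) (g := fun x => b⁻¹ * g x)
    (h := fun x => c⁻¹ * h x) h0 h1 (hf.const_mul _) (hg.const_mul _) (hh.const_mul _)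
    (by rw [← ENNReal.mul_iSup, ← ha, ENNReal.inv_mul_cancel ha0 hfs])
    (by rw [← ENNReal.mul_iSup, ← hb, ENNReal.inv_mul_cancel hb0 hgs])
    (by
      intro x y
      have hci : c⁻¹ = (a⁻¹) ^ (1 - t) * (b⁻¹) ^ t := by
        rw [hc, ENNReal.mul_inv, ENNReal.inv_rpow, ENNReal.inv_rpow]
        · right; exact ENNReal.rpow_ne_top_of_nonneg h0.le hgs
        · left; exact ENNReal.rpow_ne_top_of_nonneg h1'.le hfs
      rw [ENNReal.mul_rpow_of_nonneg _ _ h1'.le, ENNReal.mul_rpow_of_nonneg _ _ h0.le, hci]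
      calc _ = (a⁻¹) ^ (1 - t) * (b⁻¹) ^ t * (f x ^ (1 - t) * g y ^ t) := by ring
        _ ≤ _ := by gcongr; exact H x y)
  rw [lintegral_const_mul _ hf, lintegral_const_mul _ hg, lintegral_const_mul _ hh] at key
  have key2 := (geom_mean_le_arith_mean_ennreal h0 h1 _ _).trans key
  rw [ENNReal.mul_rpow_of_nonneg _ _ h1'.le, ENNReal.mul_rpow_of_nonneg _ _ h0.le] at key2
  have hci : (a⁻¹) ^ (1 - t) * (b⁻¹) ^ t = c⁻¹ := by
    rw [hc, ENNReal.mul_inv, ENNReal.inv_rpow, ENNReal.inv_rpow]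
    · right; exact ENNReal.rpow_ne_top_of_nonneg h0.le hgs
    · left; exact ENNReal.rpow_ne_top_of_nonneg h1'.le hfs
  have key3 : c⁻¹ * ((∫⁻ x, f x) ^ (1 - t) * (∫⁻ x, g x) ^ t) ≤ c⁻¹ * ∫⁻ x, h x := by
    calc _ = _ := by rw [← hci]; ring
      _ ≤ _ := key2
  exact (ENNReal.mul_le_mul_iff_right (ENNReal.inv_ne_zero.2 hct)
    (ENNReal.inv_ne_top.2 hc0)).1 key3

lemma iSup_lintegral_min_nat {X : Type*} [MeasurableSpace X] (μ : Measure X)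
    {f : X → ℝ≥0∞} (hf : Measurable f) :
    Tendsto (fun n : ℕ => ∫⁻ x, min (f x) n ∂μ) atTop (𝓝 (∫⁻ x, f x ∂μ)) := by
  refine lintegral_tendsto_of_tendsto_of_monotone (fun n => (hf.min measurable_const).aemeasurable)
    (ae_of_all _ fun x m n hmn =>
      min_le_min le_rfl (Nat.cast_le.2 hmn)) (ae_of_all _ fun x => ?_)
  have : Tendsto (fun n : ℕ => min (f x) (n : ℝ≥0∞)) atTop (𝓝 (min (f x) ∞)) :=
    tendsto_const_nhds.min ENNReal.tendsto_nat_nhds_top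
  simpa using this

lemma prekopaLeindlerProp_real : PrekopaLeindlerProp ℝ := by
  intro t h0 h1 f g h hf hg hh H
  have h1' : 0 < 1 - t := by linarith
  have hbd : ∀ n : ℕ, ∀ F : ℝ → ℝ≥0∞, (⨆ x, min (F x) (n : ℝ≥0∞)) ≠ ∞ := fun n F =>
    ne_top_of_le_ne_top (ENNReal.natCast_ne_top n) (iSup_le fun x => min_le_right _ _)
  have key : ∀ m n : ℕ, (∫⁻ x, min (f x) m) ^ (1 - t) * (∫⁻ x, min (g x) n) ^ t ≤ ∫⁻ x, h x :=
    fun m n => prekopaLeindler_real_bounded h0 h1 (hf.min measurable_const)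
      (hg.min measurable_const) hh (hbd m f) (hbd n g) fun x y => le_trans (by
        gcongr
        · exact min_le_left _ _
        · exact min_le_left _ _) (H x y)
  have mono : ∀ (F : ℝ → ℝ≥0∞), Measurable F → ∫⁻ x, F x = ⨆ n : ℕ, ∫⁻ x, min (F x) n := by
    intro F hF
    refine tendsto_nhds_unique (iSup_lintegral_min_nat volume hF) (tendsto_atTop_iSup ?_)
    intro m n hmn
    exact lintegral_mono fun x => min_le_min le_rfl (Nat.cast_le.2 hmn)
  have rp : ∀ (F : ℕ → ℝ≥0∞) (s : ℝ), 0 < s → (⨆ n, F n) ^ s = ⨆ n, F n ^ s := fun F s hs =>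
    (ENNReal.orderIsoRpow s hs).map_iSup F
  rw [mono f hf, mono g hg, rp _ _ h1', rp _ _ h0, ENNReal.iSup_mul]
  refine iSup_le fun m => ?_
  rw [ENNReal.mul_iSup]
  exact iSup_le fun n => key m n

lemma PrekopaLeindlerProp.of_measurePreserving {E F : Type*} [AddCommGroup E] [Module ℝ E]
    [MeasureSpace E] [AddCommGroup F] [Module ℝ F] [MeasureSpace F]
    (hE : PrekopaLeindlerProp E) (e : E ≃ᵐ F) (he : MeasurePreserving e)
    (hlin : ∀ (a b : ℝ) (x y : E), e (a • x + b • y) = a • e x + b • e y) :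
    PrekopaLeindlerProp F := by
  intro t h0 h1 f g h hf hg hh H
  rw [← he.lintegral_comp hf, ← he.lintegral_comp hg, ← he.lintegral_comp hh]
  refine hE t h0 h1 _ _ _ (hf.comp e.measurable) (hg.comp e.measurable) (hh.comp e.measurable) ?_
  intro x y
  simp only [hlin]
  exact H _ _

lemma PrekopaLeindlerProp.prod {E F : Type*} [AddCommGroup E] [Module ℝ E]
    [MeasureSpace E] [AddCommGroup F] [Module ℝ F] [MeasureSpace F]
    [SFinite (volume : Measure E)] [SFinite (volume : Measure F)]
    (hE : PrekopaLeindlerProp E) (hF : PrekopaLeindlerProp F) :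
    PrekopaLeindlerProp (E × F) := by
  intro t h0 h1 f g h hf hg hh H
  rw [Measure.volume_eq_prod, lintegral_prod _ hf.aemeasurable, lintegral_prod _ hg.aemeasurable,
    lintegral_prod _ hh.aemeasurable]
  refine hE t h0 h1 _ _ _ hf.lintegral_prod_right' hg.lintegral_prod_right'
    hh.lintegral_prod_right' fun x y => ?_
  refine hF t h0 h1 _ _ _ (hf.comp measurable_prodMk_left) (hg.comp measurable_prodMk_left)
    (hh.comp measurable_prodMk_left) fun u v => ?_
  exact H (x, u) (y, v)

lemma prekopaLeindlerProp_pi (n : ℕ) : PrekopaLeindlerProp (Fin n → ℝ) := by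
  induction n with
  | zero =>
    intro t h0 h1 f g h hf hg hh H
    have hv : (volume : Measure (Fin 0 → ℝ)) = Measure.dirac default := by
      rw [volume_pi, Measure.pi_of_empty]
      congr 1; exact Subsingleton.elim _ _
    rw [hv, lintegral_dirac, lintegral_dirac, lintegral_dirac]
    have := H default default
    rwa [Subsingleton.elim ((1 - t) • (default : Fin 0 → ℝ) + t • default) default] at this
  | succ n ih =>
    refine (prekopaLeindlerProp_real.prod ih).of_measurePreserving
      (MeasurableEquiv.piFinSuccAbove (fun _ => ℝ) 0).symm
      ((volume_preserving_piFinSuccAbove (fun _ : Fin (n + 1) => ℝ) 0).symm) ?_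
    intro a b x y
    ext i
    refine Fin.cases ?_ (fun i => ?_) i <;>
      simp [MeasurableEquiv.piFinSuccAbove, Fin.insertNthEquiv]

/-- The Prékopa–Leindler inequality in Euclidean space. -/
theorem prekopaLeindlerProp_euclideanSpace (n : ℕ) :
    PrekopaLeindlerProp (EuclideanSpace ℝ (Fin n)) :=
  (prekopaLeindlerProp_pi n).of_measurePreserving
    (MeasurableEquiv.toLp 2 (Fin n → ℝ))
    (PiLp.volume_preserving_toLp (Fin n)) (fun a b x y => by
      ext i; simp)

/-- Brunn–Minkowski inequality for the sum of a set and a ball. -/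
theorem le_volume_thickening {n : ℕ} {A : Set (EuclideanSpace ℝ (Fin n))}
    (hA : MeasurableSet A) {R ε : ℝ} (hR : 0 < R) (hε : 0 < ε)
    (hAR : volume A = volume (ball (0 : EuclideanSpace ℝ (Fin n)) R)) :
    volume (ball (0 : EuclideanSpace ℝ (Fin n)) (R + ε)) ≤ volume (thickening ε A) := by
  have hRε : 0 < R + ε := by linarith
  set t := ε / (R + ε) with ht
  have h0 : 0 < t := by positivity
  have h1 : t < 1 := by rw [ht, div_lt_one hRε]; linarith
  have h1t : 1 - t = R / (R + ε) := by rw [ht]; field_simp; ring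
  have h1' : 0 < 1 - t := by linarith
  set A' : Set (EuclideanSpace ℝ (Fin n)) := (fun x => (1 - t) • x) ⁻¹' A
  have hA'm : MeasurableSet A' := measurable_const_smul (1 - t) hA
  have hmul : (1 - t)⁻¹ * R = R + ε := by rw [h1t]; field_simp
  have hA'v : volume A' = volume (ball (0 : EuclideanSpace ℝ (Fin n)) (R + ε)) := by
    have e := Measure.addHaar_preimage_smul (volume : Measure (EuclideanSpace ℝ (Fin n)))
      h1'.ne' A
    rw [show A' = ((1 - t) • ·) ⁻¹' A from rfl, e, hAR,
      Measure.addHaar_ball_of_pos _ _ hR, Measure.addHaar_ball_of_pos _ _ hRε, ← mul_assoc,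
      ← ENNReal.ofReal_mul (by positivity)]
    congr 2
    rw [abs_of_pos (by positivity), ← inv_pow, ← mul_pow, hmul]
  have key := prekopaLeindlerProp_euclideanSpace n t h0 h1 (A'.indicator 1)
    ((ball (0 : EuclideanSpace ℝ (Fin n)) (R + ε)).indicator 1) ((thickening ε A).indicator 1)
    (measurable_one.indicator hA'm) (measurable_one.indicator measurableSet_ball)
    (measurable_one.indicator isOpen_thickening.measurableSet) ?_
  · rw [lintegral_indicator_one hA'm, lintegral_indicator_one measurableSet_ball,
      lintegral_indicator_one isOpen_thickening.measurableSet, hA'v,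
      ← ENNReal.rpow_add _ _ (measure_ball_pos _ _ hRε).ne' measure_ball_lt_top.ne] at key
    simpa using key
  · intro x y
    by_cases hx : x ∈ A'
    · by_cases hy : y ∈ ball (0 : EuclideanSpace ℝ (Fin n)) (R + ε)
      · have : (1 - t) • x + t • y ∈ thickening ε A := by
          refine mem_thickening_iff.2 ⟨(1 - t) • x, hx, ?_⟩
          rw [dist_eq_norm, add_sub_cancel_left, norm_smul, Real.norm_of_nonneg h0.le, ht]
          rw [mem_ball_zero_iff] at hy
          calc ε / (R + ε) * ‖y‖ < ε / (R + ε) * (R + ε) := by gcongr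
            _ = ε := by field_simp
        simp [this, hx, hy]
      · rw [indicator_of_notMem hy]; simp [h0]
    · rw [indicator_of_notMem hx]; simp [h1']

end PrekopaLeindler

section Rearrangement

variable {d : ℕ} {w : EuclideanSpace ℝ (Fin d) → ℝ} {L : ℝ≥0}

/-- Levels whose superlevel set has larger volume than the ball of radius `r`. -/
def rearrLevels (w : EuclideanSpace ℝ (Fin d) → ℝ) (r : ℝ) : Set ℝ :=
  {t | t = 0 ∨ (0 < t ∧ volume (ball (0 : EuclideanSpace ℝ (Fin d)) r) < volume {x | t < w x})}

/-- The profile, as a function of the radius, of the symmetric decreasing rearrangement. -/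
def rearr (w : EuclideanSpace ℝ (Fin d) → ℝ) (r : ℝ) : ℝ := sSup (rearrLevels w r)

lemma volume_ball_strictMono (hd : 2 ≤ d) {r s : ℝ} (hs : 0 < s) (hrs : r < s) :
    volume (ball (0 : EuclideanSpace ℝ (Fin d)) r) <
      volume (ball (0 : EuclideanSpace ℝ (Fin d)) s) := by
  rcases le_or_gt r 0 with hr | hr
  · rw [ball_eq_empty.2 hr, measure_empty]
    exact measure_ball_pos _ _ hs
  · rw [Measure.addHaar_ball_of_pos _ _ hr, Measure.addHaar_ball_of_pos _ _ hs]
    refine (ENNReal.mul_lt_mul_iff_left (measure_ball_pos _ _ one_pos).ne'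
      measure_ball_lt_top.ne).2 ?_
    refine (ENNReal.ofReal_lt_ofReal_iff (by positivity)).2 ?_
    rw [finrank_euclideanSpace_fin]
    exact pow_lt_pow_left₀ hrs hr.le (by omega)

lemma lt_of_volume_ball_lt {r s : ℝ}
    (h : volume (ball (0 : EuclideanSpace ℝ (Fin d)) r) <
      volume (ball (0 : EuclideanSpace ℝ (Fin d)) s)) : r < s := by
  by_contra hcon
  exact absurd h (not_lt.2 (measure_mono (ball_subset_ball (not_lt.1 hcon))))

lemma volume_ball_eq (hd : 2 ≤ d) {r : ℝ} (hr : 0 ≤ r) (c : EuclideanSpace ℝ (Fin d)) :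
    volume (ball c r) =
      ENNReal.ofReal (r ^ d) * volume (ball (0 : EuclideanSpace ℝ (Fin d)) 1) := by
  have : Nonempty (Fin d) := ⟨⟨0, by omega⟩⟩
  rw [Measure.addHaar_ball _ _ hr, finrank_euclideanSpace_fin]

/-- Every finite volume is the volume of a ball. -/
lemma exists_radius_of_volume (hd : 2 ≤ d) {m : ℝ≥0∞} (hm : m ≠ ∞) :
    ∃ R : ℝ, 0 ≤ R ∧ volume (ball (0 : EuclideanSpace ℝ (Fin d)) R) = m := by
  have hω : volume (ball (0 : EuclideanSpace ℝ (Fin d)) 1) ≠ 0 :=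
    (measure_ball_pos _ _ one_pos).ne'
  have hω' : volume (ball (0 : EuclideanSpace ℝ (Fin d)) 1) ≠ ∞ := measure_ball_lt_top.ne
  set c := m / volume (ball (0 : EuclideanSpace ℝ (Fin d)) 1) with hc
  have hc' : c ≠ ∞ := ENNReal.div_ne_top hm hω
  refine ⟨c.toReal ^ ((d : ℝ)⁻¹), by positivity, ?_⟩
  rw [volume_ball_eq hd (by positivity), Real.rpow_inv_natCast_pow (by positivity) (by omega),
    ENNReal.ofReal_toReal hc', hc, ENNReal.div_mul_cancel hω hω']

lemma zero_mem_rearrLevels (r : ℝ) : (0 : ℝ) ∈ rearrLevels w r := Or.inl rfl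

lemma bddAbove_rearrLevels {M : ℝ} (hM : ∀ x, w x ≤ M) (h0 : 0 ≤ M) (r : ℝ) :
    M ∈ upperBounds (rearrLevels w r) := by
  rintro t (rfl | ⟨-, ht⟩)
  · exact h0
  · by_contra hcon
    have : {x | t < w x} = ∅ := by
      ext x; simpa using (hM x).trans (not_le.1 hcon).le
    simp [this] at ht

lemma rearr_nonneg {M : ℝ} (hM : ∀ x, w x ≤ M) (h0 : 0 ≤ M) (r : ℝ) : 0 ≤ rearr w r :=
  le_csSup ⟨M, bddAbove_rearrLevels hM h0 r⟩ (zero_mem_rearrLevels r)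

lemma lt_rearr_iff {M : ℝ} (hM : ∀ x, w x ≤ M) (h0 : 0 ≤ M) {t r : ℝ} (ht : 0 ≤ t) :
    t < rearr w r ↔
      volume (ball (0 : EuclideanSpace ℝ (Fin d)) r) < volume {x | t < w x} := by
  constructor
  · intro h
    obtain ⟨s, hs, hts⟩ := exists_lt_of_lt_csSup ⟨0, zero_mem_rearrLevels r⟩ h
    rcases hs with rfl | ⟨-, hs⟩
    · linarith
    · exact hs.trans_le (measure_mono fun x hx => hts.trans hx)
  · intro h
    have hU : {x | t < w x} = ⋃ n : ℕ, {x | t + 1 / ((n : ℝ) + 1) < w x} := by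
      ext x
      simp only [mem_ofPred_eq, mem_iUnion]
      constructor
      · intro hx
        obtain ⟨n, hn⟩ := exists_nat_one_div_lt (sub_pos.2 hx)
        exact ⟨n, by linarith⟩
      · rintro ⟨n, hn⟩
        have : 0 < 1 / ((n : ℝ) + 1) := by positivity
        linarith
    have hmono : Monotone fun n : ℕ => {x | t + 1 / ((n : ℝ) + 1) < w x} := by
      intro m n hmn x hx
      have : 1 / ((n : ℝ) + 1) ≤ 1 / ((m : ℝ) + 1) := by gcongr
      simp only [mem_ofPred_eq] at *
      linarith
    rw [hU, hmono.measure_iUnion] at h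
    obtain ⟨n, hn⟩ := lt_iSup_iff.1 h
    have hn0 : 0 < 1 / ((n : ℝ) + 1) := by positivity
    calc t < t + 1 / ((n : ℝ) + 1) := by linarith
      _ ≤ rearr w r := le_csSup ⟨M, bddAbove_rearrLevels hM h0 r⟩ (Or.inr ⟨by linarith, hn⟩)

lemma rearr_antitone {M : ℝ} (hM : ∀ x, w x ≤ M) (h0 : 0 ≤ M) : Antitone (rearr w) := by
  intro r s hrs
  refine csSup_le ⟨0, zero_mem_rearrLevels s⟩ ?_
  rintro t (rfl | ⟨ht, hts⟩)
  · exact rearr_nonneg hM h0 r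
  · exact le_csSup ⟨M, bddAbove_rearrLevels hM h0 r⟩
      (Or.inr ⟨ht, lt_of_le_of_lt (measure_mono (ball_subset_ball hrs)) hts⟩)

lemma thickening_superlevel_subset (hw : LipschitzWith L w) {ε : ℝ} (t : ℝ) :
    thickening ε {x | t < w x} ⊆ {x | t - L * ε < w x} := by
  intro x hx
  obtain ⟨z, hz, hxz⟩ := mem_thickening_iff.1 hx
  have h1 := hw.dist_le_mul z x
  rw [Real.dist_eq, dist_comm] at h1
  have h2 := le_abs_self (w z - w x)
  have h3 : (L : ℝ) * dist x z ≤ L * ε := by gcongr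
  simp only [mem_ofPred_eq] at *
  linarith

lemma lipschitzWith_rearr (hd : 2 ≤ d) (hw : LipschitzWith L w) {M : ℝ} (hM : ∀ x, w x ≤ M)
    (h0 : 0 ≤ M) (hfin : ∀ t, 0 ≤ t → volume {x | t < w x} ≠ ∞) : LipschitzWith L (rearr w) := by
  have main : ∀ r ε : ℝ, 0 < ε → rearr w r ≤ rearr w (r + ε) + L * ε := by
    intro r ε hε
    refine le_of_forall_lt fun s hs => ?_
    have hLε : 0 ≤ L * ε := by positivity
    have hv := rearr_nonneg hM h0 (r + ε)
    rcases lt_or_ge s (L * ε) with hsL | hsL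
    · linarith
    have hs0 : 0 ≤ s := hLε.trans hsL
    have h1 := (lt_rearr_iff hM h0 hs0).1 hs
    obtain ⟨R, hR0, hR⟩ := exists_radius_of_volume hd (hfin s hs0)
    rw [← hR] at h1
    have hrR := lt_of_volume_ball_lt h1
    have hRpos : 0 < R := by
      rcases hR0.eq_or_lt with h | h
      · rw [← h] at h1; simp at h1
      · exact h
    have h2 := le_volume_thickening (measurableSet_lt measurable_const hw.continuous.measurable)
      hRpos hε hR.symm
    have : s - L * ε < rearr w (r + ε) := by
      refine (lt_rearr_iff hM h0 (by linarith)).2 ?_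
      calc _ < _ := volume_ball_strictMono hd (by linarith : 0 < R + ε) (by linarith)
        _ ≤ _ := h2
        _ ≤ _ := measure_mono (thickening_superlevel_subset hw s)
    linarith
  have hanti := rearr_antitone (w := w) hM h0
  refine LipschitzWith.of_le_add_mul L fun x y => ?_
  rcases lt_trichotomy x y with h | h | h
  · have := main x (y - x) (by linarith)
    rw [Real.dist_eq, abs_sub_comm, abs_of_pos (by linarith : 0 < y - x)]
    simpa using this
  · subst h; simp
  · have := hanti h.le
    have : 0 ≤ L * dist x y := by positivity
    linarith

lemma superlevel_rearr_norm (hd : 2 ≤ d) {M : ℝ} (hM : ∀ x, w x ≤ M) (h0 : 0 ≤ M) {t R ε : ℝ}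
    (ht : 0 ≤ t) (hR0 : 0 < R)
    (hR : volume (ball (0 : EuclideanSpace ℝ (Fin d)) R) = volume {x | t < w x}) :
    {x : EuclideanSpace ℝ (Fin d) | t < rearr w (‖x‖ - ε)} = ball 0 (R + ε) := by
  ext x
  rw [mem_ofPred_eq, lt_rearr_iff hM h0 ht, ← hR, mem_ball_zero_iff, ← sub_lt_iff_lt_add]
  exact ⟨lt_of_volume_ball_lt, volume_ball_strictMono hd hR0⟩

lemma volume_superlevel_rearr_norm (hd : 2 ≤ d) {M : ℝ} (hM : ∀ x, w x ≤ M) (h0 : 0 ≤ M)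
    (hfin : ∀ t, 0 ≤ t → volume {x | t < w x} ≠ ∞) {t : ℝ} (ht : 0 ≤ t) :
    volume {x : EuclideanSpace ℝ (Fin d) | t < rearr w ‖x‖} = volume {x | t < w x} := by
  obtain ⟨R, hR0, hR⟩ := exists_radius_of_volume hd (hfin t ht)
  rcases hR0.eq_or_lt with h | h
  · have h2 : volume {x | t < w x} = 0 := by rw [← hR, ← h]; simp
    have : {x : EuclideanSpace ℝ (Fin d) | t < rearr w ‖x‖} = ∅ := by
      ext x
      simp [lt_rearr_iff hM h0 ht, h2]
    rw [this, h2, measure_empty]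
  · have := superlevel_rearr_norm hd hM h0 (ε := 0) ht h hR
    simp only [sub_zero, add_zero] at this
    rw [this, hR]

lemma lintegral_ofReal_eq_of_equimeasurable {X : Type*} [MeasurableSpace X] {μ : Measure X}
    [SFinite μ] {f g : X → ℝ} (hf : Measurable f) (hg : Measurable g)
    (h : ∀ t, 0 ≤ t → μ {x | t < f x} = μ {x | t < g x}) :
    ∫⁻ x, ENNReal.ofReal (f x) ∂μ = ∫⁻ x, ENNReal.ofReal (g x) ∂μ := by
  rw [lintegral_eq_lintegral_meas_ofReal_lt _ hf.ennreal_ofReal,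
    lintegral_eq_lintegral_meas_ofReal_lt _ hg.ennreal_ofReal]
  refine setLIntegral_congr_fun measurableSet_Ioi fun s hs => ?_
  have : ∀ F : X → ℝ, {x | ENNReal.ofReal s < ENNReal.ofReal (F x)} = {x | s < F x} := by
    intro F; ext x
    simp only [mem_ofPred_eq]
    exact ENNReal.ofReal_lt_ofReal_iff_of_nonneg (le_of_lt hs)
  simp only [this]
  exact h s (le_of_lt hs)

/-- Two nonnegative equimeasurable functions have the same integral. -/
lemma integral_eq_of_equimeasurable {X : Type*} [MeasurableSpace X] {μ : Measure X}
    [SFinite μ] {f g : X → ℝ} (hf : Measurable f) (hg : Measurable g) (hf0 : ∀ x, 0 ≤ f x)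
    (hg0 : ∀ x, 0 ≤ g x) (h : ∀ t, 0 ≤ t → μ {x | t < f x} = μ {x | t < g x}) :
    ∫ x, f x ∂μ = ∫ x, g x ∂μ := by
  rw [integral_eq_lintegral_of_nonneg_ae (ae_of_all _ hf0) hf.aestronglyMeasurable,
    integral_eq_lintegral_of_nonneg_ae (ae_of_all _ hg0) hg.aestronglyMeasurable,
    lintegral_ofReal_eq_of_equimeasurable hf hg h]

/-- Supremum of `w` over the ball of radius `ε`. -/
def supBall (w : EuclideanSpace ℝ (Fin d) → ℝ) (ε : ℝ) (x : EuclideanSpace ℝ (Fin d)) : ℝ :=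
  sSup (w '' ball x ε)

lemma lt_supBall_iff {M : ℝ} (hM : ∀ x, w x ≤ M) {ε : ℝ} (hε : 0 < ε) (t : ℝ)
    (x : EuclideanSpace ℝ (Fin d)) : t < supBall w ε x ↔ x ∈ thickening ε {x | t < w x} := by
  rw [supBall, lt_csSup_iff ⟨M, by rintro _ ⟨y, -, rfl⟩; exact hM y⟩
    ((nonempty_ball.2 hε).image _), mem_thickening_iff]
  constructor
  · rintro ⟨_, ⟨y, hy, rfl⟩, h⟩
    exact ⟨y, h, by rw [dist_comm]; exact hy⟩
  · rintro ⟨y, h, hy⟩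
    exact ⟨w y, ⟨y, by rw [mem_ball, dist_comm]; exact hy, rfl⟩, h⟩

lemma measurable_supBall {M : ℝ} (hM : ∀ x, w x ≤ M) {ε : ℝ} (hε : 0 < ε) :
    Measurable (supBall w ε) := by
  refine measurable_of_Ioi fun t => ?_
  have : supBall w ε ⁻¹' Ioi t = thickening ε {x | t < w x} := by
    ext x; exact lt_supBall_iff hM hε t x
  rw [this]
  exact isOpen_thickening.measurableSet

lemma le_supBall {M : ℝ} (hM : ∀ x, w x ≤ M) {ε : ℝ} (hε : 0 < ε)
    (x : EuclideanSpace ℝ (Fin d)) : w x ≤ supBall w ε x :=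
  le_csSup ⟨M, by rintro _ ⟨y, -, rfl⟩; exact hM y⟩ (mem_image_of_mem _ (mem_ball_self hε))

lemma supBall_le {ε c : ℝ} (hε : 0 < ε) (x : EuclideanSpace ℝ (Fin d))
    (h : ∀ y ∈ ball x ε, w y ≤ c) : supBall w ε x ≤ c :=
  csSup_le ((nonempty_ball.2 hε).image _) (by rintro _ ⟨y, hy, rfl⟩; exact h y hy)

lemma lintegral_sub_sq_eq {X : Type*} [MeasurableSpace X] {μ : Measure X} [SFinite μ]
    {F G : X → ℝ} (hF : Measurable F) (hG : Measurable G) (h : ∀ x, G x ≤ F x) :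
    ∫⁻ x, ENNReal.ofReal ((F x - G x) ^ 2) ∂μ =
      ∫⁻ p : ℝ × ℝ, μ {x | (G x ≤ p.1 ∧ p.1 < F x) ∧ (G x ≤ p.2 ∧ p.2 < F x)} := by
  set S : Set (X × (ℝ × ℝ)) :=
    {q | (G q.1 ≤ q.2.1 ∧ q.2.1 < F q.1) ∧ (G q.1 ≤ q.2.2 ∧ q.2.2 < F q.1)} with hS
  have hSm : MeasurableSet S := by
    have hF' := hF.comp (measurable_fst : Measurable (Prod.fst : X × (ℝ × ℝ) → X))
    have hG' := hG.comp (measurable_fst : Measurable (Prod.fst : X × (ℝ × ℝ) → X))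
    have h1 : Measurable fun q : X × (ℝ × ℝ) => q.2.1 := by fun_prop
    have h2 : Measurable fun q : X × (ℝ × ℝ) => q.2.2 := by fun_prop
    exact ((measurableSet_le hG' h1).inter (measurableSet_lt h1 hF')).inter
      ((measurableSet_le hG' h2).inter (measurableSet_lt h2 hF'))
  have e1 := Measure.prod_apply (μ := μ) (ν := (volume : Measure (ℝ × ℝ))) hSm
  have e2 := Measure.prod_apply_symm (μ := μ) (ν := (volume : Measure (ℝ × ℝ))) hSm
  rw [e1] at e2
  rw [show ∫⁻ p : ℝ × ℝ, μ {x | (G x ≤ p.1 ∧ p.1 < F x) ∧ (G x ≤ p.2 ∧ p.2 < F x)} =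
    ∫⁻ p : ℝ × ℝ, μ ((fun x => (x, p)) ⁻¹' S) from rfl, ← e2]
  refine lintegral_congr fun x => ?_
  have : Prod.mk x ⁻¹' S = Ico (G x) (F x) ×ˢ Ico (G x) (F x) := by
    ext p; simp [hS]
  rw [this, Measure.volume_eq_prod, Measure.prod_prod, Real.volume_Ico,
    ← ENNReal.ofReal_mul (by linarith [h x]), sq]

/-- Nonexpansivity underlying the Pólya–Szegő inequality. -/
lemma lintegral_rearr_shift_le (hd : 2 ≤ d) (hw : LipschitzWith L w) {M : ℝ}
    (hM : ∀ x, w x ≤ M) (h0 : 0 ≤ M) (hfin : ∀ t, 0 ≤ t → volume {x | t < w x} ≠ ∞)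
    {ε : ℝ} (hε : 0 < ε) :
    ∫⁻ x : EuclideanSpace ℝ (Fin d),
        ENNReal.ofReal ((rearr w (‖x‖ - ε) - rearr w ‖x‖) ^ 2) ≤
      ∫⁻ x, ENNReal.ofReal ((supBall w ε x - w x) ^ 2) := by
  have hv := (lipschitzWith_rearr hd hw hM h0 hfin).continuous
  have hanti := rearr_antitone (w := w) hM h0
  have hm1 : Measurable fun x : EuclideanSpace ℝ (Fin d) => rearr w (‖x‖ - ε) :=
    (hv.comp (continuous_norm.sub continuous_const)).measurable
  have hm2 : Measurable fun x : EuclideanSpace ℝ (Fin d) => rearr w ‖x‖ :=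
    (hv.comp continuous_norm).measurable
  rw [lintegral_sub_sq_eq hm1 hm2 (fun x => hanti (by linarith)),
    lintegral_sub_sq_eq (measurable_supBall hM hε) hw.continuous.measurable (le_supBall hM hε)]
  refine lintegral_mono fun p => ?_
  have key : ∀ m' M' : ℝ, m' ≤ M' →
      volume {x : EuclideanSpace ℝ (Fin d) | rearr w ‖x‖ ≤ m' ∧ M' < rearr w (‖x‖ - ε)} ≤
        volume {x | w x ≤ m' ∧ M' < supBall w ε x} := by
    intro m' M' hmM
    rcases lt_or_ge m' 0 with hm0 | hm0
    · have : {x : EuclideanSpace ℝ (Fin d) | rearr w ‖x‖ ≤ m' ∧ M' < rearr w (‖x‖ - ε)} = ∅ := by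
        ext x
        simp only [mem_ofPred_eq, mem_empty_iff_false, iff_false, not_and]
        intro hx
        linarith [rearr_nonneg hM h0 ‖x‖]
      simp [this]
    have hM0 := hm0.trans hmM
    obtain ⟨R, hR0, hR⟩ := exists_radius_of_volume hd (hfin M' hM0)
    rcases hR0.eq_or_lt with h | h
    · have h2 : volume {x | M' < w x} = 0 := by rw [← hR, ← h]; simp
      have : {x : EuclideanSpace ℝ (Fin d) |
          rearr w ‖x‖ ≤ m' ∧ M' < rearr w (‖x‖ - ε)} = ∅ := by
        ext x
        simp [lt_rearr_iff hM h0 hM0, h2]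
      simp [this]
    have hs1 := superlevel_rearr_norm hd hM h0 (ε := ε) hM0 h hR
    have hs2 : {x | M' < supBall w ε x} = thickening ε {x | M' < w x} := by
      ext x; exact lt_supBall_iff hM hε M' x
    have e1 : {x : EuclideanSpace ℝ (Fin d) | rearr w ‖x‖ ≤ m' ∧ M' < rearr w (‖x‖ - ε)} =
        ball 0 (R + ε) \ {x | m' < rearr w ‖x‖} := by
      rw [← hs1]; ext x; simp [and_comm]
    have e2 : {x | w x ≤ m' ∧ M' < supBall w ε x} =
        thickening ε {x | M' < w x} \ {x | m' < w x} := by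
      rw [← hs2]; ext x; simp [and_comm]
    rw [e1, e2]
    obtain ⟨R', hR0', hR'⟩ := exists_radius_of_volume hd (hfin m' hm0)
    have hbm := le_volume_thickening (measurableSet_lt measurable_const hw.continuous.measurable)
      h hε hR.symm
    have hlev : {x : EuclideanSpace ℝ (Fin d) | m' < rearr w ‖x‖} = ball 0 R' := by
      rcases hR0'.eq_or_lt with h' | h'
      · have : R ≤ R' := by
          by_contra hcon
          have h3 := volume_ball_strictMono hd h (not_le.1 hcon)
          rw [hR', hR] at h3
          exact absurd h3 (not_lt.2 (measure_mono fun x hx => hmM.trans_lt hx))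
        linarith
      · have := superlevel_rearr_norm hd hM h0 (ε := 0) hm0 h' hR'
        simpa using this
    rw [hlev]
    rcases le_or_gt (R + ε) R' with hle | hlt
    · rw [sdiff_eq_empty.2 (ball_subset_ball hle)]; simp
    · rw [measure_sdiff (ball_subset_ball hlt.le) measurableSet_ball.nullMeasurableSet
        measure_ball_lt_top.ne, hR']
      calc _ ≤ volume (thickening ε {x | M' < w x}) - volume {x | m' < w x} := by gcongr
        _ ≤ _ := le_measure_sdiff
  have conv : ∀ (F G : EuclideanSpace ℝ (Fin d) → ℝ),
      {x | (G x ≤ p.1 ∧ p.1 < F x) ∧ (G x ≤ p.2 ∧ p.2 < F x)} =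
        {x | G x ≤ min p.1 p.2 ∧ max p.1 p.2 < F x} := by
    intro F G; ext x
    simp only [mem_ofPred_eq, le_min_iff, max_lt_iff]
    tauto
  rw [conv, conv]
  exact key _ _ min_le_max

lemma differentiableAt_of_comp_norm {v : ℝ → ℝ} {x : EuclideanSpace ℝ (Fin d)} (hx : x ≠ 0)
    (h : DifferentiableAt ℝ (fun y : EuclideanSpace ℝ (Fin d) => v ‖y‖) x) :
    DifferentiableAt ℝ v ‖x‖ := by
  have hx' : 0 < ‖x‖ := norm_pos_iff.2 hx
  have h1 : DifferentiableAt ℝ (fun s : ℝ => (s / ‖x‖) • x) ‖x‖ := by fun_prop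
  have h2 : (‖x‖ / ‖x‖) • x = x := by rw [div_self hx'.ne', one_smul]
  have h3 : DifferentiableAt ℝ ((fun y : EuclideanSpace ℝ (Fin d) => v ‖y‖) ∘
      fun s : ℝ => (s / ‖x‖) • x) ‖x‖ := by
    refine DifferentiableAt.comp _ ?_ h1
    rw [h2]; exact h
  refine h3.congr_of_eventuallyEq ?_
  filter_upwards [eventually_gt_nhds hx'] with s hs
  simp only [Function.comp, norm_smul, norm_div, norm_norm, Real.norm_of_nonneg hs.le]
  rw [div_mul_cancel₀ _ hx'.ne']

lemma norm_gradient_eq (f : EuclideanSpace ℝ (Fin d) → ℝ) (x : EuclideanSpace ℝ (Fin d)) :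
    ‖gradient f x‖ = ‖fderiv ℝ f x‖ := by
  rw [gradient, LinearIsometryEquiv.norm_map]

lemma norm_gradient_le_of_lipschitz (hw : LipschitzWith L w) (x : EuclideanSpace ℝ (Fin d)) :
    ‖gradient w x‖ ≤ L := by
  rw [norm_gradient_eq]; exact norm_fderiv_le_of_lipschitz ℝ hw

lemma measurable_norm_gradient (f : EuclideanSpace ℝ (Fin d) → ℝ) :
    Measurable fun x => ‖gradient f x‖ := by
  simp only [norm_gradient_eq]
  exact (measurable_fderiv ℝ f).norm

lemma limsup_supBall_le {M : ℝ} (hM : ∀ x, w x ≤ M) {x : EuclideanSpace ℝ (Fin d)}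
    (hx : DifferentiableAt ℝ w x) :
    limsup (fun n : ℕ => ENNReal.ofReal
      (((supBall w (1 / ((n : ℝ) + 1)) x - w x) / (1 / ((n : ℝ) + 1))) ^ 2)) atTop ≤
      ENNReal.ofReal (‖gradient w x‖ ^ 2) := by
  have key : ∀ η : ℝ, 0 < η → limsup (fun n : ℕ => ENNReal.ofReal
      (((supBall w (1 / ((n : ℝ) + 1)) x - w x) / (1 / ((n : ℝ) + 1))) ^ 2)) atTop ≤
      ENNReal.ofReal ((‖gradient w x‖ + η) ^ 2) := by
    intro η hη
    have h1 := hx.hasFDerivAt.isLittleO.def hη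
    obtain ⟨δ, hδ, hball⟩ := Metric.eventually_nhds_iff.1 h1
    obtain ⟨N, hN⟩ := exists_nat_one_div_lt hδ
    refine limsup_le_of_le (h := ?_)
    filter_upwards [eventually_ge_atTop N] with n hn
    have hn0 : 0 < 1 / ((n : ℝ) + 1) := by positivity
    have hnN : 1 / ((n : ℝ) + 1) ≤ 1 / ((N : ℝ) + 1) := by gcongr
    set ε := 1 / ((n : ℝ) + 1)
    refine ENNReal.ofReal_le_ofReal ?_
    have hlow : 0 ≤ (supBall w ε x - w x) / ε :=
      div_nonneg (sub_nonneg.2 (le_supBall hM hn0 x)) hn0.le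
    refine pow_le_pow_left₀ hlow ?_ 2
    rw [div_le_iff₀ hn0, sub_le_iff_le_add]
    refine supBall_le hn0 x fun y hy => ?_
    have h2 := hball (lt_of_lt_of_le (mem_ball.1 hy) (hnN.trans hN.le))
    rw [Real.norm_eq_abs] at h2
    have h3 := le_abs_self (w y - w x - (fderiv ℝ w x) (y - x))
    have h4 := (le_abs_self _).trans ((fderiv ℝ w x).le_opNorm (y - x))
    have h5 : ‖y - x‖ ≤ ε := by rw [← dist_eq_norm]; exact (mem_ball.1 hy).le
    rw [norm_gradient_eq]
    have h6 : (‖fderiv ℝ w x‖ + η) * ‖y - x‖ ≤ (‖fderiv ℝ w x‖ + η) * ε := by gcongr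
    nlinarith
  have hlim : Tendsto (fun η : ℝ => ENNReal.ofReal ((‖gradient w x‖ + η) ^ 2))
      (𝓝[>] 0) (𝓝 (ENNReal.ofReal (‖gradient w x‖ ^ 2))) := by
    have : Continuous fun η : ℝ => ENNReal.ofReal ((‖gradient w x‖ + η) ^ 2) :=
      ENNReal.continuous_ofReal.comp (by fun_prop)
    have := (this.tendsto 0).mono_left (nhdsWithin_le_nhds (s := Ioi 0))
    simpa using this
  refine ge_of_tendsto hlim ?_
  filter_upwards [self_mem_nhdsWithin] with η hη using key η hη

lemma tendsto_shift_quotient {v : ℝ → ℝ} {r : ℝ} (h : DifferentiableAt ℝ v r) :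
    Tendsto (fun n : ℕ => ENNReal.ofReal
      (((v (r - 1 / ((n : ℝ) + 1)) - v r) / (1 / ((n : ℝ) + 1))) ^ 2)) atTop
      (𝓝 (ENNReal.ofReal (deriv v r ^ 2))) := by
  have h1 := h.hasDerivAt.tendsto_slope
  have h2 : Tendsto (fun n : ℕ => r - 1 / ((n : ℝ) + 1)) atTop (𝓝[≠] r) := by
    refine tendsto_nhdsWithin_iff.2 ⟨?_, ?_⟩
    · have := (tendsto_one_div_add_atTop_nhds_zero_nat (𝕜 := ℝ)).const_sub r
      simpa using this
    · refine Eventually.of_forall fun n => ?_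
      have : 0 < 1 / ((n : ℝ) + 1) := by positivity
      simp only [mem_compl_iff, mem_singleton_iff]
      intro h; linarith
  have h3 := (h1.comp h2).pow 2
  refine (ENNReal.tendsto_ofReal h3).congr fun n => ?_
  congr 1
  simp only [Function.comp, slope_def_field]
  have : r - 1 / ((n : ℝ) + 1) - r = -(1 / ((n : ℝ) + 1)) := by ring
  rw [this, div_neg, neg_sq]

lemma polyaSzego_lintegral (hd : 2 ≤ d) (hw : LipschitzWith L w) {M ρ : ℝ}
    (hM : ∀ x, w x ≤ M) (h0 : 0 ≤ M) (hfin : ∀ t, 0 ≤ t → volume {x | t < w x} ≠ ∞)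
    (hρ : ∀ x, ρ ≤ ‖x‖ → w x = 0) :
    ∫⁻ x : EuclideanSpace ℝ (Fin d), ENNReal.ofReal (deriv (rearr w) ‖x‖ ^ 2) ≤
      ∫⁻ x, ENNReal.ofReal (‖gradient w x‖ ^ 2) := by
  have : Nonempty (Fin d) := ⟨⟨0, by omega⟩⟩
  set e : ℕ → ℝ := fun n => 1 / ((n : ℝ) + 1) with he
  have he0 : ∀ n, 0 < e n := fun n => by positivity
  have he1 : ∀ n, e n ≤ 1 := fun n => by
    rw [he]; simp only; rw [div_le_one (by positivity)]
    have : (0 : ℝ) ≤ n := by positivity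
    linarith
  have hvL := lipschitzWith_rearr hd hw hM h0 hfin
  have hv := hvL.continuous
  have hdiv : ∀ (F : EuclideanSpace ℝ (Fin d) → ℝ) (n : ℕ),
      ∫⁻ x, ENNReal.ofReal ((F x / e n) ^ 2) =
        ENNReal.ofReal ((e n)⁻¹ ^ 2) * ∫⁻ x, ENNReal.ofReal (F x ^ 2) := by
    intro F n
    rw [← lintegral_const_mul' _ _ ENNReal.ofReal_ne_top]
    refine lintegral_congr fun x => ?_
    rw [← ENNReal.ofReal_mul (by positivity)]
    congr 1; field_simp
  have step : ∀ n, ∫⁻ x : EuclideanSpace ℝ (Fin d),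
      ENNReal.ofReal (((rearr w (‖x‖ - e n) - rearr w ‖x‖) / e n) ^ 2) ≤
      ∫⁻ x, ENNReal.ofReal (((supBall w (e n) x - w x) / e n) ^ 2) := by
    intro n
    rw [hdiv, hdiv]
    exact mul_le_mul' le_rfl (lintegral_rearr_shift_le hd hw hM h0 hfin (he0 n))
  have hlow : ∫⁻ x : EuclideanSpace ℝ (Fin d), ENNReal.ofReal (deriv (rearr w) ‖x‖ ^ 2) ≤
      liminf (fun n => ∫⁻ x : EuclideanSpace ℝ (Fin d),
        ENNReal.ofReal (((rearr w (‖x‖ - e n) - rearr w ‖x‖) / e n) ^ 2)) atTop := by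
    refine le_trans (lintegral_mono_ae ?_) (lintegral_liminf_le fun n => ?_)
    · have hL2 : LipschitzWith (L * 1) fun x : EuclideanSpace ℝ (Fin d) => rearr w ‖x‖ :=
        hvL.comp lipschitzWith_one_norm
      have hne : ∀ᵐ x : EuclideanSpace ℝ (Fin d), x ≠ 0 := by
        simp [ae_iff]
      filter_upwards [hL2.ae_differentiableAt (μ := volume), hne] with x hx hx0
      exact (tendsto_shift_quotient (differentiableAt_of_comp_norm hx0 hx)).liminf_eq.ge
    · exact ENNReal.measurable_ofReal.comp (((((hv.comp (continuous_norm.sub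
        continuous_const)).sub (hv.comp continuous_norm)).div_const _).pow 2).measurable)
  have hup : limsup (fun n => ∫⁻ x, ENNReal.ofReal (((supBall w (e n) x - w x) / e n) ^ 2))
      atTop ≤ ∫⁻ x, ENNReal.ofReal (‖gradient w x‖ ^ 2) := by
    refine le_trans (limsup_lintegral_le
      ((ball (0 : EuclideanSpace ℝ (Fin d)) (ρ + 2)).indicator fun _ => ENNReal.ofReal (L ^ 2))
      (fun n => ?_) (fun n => ae_of_all _ fun x => ?_) ?_) (lintegral_mono_ae ?_)
    · exact ENNReal.measurable_ofReal.comp ((((measurable_supBall hM (he0 n)).sub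
        hw.continuous.measurable).div_const _).pow_const 2)
    · by_cases hx : x ∈ ball (0 : EuclideanSpace ℝ (Fin d)) (ρ + 2)
      · rw [indicator_of_mem hx]
        refine ENNReal.ofReal_le_ofReal ?_
        refine pow_le_pow_left₀ (div_nonneg (sub_nonneg.2 (le_supBall hM (he0 n) x))
          (he0 n).le) ?_ 2
        rw [div_le_iff₀ (he0 n), sub_le_iff_le_add]
        refine supBall_le (he0 n) x fun y hy => ?_
        have h1 := hw.dist_le_mul y x
        rw [Real.dist_eq] at h1
        have h2 := le_abs_self (w y - w x)
        have h3 : (L : ℝ) * dist y x ≤ L * e n := by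
          gcongr; exact (mem_ball.1 hy).le
        linarith
      · rw [mem_ball_zero_iff, not_lt] at hx
        have h1 : w x = 0 := hρ x (by linarith)
        have h2 : supBall w (e n) x = 0 := by
          refine le_antisymm (supBall_le (he0 n) x fun y hy => ?_)
            (h1 ▸ le_supBall hM (he0 n) x)
          refine (hρ y ?_).le
          have := norm_sub_norm_le x y
          have h3 : ‖x - y‖ < e n := by rw [← dist_eq_norm, dist_comm]; exact hy
          linarith [he1 n]
        simp [h1, h2]
    · rw [lintegral_indicator measurableSet_ball, setLIntegral_const]
      exact ENNReal.mul_ne_top ENNReal.ofReal_ne_top measure_ball_lt_top.ne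
    · filter_upwards [hw.ae_differentiableAt (μ := volume)] with x hx
      exact limsup_supBall_le hM hx
  calc _ ≤ _ := hlow
    _ ≤ _ := liminf_le_liminf (Eventually.of_forall step)
    _ ≤ _ := liminf_le_limsup
    _ ≤ _ := hup

lemma integrable_of_le_of_support {f : EuclideanSpace ℝ (Fin d) → ℝ} (hf : Measurable f)
    {C ρ : ℝ} (hC : ∀ x, |f x| ≤ C) (hρ : ∀ x, ρ ≤ ‖x‖ → f x = 0) : Integrable f := by
  have : Integrable ((ball (0 : EuclideanSpace ℝ (Fin d)) ρ).indicator fun _ => C) :=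
    (integrable_indicator_iff measurableSet_ball).2
      (integrableOn_const measure_ball_lt_top.ne)
  refine this.mono' hf.aestronglyMeasurable (ae_of_all _ fun x => ?_)
  by_cases hx : x ∈ ball (0 : EuclideanSpace ℝ (Fin d)) ρ
  · rw [indicator_of_mem hx]; exact hC x
  · rw [indicator_of_notMem hx, hρ x (by simpa using hx)]; simp

lemma gradient_eq_zero_of_isLocalMin {f : EuclideanSpace ℝ (Fin d) → ℝ}
    {x : EuclideanSpace ℝ (Fin d)} (h : IsLocalMin f x) : gradient f x = 0 := by
  rw [gradient, h.fderiv_eq_zero, map_zero]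

lemma gradient_eq_zero_of_nonneg {f : EuclideanSpace ℝ (Fin d) → ℝ} (h0 : ∀ x, 0 ≤ f x)
    {x : EuclideanSpace ℝ (Fin d)} (hx : f x = 0) : gradient f x = 0 :=
  gradient_eq_zero_of_isLocalMin (Eventually.of_forall fun y => by rw [hx]; exact h0 y)

lemma integrable_norm_gradient_sq (hw : LipschitzWith L w) (h0 : ∀ x, 0 ≤ w x) {ρ : ℝ}
    (hρ : ∀ x, ρ ≤ ‖x‖ → w x = 0) : Integrable fun x => ‖gradient w x‖ ^ 2 := by
  refine integrable_of_le_of_support (C := L ^ 2) (ρ := ρ)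
    ((measurable_norm_gradient w).pow_const 2) (fun x => ?_) (fun x hx => ?_)
  · rw [abs_of_nonneg (by positivity)]
    exact pow_le_pow_left₀ (norm_nonneg _) (norm_gradient_le_of_lipschitz hw x) 2
  · rw [gradient_eq_zero_of_nonneg h0 (hρ x hx)]; simp

/-- Pólya–Szegő inequality for nonnegative Lipschitz functions with bounded support. -/
theorem exists_symmetrization (hd : 2 ≤ d) (hw : LipschitzWith L w) (h0 : ∀ x, 0 ≤ w x) {ρ a : ℝ}
    (hρ : ∀ x, ρ ≤ ‖x‖ → w x = 0)
    (hvol : volume (ball (0 : EuclideanSpace ℝ (Fin d)) a) = volume {x | 0 < w x}) :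
    ∃ v : ℝ → ℝ, LipschitzWith L v ∧ (∀ r, a ≤ r → v r = 0) ∧
      ∫ x : EuclideanSpace ℝ (Fin d), v ‖x‖ = ∫ x, w x ∧
      ∫ x : EuclideanSpace ℝ (Fin d), v ‖x‖ ^ 2 = ∫ x, w x ^ 2 ∧
      ∫ x : EuclideanSpace ℝ (Fin d), deriv v ‖x‖ ^ 2 ≤ ∫ x, ‖gradient w x‖ ^ 2 := by
  have : Nonempty (Fin d) := ⟨⟨0, by omega⟩⟩
  have hsub : ∀ t, 0 ≤ t → {x | t < w x} ⊆ ball 0 ρ := by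
    intro t ht x hx
    rw [mem_ball_zero_iff]
    by_contra hcon
    have := hρ x (not_lt.1 hcon)
    simp only [mem_ofPred_eq] at hx
    linarith
  have hfin : ∀ t, 0 ≤ t → volume {x | t < w x} ≠ ∞ := fun t ht =>
    ne_top_of_le_ne_top measure_ball_lt_top.ne (measure_mono (hsub t ht))
  obtain ⟨M, hM0, hM⟩ : ∃ M : ℝ, 0 ≤ M ∧ ∀ x, w x ≤ M := by
    obtain ⟨C, hC⟩ := ((isCompact_closedBall (0 : EuclideanSpace ℝ (Fin d)) ρ).image
      hw.continuous).bddAbove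
    refine ⟨max C 0, le_max_right _ _, fun x => ?_⟩
    rcases le_total ‖x‖ ρ with h | h
    · exact (hC (mem_image_of_mem _ (mem_closedBall_zero_iff.2 h))).trans (le_max_left _ _)
    · rw [hρ x h]; exact le_max_right _ _
  have hvL := lipschitzWith_rearr hd hw hM hM0 hfin
  have hvm : Measurable fun x : EuclideanSpace ℝ (Fin d) => rearr w ‖x‖ :=
    (hvL.continuous.comp continuous_norm).measurable
  have hv0 : ∀ r, 0 ≤ rearr w r := rearr_nonneg hM hM0
  have heq : ∀ t, 0 ≤ t → volume {x : EuclideanSpace ℝ (Fin d) | t < rearr w ‖x‖} =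
      volume {x | t < w x} := fun t ht => volume_superlevel_rearr_norm hd hM hM0 hfin ht
  refine ⟨rearr w, hvL, fun r hr => ?_, ?_, ?_, ?_⟩
  · refine le_antisymm (not_lt.1 fun h => ?_) (hv0 r)
    rw [lt_rearr_iff hM hM0 le_rfl, ← hvol] at h
    linarith [lt_of_volume_ball_lt h]
  · exact integral_eq_of_equimeasurable hvm hw.continuous.measurable (fun x => hv0 _) h0 heq
  · refine integral_eq_of_equimeasurable (hvm.pow_const 2) (hw.continuous.measurable.pow_const 2)
      (fun x => sq_nonneg _) (fun x => sq_nonneg _) fun t ht => ?_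
    have hsq : ∀ F : EuclideanSpace ℝ (Fin d) → ℝ, (∀ x, 0 ≤ F x) →
        {x | t < F x ^ 2} = {x | √t < F x} := by
      intro F hF; ext x
      exact (Real.sqrt_lt ht (hF x)).symm
    rw [hsq _ fun x => hv0 _, hsq _ h0]
    exact heq _ (Real.sqrt_nonneg t)
  · have hgi := integrable_norm_gradient_sq hw h0 hρ
    have hdm : Measurable fun x : EuclideanSpace ℝ (Fin d) => deriv (rearr w) ‖x‖ ^ 2 :=
      ((measurable_deriv (rearr w)).comp measurable_norm).pow_const 2
    rw [integral_eq_lintegral_of_nonneg_ae (ae_of_all _ fun x => sq_nonneg _)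
      hdm.aestronglyMeasurable,
      integral_eq_lintegral_of_nonneg_ae (ae_of_all _ fun x => sq_nonneg _)
      hgi.aestronglyMeasurable]
    refine ENNReal.toReal_mono ?_ (polyaSzego_lintegral hd hw hM hM0 hfin hρ)
    have := hgi.lintegral_lt_top
    exact this.ne

end Rearrangement

section BesselSeries

/-- The Taylor coefficients of the normalized Bessel functions `besselPhi`. -/
def besselCoeff (n : ℝ) (k : ℕ) : ℝ :=
  (-1) ^ k / (2 ^ k * k.factorial * ∏ j ∈ Finset.range k, (n + 2 * j))

/-- The entire function `Γ(n/2) (2/r)^(n/2-1) J_(n/2-1)(r)`, normalized to equal `1` at `0`. -/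
def besselPhi (n r : ℝ) : ℝ := ∑' k : ℕ, besselCoeff n k * r ^ (2 * k)

lemma besselCoeff_prod_pos {n : ℝ} (hn : 1 ≤ n) (k : ℕ) :
    0 < ∏ j ∈ Finset.range k, (n + 2 * (j : ℝ)) :=
  Finset.prod_pos fun j _ => by positivity

lemma abs_besselCoeff_le {n : ℝ} (hn : 1 ≤ n) (k : ℕ) :
    |besselCoeff n k| ≤ 1 / k.factorial := by
  have h1 : (1 : ℝ) ≤ ∏ j ∈ Finset.range k, (n + 2 * (j : ℝ)) :=
    Finset.one_le_prod fun j _ => by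
      have : (0 : ℝ) ≤ j := j.cast_nonneg
      linarith
  have h2 : (1 : ℝ) ≤ 2 ^ k := one_le_pow₀ one_le_two
  have h3 : (0 : ℝ) < k.factorial := by positivity
  rw [besselCoeff, abs_div, abs_pow, abs_neg, abs_one, one_pow,
    abs_of_pos (by have := besselCoeff_prod_pos hn k; positivity)]
  refine one_div_le_one_div_of_le h3 ?_
  calc (k.factorial : ℝ) = 1 * k.factorial * 1 := by ring
    _ ≤ _ := by gcongr

lemma besselCoeff_term_bound {n : ℝ} (hn : 1 ≤ n) {r R : ℝ} (hr : |r| ≤ R) (k : ℕ) :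
    ‖besselCoeff n k * r ^ (2 * k)‖ ≤ (R ^ 2) ^ k / k.factorial := by
  rw [Real.norm_eq_abs, abs_mul, abs_pow, pow_mul]
  calc |besselCoeff n k| * (|r| ^ 2) ^ k ≤ 1 / k.factorial * (R ^ 2) ^ k := by
        gcongr; exact abs_besselCoeff_le hn k
    _ = _ := by ring

lemma summable_besselPhi {n : ℝ} (hn : 1 ≤ n) (r : ℝ) :
    Summable fun k => besselCoeff n k * r ^ (2 * k) :=
  (Real.summable_pow_div_factorial (|r| ^ 2)).of_norm_bounded
    (fun k => besselCoeff_term_bound hn le_rfl k)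

lemma besselPhi_zero (n : ℝ) : besselPhi n 0 = 1 := by
  rw [besselPhi, tsum_eq_single 0]
  · simp [besselCoeff]
  · intro k hk; simp [hk]

lemma besselCoeff_succ {n : ℝ} (hn : 1 ≤ n) (k : ℕ) :
    besselCoeff n (k + 1) * (2 * (k + 1)) = -(1 / n) * besselCoeff (n + 2) k := by
  have h := besselCoeff_prod_pos (n := n + 2) (by linarith) k
  have hn0 : 0 < n := by linarith
  have e : ∏ j ∈ Finset.range (k + 1), (n + 2 * (j : ℝ)) =
      n * ∏ j ∈ Finset.range k, (n + 2 + 2 * (j : ℝ)) := by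
    rw [Finset.prod_range_succ', mul_comm]
    congr 1
    · simp
    · refine Finset.prod_congr rfl fun j _ => ?_
      push_cast; ring
  rw [besselCoeff, besselCoeff, e, Nat.factorial_succ]
  have hk : (0 : ℝ) < k.factorial := by positivity
  push_cast
  field_simp
  ring

lemma besselCoeff_rec {n : ℝ} (hn : 1 ≤ n) (k : ℕ) :
    besselCoeff n (k + 1) = besselCoeff (n + 2) (k + 1) -
      1 / (n * (n + 2)) * besselCoeff (n + 4) k := by
  have h1 := besselCoeff_succ hn k
  have h2 := besselCoeff_succ (n := n + 2) (by linarith) k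
  have h3 : besselCoeff (n + 2) k * (n + 2) = (n + 2 + 2 * k) * besselCoeff (n + 4) k := by
    have hp := besselCoeff_prod_pos (n := n + 2) (by linarith) k
    have hq := besselCoeff_prod_pos (n := n + 4) (by linarith) k
    have e : (∏ j ∈ Finset.range k, (n + 2 + 2 * (j : ℝ))) * (n + 2 + 2 * k) =
        (n + 2) * ∏ j ∈ Finset.range k, (n + 4 + 2 * (j : ℝ)) := by
      rw [← Finset.prod_range_succ (fun j : ℕ => n + 2 + 2 * (j : ℝ)),
        Finset.prod_range_succ', mul_comm]
      congr 1
      · simp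
      · refine Finset.prod_congr rfl fun j _ => ?_
        push_cast; ring
    rw [besselCoeff, besselCoeff, div_mul_eq_mul_div, mul_div_assoc', div_eq_div_iff
      (by positivity) (by positivity)]
    linear_combination (-((-1) ^ k * 2 ^ k * (k.factorial : ℝ))) * e
  rw [show n + 2 + 2 = n + 4 by ring] at h2
  have hn0 : 0 < n := by linarith
  have hk : (0 : ℝ) < 2 * (k + 1) := by positivity
  have e1 : besselCoeff n (k + 1) = -(1 / n) * besselCoeff (n + 2) k / (2 * (k + 1)) := by
    rw [← h1]; field_simp
  have e2 : besselCoeff (n + 2) (k + 1) =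
      -(1 / (n + 2)) * besselCoeff (n + 4) k / (2 * (k + 1)) := by
    rw [← h2]; field_simp
  have e3 : besselCoeff (n + 2) k = (n + 2 + 2 * k) * besselCoeff (n + 4) k / (n + 2) := by
    rw [← h3]; field_simp
  rw [e1, e2, e3]
  field_simp
  ring

lemma besselPhi_rec {n : ℝ} (hn : 1 ≤ n) (r : ℝ) :
    besselPhi n r = besselPhi (n + 2) r - r ^ 2 / (n * (n + 2)) * besselPhi (n + 4) r := by
  have h0 := summable_besselPhi hn r
  have h2 := summable_besselPhi (n := n + 2) (by linarith) r
  have h4 := summable_besselPhi (n := n + 4) (by linarith) r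
  rw [besselPhi, besselPhi, h0.tsum_eq_zero_add, h2.tsum_eq_zero_add, besselPhi, ← tsum_mul_left,
    add_sub_assoc, ← ((summable_nat_add_iff 1).2 h2).tsum_sub (h4.mul_left _)]
  rw [show besselCoeff n 0 = besselCoeff (n + 2) 0 by simp [besselCoeff]]
  congr 1
  refine tsum_congr fun k => ?_
  rw [besselCoeff_rec hn k]
  ring

lemma hasDerivAt_besselPhi {n : ℝ} (hn : 1 ≤ n) (r : ℝ) :
    HasDerivAt (besselPhi n) (-(r / n) * besselPhi (n + 2) r) r := by
  have hn0 : 0 < n := by linarith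
  set R := |r| + 1
  have hR : 0 < R := by positivity
  have hmem : r ∈ ball (0 : ℝ) R := by simp [R]
  have key := hasDerivAt_tsum_of_isPreconnected
    (g := fun (k : ℕ) (y : ℝ) => besselCoeff n (k + 1) * y ^ (2 * (k + 1)))
    (g' := fun (k : ℕ) (y : ℝ) => -(y / n) * (besselCoeff (n + 2) k * y ^ (2 * k)))
    (u := fun k : ℕ => R / n * ((R ^ 2) ^ k / k.factorial))
    (t := ball (0 : ℝ) R) (y₀ := r) (y := r)
    ((Real.summable_pow_div_factorial (R ^ 2)).mul_left _) isOpen_ball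
    (convex_ball _ _).isPreconnected (fun k y _ => ?_) (fun k y hy => ?_) hmem
    ((summable_nat_add_iff 1).2 (summable_besselPhi hn r)) hmem
  · rw [tsum_mul_left] at key
    have e : besselPhi n = fun y => besselCoeff n 0 * y ^ (2 * 0) +
        ∑' k : ℕ, besselCoeff n (k + 1) * y ^ (2 * (k + 1)) := by
      ext y
      rw [besselPhi, (summable_besselPhi hn y).tsum_eq_zero_add]
    rw [e]
    simpa [besselPhi] using key.const_add (besselCoeff n 0)
  · refine ((hasDerivAt_pow (2 * (k + 1)) y).const_mul (besselCoeff n (k + 1))).congr_deriv ?_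
    have := besselCoeff_succ hn k
    rw [show 2 * (k + 1) - 1 = 2 * k + 1 by omega]
    push_cast
    linear_combination y ^ (2 * k + 1) * this
  · have hy' : |y| ≤ R := by simpa using (mem_ball_zero_iff.1 hy).le
    rw [norm_mul, norm_neg, norm_div, Real.norm_eq_abs y, Real.norm_of_nonneg hn0.le]
    gcongr
    exact besselCoeff_term_bound (by linarith) hy' k

end BesselSeries

section BesselQuotient

variable {d : ℕ} {R r : ℝ}

lemma continuous_besselPhi {n : ℝ} (hn : 1 ≤ n) : Continuous (besselPhi n) :=
  continuous_iff_continuousAt.2 fun r => (hasDerivAt_besselPhi hn r).continuousAt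

lemma hasDerivAt_besselPhi_add_two (r : ℝ) :
    HasDerivAt (besselPhi (d + 2)) (-(r / (d + 2)) * besselPhi (d + 4) r) r := by
  have h := hasDerivAt_besselPhi (n := (d : ℝ) + 2) (by linarith [d.cast_nonneg (α := ℝ)]) r
  rwa [show (d : ℝ) + 2 + 2 = d + 4 by ring] at h

lemma hasDerivAt_besselPhi_add_four (hr : r ≠ 0) :
    HasDerivAt (besselPhi (d + 4))
      ((d + 2) * (besselPhi (d + 2) r - besselPhi (d + 4) r) / r) r := by
  have h := hasDerivAt_besselPhi (n := (d : ℝ) + 4) (by linarith [d.cast_nonneg (α := ℝ)]) r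
  have h2 := besselPhi_rec (n := (d : ℝ) + 2) (by linarith [d.cast_nonneg (α := ℝ)]) r
  refine h.congr_deriv ?_
  rw [h2, show (d : ℝ) + 2 + 2 = d + 4 by ring, show (d : ℝ) + 2 + 4 = d + 4 + 2 by ring]
  have : (d : ℝ) + 2 ≠ 0 := by positivity
  have : (d : ℝ) + 4 ≠ 0 := by positivity
  field_simp
  ring

lemma hasDerivAt_pow_succ_mul {f : ℝ → ℝ} {f' : ℝ} (hf : HasDerivAt f f' r) (k : ℕ) :
    HasDerivAt (fun x => x ^ (k + 1) * f x) (r ^ k * ((k + 1) * f r + r * f')) r := by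
  refine ((hasDerivAt_pow (k + 1) r).mul hf).congr_deriv ?_
  simp only [Nat.add_sub_cancel]
  push_cast
  ring

lemma strictMonoOn_Icc_of_hasDerivAt_pos {f f' : ℝ → ℝ} {a b : ℝ}
    (hc : ContinuousOn f (Icc a b)) (hf : ∀ x ∈ Ioo a b, HasDerivAt f (f' x) x)
    (hpos : ∀ x ∈ Ioo a b, 0 < f' x) : StrictMonoOn f (Icc a b) := by
  refine strictMonoOn_of_deriv_pos (convex_Icc a b) hc fun x hx => ?_
  rw [interior_Icc] at hx
  rw [(hf x hx).deriv]
  exact hpos x hx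

lemma monotoneOn_Icc_of_hasDerivAt_nonneg {f f' : ℝ → ℝ} {a b : ℝ}
    (hc : ContinuousOn f (Icc a b)) (hf : ∀ x ∈ Ioo a b, HasDerivAt f (f' x) x)
    (hpos : ∀ x ∈ Ioo a b, 0 ≤ f' x) : MonotoneOn f (Icc a b) := by
  refine monotoneOn_of_deriv_nonneg (convex_Icc a b) hc ?_ ?_
  · rw [interior_Icc]
    exact fun x hx => (hf x hx).differentiableAt.differentiableWithinAt
  · rw [interior_Icc]
    intro x hx
    rw [(hf x hx).deriv]
    exact hpos x hx

lemma besselPhi_add_four_pos_of_pos (hR : 0 < R)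
    (h : ∀ r ∈ Ico 0 R, 0 < besselPhi (d + 2) r) (hr : r ∈ Icc 0 R) :
    0 < besselPhi (d + 4) r := by
  have hd : (0 : ℝ) ≤ d := d.cast_nonneg
  rcases hr.1.eq_or_lt with h0 | h0
  · rw [← h0, besselPhi_zero]; exact one_pos
  have hmono : StrictMonoOn (fun x => x ^ (d + 1 + 1) * besselPhi (d + 4) x) (Icc 0 R) := by
    refine strictMonoOn_Icc_of_hasDerivAt_pos
      (((continuous_pow _).mul (continuous_besselPhi (by linarith))).continuousOn)
      (fun x hx => hasDerivAt_pow_succ_mul (hasDerivAt_besselPhi_add_four hx.1.ne') (d + 1))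
      (fun x hx => ?_)
    have hx0 := hx.1
    have hB := h x ⟨hx0.le, hx.2⟩
    refine mul_pos (by positivity) ?_
    rw [mul_div_cancel₀ _ hx0.ne']
    push_cast
    have : 0 < ((d : ℝ) + 2) * besselPhi (d + 2) x := by positivity
    linarith
  have := hmono ⟨le_rfl, hR.le⟩ hr h0
  simp only [ne_eq, Nat.add_eq_zero_iff, one_ne_zero, and_false, not_false_eq_true, zero_pow,
    zero_mul] at this
  exact pos_of_mul_pos_right this (by positivity)

/-- The logarithmic-derivative quotient `r J_(d/2)(r) / J_(d/2+1)(r)`. -/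
def besselQuot (d : ℕ) (r : ℝ) : ℝ := (d + 2) * besselPhi (d + 2) r / besselPhi (d + 4) r

lemma hasDerivAt_besselQuot (hr : r ≠ 0) (hC : besselPhi (d + 4) r ≠ 0) :
    HasDerivAt (besselQuot d)
      (((d + 2) * besselQuot d r - r ^ 2 - besselQuot d r ^ 2) / r) r := by
  refine (((hasDerivAt_besselPhi_add_two r).const_mul ((d : ℝ) + 2)).div
    (hasDerivAt_besselPhi_add_four hr) hC).congr_deriv ?_
  have : (d : ℝ) + 2 ≠ 0 := by positivity
  rw [besselQuot]
  field_simp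
  ring

lemma exists_besselPhi_eq_zero (d : ℕ) : ∃ r, 0 < r ∧ besselPhi (d + 2) r = 0 := by
  by_contra hcon
  push Not at hcon
  have hd : (0 : ℝ) ≤ d := d.cast_nonneg
  have hBc : Continuous (besselPhi (d + 2)) := continuous_besselPhi (by linarith)
  have hB : ∀ r, 0 ≤ r → 0 < besselPhi (d + 2) r := by
    intro r hr
    by_contra hneg
    obtain ⟨x, hx, hx0⟩ := intermediate_value_Icc' hr hBc.continuousOn
      (show (0 : ℝ) ∈ Icc (besselPhi (d + 2) r) (besselPhi (d + 2) 0) from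
        ⟨not_lt.1 hneg, by rw [besselPhi_zero]; exact zero_le_one⟩)
    rcases hx.1.eq_or_lt with h | h
    · rw [← h, besselPhi_zero] at hx0; exact one_ne_zero hx0
    · exact hcon x h hx0
  have hC : ∀ r, 0 < r → 0 < besselPhi (d + 4) r := fun r hr =>
    besselPhi_add_four_pos_of_pos hr (fun x hx => hB x hx.1) ⟨hr.le, le_rfl⟩
  set Q := besselQuot d
  have hQ : ∀ r, 0 < r → 0 < Q r := fun r hr =>
    div_pos (mul_pos (by positivity) (hB r hr.le)) (hC r hr)
  set a : ℝ := d + 2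
  have ha : 2 ≤ a := by simp [a]
  set b := a + Q a + 1
  have hab : a < b := by have := hQ a (by linarith); simp only [b]; linarith
  have hder : ∀ x, a ≤ x → HasDerivAt Q ((a * Q x - x ^ 2 - Q x ^ 2) / x) x := fun x hx =>
    hasDerivAt_besselQuot (by linarith) (hC x (by linarith)).ne'
  have hanti : MonotoneOn (fun x => -(Q x + x)) (Icc a b) := by
    refine monotoneOn_Icc_of_hasDerivAt_nonneg (fun x hx =>
      ((hder x hx.1).continuousAt.add continuousAt_id).neg.continuousWithinAt)
      (fun x hx => ((hder x hx.1.le).add (hasDerivAt_id x)).neg) (fun x hx => ?_)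
    have hx0 : 0 < x := by linarith [hx.1]
    rw [Left.nonneg_neg_iff, ← le_neg_iff_add_nonpos_right, div_le_iff₀ hx0]
    nlinarith [sq_nonneg (Q x - a / 2), hx.1]
  have h1 := hanti ⟨le_rfl, hab.le⟩ ⟨hab.le, le_rfl⟩ hab.le
  have h2 := hQ b (by linarith)
  simp only [b] at h1 h2
  linarith

/-- `R` is the first positive zero of the Bessel function `J_(d/2)`. -/
structure IsFirstZero (d : ℕ) (R : ℝ) : Prop where
  pos : 0 < R
  eq_zero : besselPhi (d + 2) R = 0
  pos_of_lt : ∀ r ∈ Ico 0 R, 0 < besselPhi (d + 2) r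

lemma exists_isFirstZero (d : ℕ) : ∃ R, IsFirstZero d R := by
  have hd : (0 : ℝ) ≤ d := d.cast_nonneg
  have hBc : Continuous (besselPhi (d + 2)) := continuous_besselPhi (by linarith)
  set S := {r : ℝ | 0 ≤ r ∧ besselPhi (d + 2) r = 0}
  have hSc : IsClosed S :=
    (isClosed_le continuous_const continuous_id).inter (isClosed_eq hBc continuous_const)
  obtain ⟨x, hx, hx0⟩ := exists_besselPhi_eq_zero d
  have hbdd : BddBelow S := ⟨0, fun y hy => hy.1⟩
  have hmem : sInf S ∈ S := hSc.csInf_mem ⟨x, hx.le, hx0⟩ hbdd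
  refine ⟨sInf S, lt_of_le_of_ne hmem.1 fun h => ?_, hmem.2, fun r hr => ?_⟩
  · have := hmem.2
    rw [← h, besselPhi_zero] at this
    exact one_ne_zero this
  · by_contra hneg
    obtain ⟨y, hy, hy0⟩ := intermediate_value_Icc' hr.1 hBc.continuousOn
      (show (0 : ℝ) ∈ Icc (besselPhi (d + 2) r) (besselPhi (d + 2) 0) from
        ⟨not_lt.1 hneg, by rw [besselPhi_zero]; exact zero_le_one⟩)
    have := csInf_le hbdd (show y ∈ S from ⟨hy.1, hy0⟩)
    linarith [hy.2, hr.2]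

namespace IsFirstZero

lemma besselPhi_add_four_pos (h : IsFirstZero d R) (hr : r ∈ Icc 0 R) :
    0 < besselPhi (d + 4) r :=
  besselPhi_add_four_pos_of_pos h.pos h.pos_of_lt hr

lemma continuousOn_quot (h : IsFirstZero d R) : ContinuousOn (besselQuot d) (Icc 0 R) := by
  have hd : (0 : ℝ) ≤ d := d.cast_nonneg
  exact ((continuous_const.mul (continuous_besselPhi (by linarith))).continuousOn).div
    (continuous_besselPhi (by linarith)).continuousOn
    fun x hx => (h.besselPhi_add_four_pos hx).ne'

lemma quot_zero : besselQuot d 0 = d + 2 := by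
  rw [besselQuot, besselPhi_zero, besselPhi_zero]; ring

lemma quot_self (h : IsFirstZero d R) : besselQuot d R = 0 := by
  rw [besselQuot, h.eq_zero]; simp

lemma quot_pos (h : IsFirstZero d R) (hr : r ∈ Ico 0 R) : 0 < besselQuot d r :=
  div_pos (mul_pos (by positivity) (h.pos_of_lt r hr))
    (h.besselPhi_add_four_pos ⟨hr.1, hr.2.le⟩)

lemma hasDerivAt_quot (h : IsFirstZero d R) (hr : r ∈ Ioc 0 R) :
    HasDerivAt (besselQuot d)
      (((d + 2) * besselQuot d r - r ^ 2 - besselQuot d r ^ 2) / r) r :=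
  hasDerivAt_besselQuot hr.1.ne' (h.besselPhi_add_four_pos ⟨hr.1.le, hr.2⟩).ne'

lemma quot_defect_pos (h : IsFirstZero d R) (hr : r ∈ Ioc 0 R) :
    0 < besselQuot d r ^ 2 - (d + 2) * besselQuot d r + r ^ 2 := by
  have hd : (0 : ℝ) ≤ d := d.cast_nonneg
  have hBc : Continuous (besselPhi (d + 2)) := continuous_besselPhi (by linarith)
  have hCc : Continuous (besselPhi (d + 4)) := continuous_besselPhi (by linarith)
  have hmono : StrictMonoOn (fun x => x ^ (d + 1 + 1) * (besselPhi (d + 2) x ^ 2 -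
      besselPhi (d + 2) x * besselPhi (d + 4) x + (x * besselPhi (d + 4) x / (d + 2)) ^ 2))
      (Icc 0 R) := by
    refine strictMonoOn_Icc_of_hasDerivAt_pos (by fun_prop) (fun x hx =>
      hasDerivAt_pow_succ_mul ((((hasDerivAt_besselPhi_add_two x).pow 2).sub
        ((hasDerivAt_besselPhi_add_two x).mul (hasDerivAt_besselPhi_add_four hx.1.ne'))).add
        ((((hasDerivAt_id x).mul (hasDerivAt_besselPhi_add_four hx.1.ne')).div_const
          ((d : ℝ) + 2)).pow 2)) (d + 1)) (fun x hx => ?_)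
    have hx0 := hx.1
    have hC := h.besselPhi_add_four_pos ⟨hx0.le, hx.2.le⟩
    refine mul_pos (by positivity) ?_
    have hpos : 0 < 2 * (x * besselPhi (d + 4) x / (d + 2)) ^ 2 := by positivity
    refine hpos.trans_eq ?_
    have : (d : ℝ) + 2 ≠ 0 := by positivity
    simp only [id, Pi.mul_apply, Pi.add_apply, Pi.sub_apply, Pi.pow_apply]
    push_cast
    field_simp
    ring
  have h1 := hmono ⟨le_rfl, h.pos.le⟩ ⟨hr.1.le, hr.2⟩ hr.1
  simp only [ne_eq, Nat.add_eq_zero_iff, one_ne_zero, and_false, not_false_eq_true, zero_pow,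
    zero_mul] at h1
  have h2 := pos_of_mul_pos_right h1 (pow_nonneg hr.1.le _)
  have hC := h.besselPhi_add_four_pos ⟨hr.1.le, hr.2⟩
  have h3 : 0 < (d + 2) ^ 2 / besselPhi (d + 4) r ^ 2 * (besselPhi (d + 2) r ^ 2 -
      besselPhi (d + 2) r * besselPhi (d + 4) r + (r * besselPhi (d + 4) r / (d + 2)) ^ 2) :=
    mul_pos (by positivity) h2
  refine h3.trans_eq ?_
  rw [besselQuot]
  field_simp

lemma quot_strictAntiOn (h : IsFirstZero d R) : StrictAntiOn (besselQuot d) (Icc 0 R) := by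
  refine strictAntiOn_of_deriv_neg (convex_Icc 0 R) h.continuousOn_quot fun x hx => ?_
  rw [interior_Icc] at hx
  have hx' : x ∈ Ioc 0 R := ⟨hx.1, hx.2.le⟩
  rw [(h.hasDerivAt_quot hx').deriv]
  exact div_neg_of_neg_of_pos (by linarith [h.quot_defect_pos hx']) hx.1

lemma quot_lt (h : IsFirstZero d R) (hr : r ∈ Ioc 0 R) : besselQuot d r < d + 2 := by
  rw [← quot_zero]
  exact h.quot_strictAntiOn ⟨le_rfl, h.pos.le⟩ ⟨hr.1.le, hr.2⟩ hr.1

lemma quot_nonneg (h : IsFirstZero d R) (hr : r ∈ Icc 0 R) : 0 ≤ besselQuot d r := by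
  rw [← h.quot_self]
  exact h.quot_strictAntiOn.antitoneOn hr ⟨h.pos.le, le_rfl⟩ hr.2

lemma le_quot_defect (h : IsFirstZero d R) (hr : r ∈ Ioc 0 R) :
    2 * r ^ 2 / (d + 4) ≤ besselQuot d r ^ 2 - (d + 2) * besselQuot d r + r ^ 2 := by
  have hd : (0 : ℝ) ≤ d := d.cast_nonneg
  have hc := h.continuousOn_quot
  have hmono : MonotoneOn (fun x => x ^ (d + 1 + 1) * (besselQuot d x ^ 2 -
      (d + 2) * besselQuot d x + x ^ 2 - 2 * x ^ 2 / (d + 4))) (Icc 0 R) := by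
    refine monotoneOn_Icc_of_hasDerivAt_nonneg (by fun_prop) (fun x hx =>
      have hx' := h.hasDerivAt_quot (r := x) ⟨hx.1, hx.2.le⟩
      hasDerivAt_pow_succ_mul ((((hx'.pow 2).sub (hx'.const_mul ((d : ℝ) + 2))).add
        (hasDerivAt_pow 2 x)).sub (((hasDerivAt_pow 2 x).const_mul 2).div_const ((d : ℝ) + 4)))
        (d + 1)) (fun x hx => ?_)
    have hx0 := hx.1
    have h1 := h.quot_defect_pos ⟨hx0, hx.2.le⟩
    have h2 := h.quot_lt ⟨hx0, hx.2.le⟩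
    refine mul_nonneg (by positivity) ?_
    have hpos := (mul_pos (mul_pos two_pos (sub_pos.2 h2)) h1).le
    refine hpos.trans_eq ?_
    have : (d : ℝ) + 4 ≠ 0 := by positivity
    simp only [Pi.add_apply, Pi.sub_apply, Pi.pow_apply]
    push_cast
    field_simp
    ring
  have h1 := hmono ⟨le_rfl, h.pos.le⟩ ⟨hr.1.le, hr.2⟩ hr.1.le
  simp only [ne_eq, Nat.add_eq_zero_iff, one_ne_zero, and_false, not_false_eq_true, zero_pow,
    zero_mul] at h1
  linarith [nonneg_of_mul_nonneg_right h1 (pow_pos hr.1 _)]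

lemma quot_le (h : IsFirstZero d R) (hr : r ∈ Icc 0 R) :
    besselQuot d r ≤ d + 2 - r ^ 2 / (d + 4) := by
  have hc := h.continuousOn_quot
  have hmono : MonotoneOn (fun x => -(besselQuot d x + x ^ 2 / (d + 4))) (Icc 0 R) := by
    refine monotoneOn_Icc_of_hasDerivAt_nonneg (by fun_prop) (fun x hx =>
      ((h.hasDerivAt_quot (r := x) ⟨hx.1, hx.2.le⟩).add
        ((hasDerivAt_pow 2 x).div_const ((d : ℝ) + 4))).neg) (fun x hx => ?_)
    have hx0 := hx.1
    have h1 := h.le_quot_defect ⟨hx0, hx.2.le⟩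
    rw [Left.nonneg_neg_iff, ← le_neg_iff_add_nonpos_right, div_le_iff₀ hx0]
    have : ((2 : ℕ) : ℝ) * x ^ (2 - 1) / (d + 4) * x = 2 * x ^ 2 / (d + 4) := by
      push_cast; ring
    linarith
  have h1 := hmono ⟨le_rfl, h.pos.le⟩ hr hr.1
  simp only [quot_zero] at h1
  norm_num at h1
  linarith

/-- The first zero of `J_(d/2-1)` lies below that of `J_(d/2)`. -/
lemma exists_balanced (hd : 2 ≤ d) (h : IsFirstZero d R) :
    ∃ r₀ ∈ Ioo 0 R, d * besselQuot d r₀ = r₀ ^ 2 ∧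
      (∀ r ∈ Ico 0 r₀, r ^ 2 < d * besselQuot d r) ∧
      (∀ r ∈ Ioc r₀ R, d * besselQuot d r < r ^ 2) := by
  have hd0 : (0 : ℝ) < d := by positivity
  have hc := h.continuousOn_quot
  have hanti : StrictAntiOn (fun x => d * besselQuot d x - x ^ 2) (Icc 0 R) := by
    intro x hx y hy hxy
    have h1 := h.quot_strictAntiOn hx hy hxy
    have h2 : x ^ 2 < y ^ 2 := pow_lt_pow_left₀ hxy hx.1 two_ne_zero
    have h3 := mul_lt_mul_of_pos_left h1 hd0
    simp only
    linarith
  have h0 : (0 : ℝ) < d * besselQuot d 0 - 0 ^ 2 := by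
    rw [quot_zero]; ring_nf; positivity
  have h1 : d * besselQuot d R - R ^ 2 < 0 := by
    rw [h.quot_self]; have := h.pos; simp; positivity
  obtain ⟨r₀, hr, hr0⟩ := intermediate_value_Ioo' h.pos.le
    (show ContinuousOn (fun x => d * besselQuot d x - x ^ 2) (Icc 0 R) by fun_prop)
    (show (0 : ℝ) ∈ Ioo _ _ from ⟨h1, h0⟩)
  simp only at hr0
  refine ⟨r₀, hr, by linarith, fun r hr' => ?_, fun r hr' => ?_⟩
  · have := hanti ⟨hr'.1, by linarith [hr'.2, hr.2]⟩ ⟨hr.1.le, hr.2.le⟩ hr'.2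
    simp only at this; linarith
  · have := hanti ⟨hr.1.le, hr.2.le⟩ ⟨by linarith [hr'.1, hr.1], hr'.2⟩ hr'.1
    simp only at this; linarith

lemma two_mul_balanced_pow_le (hd : 2 ≤ d) (h : IsFirstZero d R) {r₀ : ℝ} (hr : r₀ ∈ Ioo 0 R)
    (hr0 : d * besselQuot d r₀ = r₀ ^ 2)
    (hlt : ∀ r ∈ Ioc r₀ R, d * besselQuot d r < r ^ 2) : 2 * r₀ ^ d ≤ R ^ d := by
  have hd0 : (2 : ℝ) ≤ d := by exact_mod_cast hd
  have hr1 := hr.1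
  have hR := h.pos
  rcases le_or_gt (R ^ 2) (3 * d ^ 2) with hRd | hRd
  · obtain ⟨k, rfl⟩ : ∃ k, d = k + 1 := ⟨d - 1, by omega⟩
    set D : ℝ := ((k + 1 : ℕ) : ℝ) with hD
    set s : ℝ → ℝ := fun x => D * besselQuot (k + 1) x / x ^ 2
    have hs : ∀ x ∈ Ioc 0 R, HasDerivAt s
        ((-(D * (1 - s x)) - x ^ 2 / D * s x ^ 2) / x) x := by
      intro x hx
      have hx0 : x ≠ 0 := hx.1.ne'
      refine (((h.hasDerivAt_quot hx).const_mul D).div (hasDerivAt_pow 2 x)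
        (by positivity)).congr_deriv ?_
      simp only [s, ← hD]
      push_cast
      field_simp
      ring
    have hmono : MonotoneOn (fun x => x ^ (k + 1) * (1 + s x + s x ^ 2 / 2 - s x ^ 3 / 2))
        (Icc r₀ R) := by
      refine monotoneOn_Icc_of_hasDerivAt_nonneg (fun x hx => ?_) (fun x hx =>
        have hx' := hs x ⟨by linarith [hx.1], hx.2.le⟩
        hasDerivAt_pow_succ_mul (((hx'.const_add 1).add ((hx'.pow 2).div_const 2)).sub
          ((hx'.pow 3).div_const 2)) k) (fun x hx => ?_)
      · have := (hs x ⟨by linarith [hx.1], hx.2⟩).continuousAt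
        exact ContinuousAt.continuousWithinAt (by fun_prop)
      · have hx0 : 0 < x := by linarith [hx.1]
        have hn := h.quot_nonneg (r := x) ⟨hx0.le, hx.2.le⟩
        have hx1 := (hlt x ⟨hx.1, hx.2.le⟩).le
        have s0 : 0 ≤ s x := by positivity
        have s1 : s x ≤ 1 := (div_le_one (by positivity)).2 hx1
        have hD1 : ((k : ℝ) + 1) = D := by rw [hD]; push_cast; ring
        refine mul_nonneg (by positivity) ?_
        rw [hD1]
        simp only [Pi.add_apply, Pi.sub_apply, Pi.pow_apply]
        generalize s x = σ at *
        have hxd : x ^ 2 / D ≤ 3 * D := by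
          rw [div_le_iff₀ (by linarith)]
          have : x ^ 2 ≤ R ^ 2 := by gcongr; exact hx.2.le
          linarith
        have hrho : 0 ≤ 1 + σ - 3 / 2 * σ ^ 2 := by nlinarith
        have hq : 0 ≤ 1 - 5 * σ ^ 2 + 9 / 2 * σ ^ 3 := by
          nlinarith [mul_nonneg s0 (sq_nonneg (σ - 3 / 4)), sq_nonneg (σ - 3 / 4)]
        have hkey : (1 + σ - 3 / 2 * σ ^ 2) * (D * (1 - σ) + x ^ 2 / D * σ ^ 2) ≤
            D * (1 + σ + σ ^ 2 / 2 - σ ^ 3 / 2) := by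
          calc _ ≤ (1 + σ - 3 / 2 * σ ^ 2) * (D * (1 - σ) + 3 * D * σ ^ 2) := by gcongr
            _ ≤ _ := by
              have : 0 ≤ D * (σ * (1 - 5 * σ ^ 2 + 9 / 2 * σ ^ 3)) := by positivity
              linarith
        have e : ∀ y : ℝ, x * (y / x) = y := fun y => mul_div_cancel₀ y hx0.ne'
        have : x * ((-(D * (1 - σ)) - x ^ 2 / D * σ ^ 2) / x +
            ((2 : ℕ) : ℝ) * σ ^ (2 - 1) * ((-(D * (1 - σ)) - x ^ 2 / D * σ ^ 2) / x) / 2 -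
            ((3 : ℕ) : ℝ) * σ ^ (3 - 1) * ((-(D * (1 - σ)) - x ^ 2 / D * σ ^ 2) / x) / 2) =
            -((1 + σ - 3 / 2 * σ ^ 2) * (D * (1 - σ) + x ^ 2 / D * σ ^ 2)) := by
          push_cast
          field_simp
          ring
        rw [this]
        linarith
    have h1 := hmono ⟨le_rfl, hr.2.le⟩ ⟨hr.2.le, le_rfl⟩ hr.2.le
    have e0 : s r₀ = 1 := by simp only [s]; rw [hr0]; exact div_self (by positivity)
    have e1 : s R = 0 := by simp only [s]; rw [h.quot_self]; simp
    simp only [e0, e1] at h1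
    linarith
  · have h1 := h.quot_le (r := r₀) ⟨hr.1.le, hr.2.le⟩
    have h2 : r₀ ^ 2 ≤ 3 / 2 * d ^ 2 := by
      have h3 : r₀ ^ 2 * (1 + d / (d + 4)) ≤ d * (d + 2) := by
        have := mul_le_mul_of_nonneg_left h1 (by linarith : (0 : ℝ) ≤ d)
        rw [hr0] at this
        have e : (d : ℝ) * (d + 2 - r₀ ^ 2 / (d + 4)) = d * (d + 2) - r₀ ^ 2 * (d / (d + 4)) := by
          ring
        linarith
      have e : (1 : ℝ) + d / (d + 4) = 2 * (d + 2) / (d + 4) := by field_simp; ring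
      rw [e, mul_div_assoc', div_le_iff₀ (by positivity)] at h3
      have h4 : r₀ ^ 2 * 2 ≤ d * (d + 4) := by
        have : (0 : ℝ) < d + 2 := by positivity
        nlinarith
      nlinarith
    have h3 : 2 * r₀ ^ 2 ≤ R ^ 2 := by linarith
    refine le_of_sq_le_sq ?_ (by positivity)
    calc (2 * r₀ ^ d) ^ 2 = 2 ^ 2 * (r₀ ^ 2) ^ d := by ring
      _ ≤ 2 ^ d * (r₀ ^ 2) ^ d := by gcongr; exact one_le_two
      _ = (2 * r₀ ^ 2) ^ d := by rw [mul_pow]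
      _ ≤ (R ^ 2) ^ d := by gcongr
      _ = (R ^ d) ^ 2 := by ring

end IsFirstZero

end BesselQuotient

section Calibration

variable {d : ℕ} {R a b : ℝ} {L : ℝ≥0} {v : ℝ → ℝ}

lemma absolutelyContinuousOnInterval_of_hasDerivAt {f f' : ℝ → ℝ} (hab : a ≤ b)
    (hf : ∀ x ∈ Icc a b, HasDerivAt f (f' x) x) (hc : ContinuousOn f' (Icc a b)) :
    AbsolutelyContinuousOnInterval f a b := by
  obtain ⟨C, hC⟩ := isCompact_Icc.exists_bound_of_continuousOn hc
  refine LipschitzOnWith.absolutelyContinuousOnInterval (K := C.toNNReal) ?_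
  rw [uIcc_of_le hab]
  refine Convex.lipschitzOnWith_of_nnnorm_hasDerivWithin_le (convex_Icc a b)
    (fun x hx => (hf x hx).hasDerivWithinAt) fun x hx => ?_
  rw [← NNReal.coe_le_coe, coe_nnnorm]
  exact (hC x hx).trans (Real.le_coe_toNNReal C)

lemma intervalIntegrable_deriv_sq_sub_mul_pow (hv : LipschitzWith L v) (k : ℕ) (a b : ℝ) :
    IntervalIntegrable (fun s => (deriv v s ^ 2 - v s ^ 2) * s ^ k) volume a b := by
  have h1 : IntervalIntegrable (fun s => deriv v s ^ 2) volume a b := by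
    rw [intervalIntegrable_iff]
    refine Measure.integrableOn_of_bounded (M := (L : ℝ) ^ 2) (by simp)
      ((measurable_deriv v).pow_const 2).aestronglyMeasurable (ae_of_all _ fun s => ?_)
    rw [norm_pow]
    exact pow_le_pow_left₀ (norm_nonneg _) (norm_deriv_le_of_lipschitz hv) 2
  exact (h1.sub ((hv.continuous.pow 2).intervalIntegrable a b)).mul_continuousOn
    (continuous_pow k).continuousOn

/-- The Dirichlet energy defect on `[0, a]` is bounded below by the square of the mean. -/
lemma mul_sq_integral_le_energy_defect (hd : 2 ≤ d) (h : IsFirstZero d R) (ha : a ∈ Ioc 0 R)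
    (hv : LipschitzWith L v) (hva : v a = 0) :
    d * ((d * besselQuot d a - a ^ 2) / a ^ (d + 2)) * (∫ s in 0..a, v s * s ^ (d - 1)) ^ 2 ≤
      ∫ s in 0..a, (deriv v s ^ 2 - v s ^ 2) * s ^ (d - 1) := by
  obtain ⟨k, rfl⟩ : ∃ k, d = k + 1 := ⟨d - 1, by omega⟩
  simp only [Nat.add_sub_cancel]
  set D : ℝ := ((k + 1 : ℕ) : ℝ) with hD
  have hD0 : 0 < D := by rw [hD]; positivity
  have hDk : D = k + 1 := by rw [hD]; push_cast; ring
  set N := besselQuot (k + 1)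
  set f : ℝ → ℝ := fun s => (deriv v s ^ 2 - v s ^ 2) * s ^ k
  have hvc := hv.continuous
  have hfi : ∀ x y, IntervalIntegrable f volume x y :=
    intervalIntegrable_deriv_sq_sub_mul_pow hv k
  set S : ℝ → ℝ := fun r => ∫ s in 0..r, v s * s ^ k
  have hSc : Continuous fun s => v s * s ^ k := hvc.mul (continuous_pow k)
  have hS : ∀ r, HasDerivAt S (v r * r ^ k) r := fun r =>
    intervalIntegral.integral_hasDerivAt_right (hSc.intervalIntegrable _ _)
      (hSc.stronglyMeasurableAtFilter _ _) hSc.continuousAt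
  set T : ℝ → ℝ := fun r => S r - r ^ (k + 1) / D * v r
  set H : ℝ → ℝ := fun r => D ^ 2 * (N r / r ^ (k + 3) * (T r * T r)) -
    D * (1 / r ^ (k + 1) * (S r * S r))
  have hN : ∀ r ∈ Ioc 0 R, HasDerivAt N (((D + 2) * N r - r ^ 2 - N r ^ 2) / r) r :=
    fun r hr => h.hasDerivAt_quot hr
  have hT : ∀ r, DifferentiableAt ℝ v r → HasDerivAt T (-(r ^ (k + 1) / D * deriv v r)) r := by
    intro r hr
    refine ((hS r).sub (((hasDerivAt_pow (k + 1) r).div_const D).mul hr.hasDerivAt)).congr_deriv ?_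
    rw [← hD, Nat.add_sub_cancel]
    field_simp
    ring
  have hH : ∀ r ∈ Ioc 0 R, DifferentiableAt ℝ v r →
      HasDerivAt H (f r - r ^ k * (deriv v r + D * N r * T r / r ^ (k + 2)) ^ 2) r := by
    intro r hr hr'
    have hr0 : r ≠ 0 := hr.1.ne'
    refine ((((((hN r hr).div (hasDerivAt_pow (k + 3) r) (by positivity)).mul
      ((hT r hr').mul (hT r hr'))).const_mul (D ^ 2))).sub
      ((((hasDerivAt_const r (1 : ℝ)).div (hasDerivAt_pow (k + 1) r) (by positivity)).mul
        ((hS r).mul (hS r))).const_mul D)).congr_deriv ?_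
    have e1 : ((k + 3 : ℕ) : ℝ) = D + 2 := by rw [hDk]; push_cast; ring
    have e2 : k + 3 - 1 = k + 2 := by omega
    simp only [Pi.mul_apply, Pi.div_apply]
    rw [← hD, e1, e2, Nat.add_sub_cancel]
    simp only [f]
    have eT : S r = T r + r ^ (k + 1) / D * v r := by simp only [T]; ring
    rw [eT]
    generalize T r = t
    generalize N r = n
    generalize deriv v r = p
    generalize v r = q
    field_simp
    ring
  have hTb : ∀ r, 0 ≤ r → |T r| ≤ L * r ^ (k + 2) := by
    intro r hr
    have e : T r = ∫ s in 0..r, (v s - v r) * s ^ k := by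
      have h1 : ∫ s in 0..r, v r * s ^ k = r ^ (k + 1) / D * v r := by
        rw [intervalIntegral.integral_const_mul, integral_pow, hDk]; simp; ring
      have h2 : T r = S r - ∫ s in 0..r, v r * s ^ k := by rw [h1]
      have h3 : Continuous fun s : ℝ => v r * s ^ k := continuous_const.mul (continuous_pow k)
      rw [h2, ← intervalIntegral.integral_sub (hSc.intervalIntegrable _ _)
        (h3.intervalIntegrable _ _)]
      exact intervalIntegral.integral_congr fun s _ => by ring
    have h2 := intervalIntegral.norm_integral_le_of_norm_le_const (a := 0) (b := r)
      (f := fun s => (v s - v r) * s ^ k) (C := L * r ^ (k + 1)) fun s hs => by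
        rw [uIoc_of_le hr] at hs
        rw [norm_mul, norm_pow, Real.norm_of_nonneg hs.1.le, ← dist_eq_norm]
        have h3 : dist (v s) (v r) ≤ L * r := (hv.dist_le_mul s r).trans (by
          gcongr
          rw [Real.dist_eq, abs_sub_comm, abs_of_nonneg (by linarith [hs.2])]
          linarith [hs.1])
        calc dist (v s) (v r) * s ^ k ≤ L * r * r ^ k := by
              have := hs.1.le
              gcongr
              exact hs.2
          _ = L * r ^ (k + 1) := by ring
    rw [e, ← Real.norm_eq_abs]
    refine h2.trans_eq ?_
    rw [sub_zero, abs_of_nonneg hr]; ring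
  have hHb : ∀ r ∈ Ioc 0 R, H r ≤ D ^ 2 * (D + 2) * L ^ 2 * r ^ (k + 1) := by
    intro r hr
    have hr0 := hr.1
    have h1 : N r ≤ D + 2 := (h.quot_lt hr).le
    have h2 : 0 ≤ N r := h.quot_nonneg ⟨hr0.le, hr.2⟩
    have h3 : T r * T r ≤ (L * r ^ (k + 2)) ^ 2 := by
      rw [← sq, ← sq_abs]; exact pow_le_pow_left₀ (abs_nonneg _) (hTb r hr0.le) 2
    have h4 : 0 ≤ D * (1 / r ^ (k + 1) * (S r * S r)) :=
      mul_nonneg hD0.le (mul_nonneg (by positivity) (mul_self_nonneg _))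
    calc H r ≤ D ^ 2 * (N r / r ^ (k + 3) * (T r * T r)) := by simp only [H]; linarith
      _ ≤ D ^ 2 * ((D + 2) / r ^ (k + 3) * (L * r ^ (k + 2)) ^ 2) := by
        gcongr
        exact mul_self_nonneg _
      _ = _ := by field_simp; ring
  have hstep : ∀ ε ∈ Ioo 0 a, H a - D ^ 2 * (D + 2) * L ^ 2 * ε ^ (k + 1) + ∫ s in 0..ε, f s ≤
      ∫ s in 0..a, f s := by
    intro ε hε
    have hsub : Icc ε a ⊆ Ioc 0 R := fun x hx => ⟨hε.1.trans_le hx.1, hx.2.trans ha.2⟩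
    have hNc : ContinuousOn N (Icc ε a) :=
      h.continuousOn_quot.mono fun x hx => ⟨(hsub hx).1.le, (hsub hx).2⟩
    have hpos : ∀ x ∈ Icc ε a, x ≠ 0 := fun x hx => (hsub hx).1.ne'
    have acS : AbsolutelyContinuousOnInterval S ε a :=
      absolutelyContinuousOnInterval_of_hasDerivAt hε.2.le (fun x _ => hS x) hSc.continuousOn
    have acp : AbsolutelyContinuousOnInterval (fun r => r ^ (k + 1) / D) ε a :=
      absolutelyContinuousOnInterval_of_hasDerivAt hε.2.le
        (fun x _ => (hasDerivAt_pow (k + 1) x).div_const D) (by fun_prop)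
    have acv : AbsolutelyContinuousOnInterval v ε a :=
      (hv.lipschitzOnWith (s := uIcc ε a)).absolutelyContinuousOnInterval
    have acT : AbsolutelyContinuousOnInterval T ε a := acS.sub (acp.mul acv)
    have acG : AbsolutelyContinuousOnInterval (fun r => N r / r ^ (k + 3)) ε a := by
      refine absolutelyContinuousOnInterval_of_hasDerivAt hε.2.le
        (fun x hx => (hN x (hsub hx)).div (hasDerivAt_pow (k + 3) x)
          (pow_ne_zero _ (hpos x hx))) ?_
      refine ContinuousOn.div (ContinuousOn.sub (ContinuousOn.mul (ContinuousOn.div ?_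
        continuousOn_id hpos) (by fun_prop)) (by fun_prop)) (by fun_prop)
        fun x hx => pow_ne_zero _ (pow_ne_zero _ (hpos x hx))
      fun_prop
    have acQ : AbsolutelyContinuousOnInterval (fun r => 1 / r ^ (k + 1)) ε a := by
      refine absolutelyContinuousOnInterval_of_hasDerivAt hε.2.le
        (fun x hx => (hasDerivAt_const x (1 : ℝ)).div (hasDerivAt_pow (k + 1) x)
          (pow_ne_zero _ (hpos x hx))) ?_
      exact ContinuousOn.div (by fun_prop) (by fun_prop)
        fun x hx => pow_ne_zero _ (pow_ne_zero _ (hpos x hx))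
    have acH : AbsolutelyContinuousOnInterval H ε a :=
      ((acG.mul (acT.mul acT)).const_mul (D ^ 2)).sub ((acQ.mul (acS.mul acS)).const_mul D)
    have hle : ∫ s in ε..a, deriv H s ≤ ∫ s in ε..a, f s := by
      refine intervalIntegral.integral_mono_ae_restrict hε.2.le acH.intervalIntegrable_deriv
        (hfi _ _) ?_
      filter_upwards [ae_restrict_of_ae (hv.ae_differentiableAt_real),
        ae_restrict_mem measurableSet_Icc] with x hx hx'
      rw [(hH x (hsub hx') hx).deriv]
      have := (hsub hx').1
      have h1 : 0 ≤ x ^ k * (deriv v x + D * N x * T x / x ^ (k + 2)) ^ 2 := by positivity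
      linarith
    rw [acH.integral_deriv_eq_sub] at hle
    have h1 := intervalIntegral.integral_add_adjacent_intervals (hfi 0 ε) (hfi ε a)
    have h2 := hHb ε ⟨hε.1, hε.2.le.trans ha.2⟩
    linarith
  have hHa : H a = D * ((D * N a - a ^ 2) / a ^ (k + 1 + 2)) * S a ^ 2 := by
    have : a ≠ 0 := ha.1.ne'
    simp only [H, T, hva]
    field_simp
    ring
  rw [← hHa]
  have hlim : Tendsto (fun ε => H a - D ^ 2 * (D + 2) * L ^ 2 * ε ^ (k + 1) + ∫ s in 0..ε, f s)
      (𝓝[>] 0) (𝓝 (H a - D ^ 2 * (D + 2) * L ^ 2 * 0 ^ (k + 1) + ∫ s in (0 : ℝ)..0, f s)) := by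
    refine tendsto_nhdsWithin_of_tendsto_nhds (Continuous.tendsto ?_ _)
    have := intervalIntegral.continuous_primitive hfi 0
    fun_prop
  have h1 := le_of_tendsto hlim (Filter.mem_of_superset (Ioo_mem_nhdsGT ha.1) hstep)
  simpa using h1

lemma integral_norm_scaled (hd : 2 ≤ d) {f : ℝ → ℝ} {k : ℝ} (hk : 0 < k) (ha : 0 ≤ a)
    (hf : ∀ r, a / k < r → f r = 0) :
    k ^ d * ∫ x : EuclideanSpace ℝ (Fin d), f ‖x‖ =
      d * volume.real (ball (0 : EuclideanSpace ℝ (Fin d)) 1) *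
        ∫ s in 0..a, f (k⁻¹ * s) * s ^ (d - 1) := by
  have : Nontrivial (EuclideanSpace ℝ (Fin d)) := by
    have : Nonempty (Fin d) := ⟨⟨0, by omega⟩⟩
    infer_instance
  rw [integral_fun_norm_addHaar volume f, finrank_euclideanSpace_fin]
  have h1 := integral_comp_mul_left_Ioi (fun r => r ^ (d - 1) * f r) 0 (inv_pos.2 hk)
  rw [mul_zero, inv_inv, smul_eq_mul] at h1
  have h2 : ∫ s in 0..a, f (k⁻¹ * s) * s ^ (d - 1) =
      ∫ s in Ioi 0, f (k⁻¹ * s) * s ^ (d - 1) := by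
    rw [intervalIntegral.integral_of_le ha]
    refine (setIntegral_eq_of_subset_of_forall_sdiff_eq_zero measurableSet_Ioi
      Ioc_subset_Ioi_self fun x hx => ?_).symm
    have h3 : a < x := not_le.1 fun h => hx.2 ⟨hx.1, h⟩
    rw [hf _ (by rw [div_eq_inv_mul]; gcongr), zero_mul]
  have h3 : ∀ s : ℝ, (k⁻¹ * s) ^ (d - 1) * f (k⁻¹ * s) =
      (k ^ (d - 1))⁻¹ * (f (k⁻¹ * s) * s ^ (d - 1)) := fun s => by rw [mul_pow, inv_pow]; ring
  simp only [h3] at h1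
  rw [integral_const_mul] at h1
  simp only [smul_eq_mul, nsmul_eq_mul]
  rw [h2]
  have h4 : k ^ d = k ^ (d - 1) * k := by rw [← pow_succ]; congr 1; omega
  have h5 : ∫ s in Ioi 0, f (k⁻¹ * s) * s ^ (d - 1) =
      k ^ d * ∫ r in Ioi 0, r ^ (d - 1) * f r := by
    have hk' : k ^ (d - 1) ≠ 0 := by positivity
    rw [h4, mul_assoc, ← h1]
    field_simp
  rw [h5]
  ring

/-- Sharp lower bound for the energy defect of a nonnegative function in terms of its mean and the
measure of its support. -/
theorem mul_sq_integral_le_of_volume (hd : 2 ≤ d) (h : IsFirstZero d R) (ha : a ∈ Ioc 0 R)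
    {k : ℝ} (hk : 0 < k) {w : EuclideanSpace ℝ (Fin d) → ℝ} (hw : LipschitzWith L w)
    (h0 : ∀ x, 0 ≤ w x) {ρ : ℝ} (hρ : ∀ x, ρ ≤ ‖x‖ → w x = 0)
    (hvol : volume (ball (0 : EuclideanSpace ℝ (Fin d)) (a / k)) = volume {x | 0 < w x}) :
    k ^ (d + 2) / volume.real (ball (0 : EuclideanSpace ℝ (Fin d)) 1) *
      ((d * besselQuot d a - a ^ 2) / a ^ (d + 2)) * (∫ x, w x) ^ 2 ≤
      (∫ x, ‖gradient w x‖ ^ 2) - k ^ 2 * ∫ x, w x ^ 2 := by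
  obtain ⟨v, hv, hva, e1, e2, e3⟩ := exists_symmetrization hd hw h0 hρ hvol
  have ha0 := ha.1
  have hd0 : (0 : ℝ) < d := by positivity
  have i1 := integral_norm_scaled hd (f := v) hk ha0.le fun r hr => hva r hr.le
  have i2 := integral_norm_scaled hd (f := fun r => v r ^ 2) hk ha0.le fun r hr => by
    simp [hva r hr.le]
  have i3 := integral_norm_scaled hd (f := fun r => deriv v r ^ 2) hk ha0.le fun r hr => by
    have : v =ᶠ[𝓝 r] fun _ => 0 := by
      filter_upwards [lt_mem_nhds hr] with y hy using hva y hy.le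
    simp [this.deriv_eq]
  set ω := volume.real (ball (0 : EuclideanSpace ℝ (Fin d)) 1)
  have hω : 0 < ω := by
    have : Nonempty (Fin d) := ⟨⟨0, by omega⟩⟩
    exact ENNReal.toReal_pos (measure_ball_pos _ _ one_pos).ne' measure_ball_lt_top.ne
  set vk : ℝ → ℝ := fun s => v (k⁻¹ * s)
  have hvk : LipschitzWith (L * ‖k⁻¹‖₊) vk := hv.comp (lipschitzWith_smul k⁻¹)
  have hdk : ∀ s, deriv v (k⁻¹ * s) ^ 2 = k ^ 2 * deriv vk s ^ 2 := fun s => by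
    have : deriv vk s = k⁻¹ * deriv v (k⁻¹ * s) := deriv_comp_mul_left k⁻¹ v s
    rw [this]
    field_simp
  have key := mul_sq_integral_le_energy_defect hd h ha hvk (hva _ (div_eq_inv_mul a k).le)
  have hi2 : IntervalIntegrable (fun s => vk s ^ 2 * s ^ (d - 1)) volume 0 a :=
    ((hvk.continuous.pow 2).mul (continuous_pow _)).intervalIntegrable _ _
  have hi3 : IntervalIntegrable (fun s => deriv vk s ^ 2 * s ^ (d - 1)) volume 0 a := by
    refine ((intervalIntegrable_deriv_sq_sub_mul_pow hvk (d - 1) 0 a).add hi2).congr ?_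
    exact fun s _ => by ring
  have e4 : ∫ s in 0..a, (deriv vk s ^ 2 - vk s ^ 2) * s ^ (d - 1) =
      (∫ s in 0..a, deriv vk s ^ 2 * s ^ (d - 1)) - ∫ s in 0..a, vk s ^ 2 * s ^ (d - 1) := by
    rw [← intervalIntegral.integral_sub hi3 hi2]
    exact intervalIntegral.integral_congr fun s _ => by ring
  simp only [hdk, mul_assoc (k ^ 2)] at i3
  rw [intervalIntegral.integral_const_mul] at i3
  rw [e4] at key
  rw [e1] at i1
  rw [e2] at i2
  set S1 := ∫ s in 0..a, vk s * s ^ (d - 1)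
  set S2 := ∫ s in 0..a, vk s ^ 2 * s ^ (d - 1)
  set S3 := ∫ s in 0..a, deriv vk s ^ 2 * s ^ (d - 1)
  set I1 := ∫ x, w x
  set I2 := ∫ x, w x ^ 2
  set G := (d * besselQuot d a - a ^ 2) / a ^ (d + 2)
  have hkd : 0 < k ^ d := by positivity
  refine le_trans ?_ (sub_le_sub_right e3 _)
  refine le_of_mul_le_mul_left ?_ hkd
  rw [mul_sub, i3, mul_left_comm (k ^ d) (k ^ 2), i2]
  have hS1 : S1 = k ^ d * I1 / (d * ω) := by rw [i1]; field_simp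
  calc k ^ d * (k ^ (d + 2) / ω * G * I1 ^ 2)
      = d * ω * k ^ 2 * (d * G * S1 ^ 2) := by rw [hS1]; field_simp; ring
    _ ≤ d * ω * k ^ 2 * (S3 - S2) := by gcongr
    _ = _ := by ring

end Calibration

section InverseFunction

variable {f g : ℝ → ℝ} {a b c : ℝ} {s t : Set ℝ}

lemma exists_contDiffOn_inverse (hs : IsOpen s) (ht : IsOpen t) (hf : StrictMonoOn f s)
    (hst : f '' s = t) (hfd : ContDiffOn ℝ 1 f s) (hf' : ∀ x ∈ s, deriv f x ≠ 0) :
    ∃ g : ℝ → ℝ, (∀ y ∈ t, g y ∈ s ∧ f (g y) = y) ∧ ContDiffOn ℝ 1 g t := by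
  have h1 : ∀ y ∈ t, ∃ x ∈ s, f x = y := fun y hy => by rwa [← hst] at hy
  choose! g hg hfg using h1
  refine ⟨g, fun y hy => ⟨hg y hy, hfg y hy⟩, ?_⟩
  have hgm : StrictMonoOn g t := fun x hx y hy hxy => by
    rwa [← hf.lt_iff_lt (hg x hx) (hg y hy), hfg x hx, hfg y hy]
  have hgt : g '' t = s := by
    refine Subset.antisymm (image_subset_iff.2 hg) fun x hx => ?_
    have hx' : f x ∈ t := hst ▸ mem_image_of_mem f hx
    exact ⟨f x, hx', hf.injOn (hg _ hx') hx (hfg _ hx')⟩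
  have hgc : ∀ y ∈ t, ContinuousAt g y := fun y hy =>
    hgm.continuousAt_of_image_mem_nhds (ht.mem_nhds hy) (hgt ▸ hs.mem_nhds (hg y hy))
  have hgd : ∀ y ∈ t, HasDerivAt g (deriv f (g y))⁻¹ y := fun y hy =>
    HasDerivAt.of_local_left_inverse (hgc y hy)
      ((hfd.differentiableOn one_ne_zero).differentiableAt (hs.mem_nhds (hg y hy))).hasDerivAt
      (hf' _ (hg y hy)) (by filter_upwards [ht.mem_nhds hy] with z hz using hfg z hz)
  rw [show (1 : WithTop ℕ∞) = 0 + 1 from rfl, contDiffOn_succ_iff_deriv_of_isOpen ht]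
  refine ⟨fun y hy => (hgd y hy).differentiableAt.differentiableWithinAt, by simp, ?_⟩
  rw [contDiffOn_zero]
  refine ContinuousOn.congr (f := fun y => (deriv f (g y))⁻¹) ?_ fun y hy => (hgd y hy).deriv
  exact ((hfd.continuousOn_deriv_of_isOpen hs le_rfl).comp
    (fun y hy => (hgc y hy).continuousWithinAt) hg).inv₀ fun y hy => hf' _ (hg y hy)

lemma tendsto_inverse_nhdsGT (hab : a < b) (hf : StrictMonoOn f (Ioo a b))
    (hc : ∀ x ∈ Ioo a b, c < f x) (ht : t ∈ 𝓝[>] c) (hg : ∀ y ∈ t, g y ∈ Ioo a b ∧ f (g y) = y) :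
    Tendsto g (𝓝[>] c) (𝓝[>] a) := by
  refine tendsto_nhdsWithin_iff.2 ⟨tendsto_order.2 ⟨fun l hl => ?_, fun u hu => ?_⟩, ?_⟩
  · filter_upwards [ht] with y hy using hl.trans (hg y hy).1.1
  · obtain ⟨x, hx, hx'⟩ := exists_between (lt_min hu hab)
    have hxm : x ∈ Ioo a b := ⟨hx, hx'.trans_le (min_le_right _ _)⟩
    filter_upwards [ht, Ioo_mem_nhdsGT (hc x hxm)] with y hy hy'
    have h1 : g y < x := by
      rw [← hf.lt_iff_lt (hg y hy).1 hxm, (hg y hy).2]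
      exact hy'.2
    exact h1.trans (hx'.trans_le (min_le_left _ _))
  · filter_upwards [ht] with y hy using (hg y hy).1.1

lemma tendsto_inverse_nhdsLT (hab : a < b) (hf : StrictMonoOn f (Ioo a b))
    (hc : ∀ x ∈ Ioo a b, f x < c) (ht : t ∈ 𝓝[<] c) (hg : ∀ y ∈ t, g y ∈ Ioo a b ∧ f (g y) = y) :
    Tendsto g (𝓝[<] c) (𝓝[<] b) := by
  refine tendsto_nhdsWithin_iff.2 ⟨tendsto_order.2 ⟨fun l hl => ?_, fun u hu => ?_⟩, ?_⟩
  · obtain ⟨x, hx, hx'⟩ := exists_between (max_lt hl hab)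
    have hxm : x ∈ Ioo a b := ⟨(le_max_right _ _).trans_lt hx, hx'⟩
    filter_upwards [ht, Ioo_mem_nhdsLT (hc x hxm)] with y hy hy'
    have h1 : x < g y := by
      rw [← hf.lt_iff_lt hxm (hg y hy).1, (hg y hy).2]
      exact hy'.1
    exact ((le_max_left _ _).trans_lt hx).trans h1
  · filter_upwards [ht] with y hy using (hg y hy).1.2.trans hu
  · filter_upwards [ht] with y hy using (hg y hy).1.2

lemma strictMonoOn_Ioo_of_hasDerivAt_pos {f' : ℝ → ℝ} (hf : ∀ x ∈ Ioo a b, HasDerivAt f (f' x) x)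
    (hf' : ∀ x ∈ Ioo a b, 0 < f' x) : StrictMonoOn f (Ioo a b) := by
  refine strictMonoOn_of_deriv_pos (convex_Ioo a b)
    (fun x hx => (hf x hx).continuousAt.continuousWithinAt) fun x hx => ?_
  rw [interior_Ioo] at hx
  rw [(hf x hx).deriv]
  exact hf' x hx

end InverseFunction

section CriticalCurve

variable {d : ℕ} {R r a b α : ℝ}

/-- Minus the boundary slope of the normalized radial profile on a ball of radius `r`. -/
def radialSlope (d : ℕ) (r : ℝ) : ℝ := besselQuot d r / r ^ (d + 1)

/-- The sharp constant bounding the energy defect on a ball of radius `r` by the squared mean. -/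
def defectCoeff (d : ℕ) (r : ℝ) : ℝ := (d * besselQuot d r - r ^ 2) / r ^ (d + 2)

/-- The quotient of `defectCoeff` by the square of `radialSlope`, with denominators cleared. -/
def balanceFun (d : ℕ) (r : ℝ) : ℝ := (d * besselQuot d r - r ^ 2) * r ^ d / besselQuot d r ^ 2

/-- A pair of radii which is critical for the two-ball problem with parameter `α`. -/
structure IsCriticalPair (d : ℕ) (R α a b : ℝ) : Prop where
  left_mem : a ∈ Ioo 0 R
  right_mem : b ∈ Ioo 0 R
  defect_eq : defectCoeff d a + α ^ 2 * defectCoeff d b = 0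
  slope_eq : radialSlope d a = α * radialSlope d b

lemma contDiff_besselPhi {n : ℝ} (hn : 1 ≤ n) : ContDiff ℝ 1 (besselPhi n) := by
  rw [contDiff_one_iff_deriv]
  refine ⟨fun r => (hasDerivAt_besselPhi hn r).differentiableAt, ?_⟩
  have : deriv (besselPhi n) = fun r => -(r / n) * besselPhi (n + 2) r :=
    funext fun r => (hasDerivAt_besselPhi hn r).deriv
  rw [this]
  have := continuous_besselPhi (n := n + 2) (by linarith)
  fun_prop

namespace IsFirstZero

variable (h : IsFirstZero d R)
include h

lemma contDiffOn_quot : ContDiffOn ℝ 1 (besselQuot d) (Ioo 0 R) := by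
  have h0 : (0 : ℝ) ≤ d := Nat.cast_nonneg d
  refine ContDiffOn.div (contDiffOn_const.mul (contDiff_besselPhi (by linarith)).contDiffOn)
    (contDiff_besselPhi (by linarith)).contDiffOn fun r hr => ?_
  exact (h.besselPhi_add_four_pos ⟨hr.1.le, hr.2.le⟩).ne'

lemma contDiffOn_slope : ContDiffOn ℝ 1 (radialSlope d) (Ioo 0 R) :=
  h.contDiffOn_quot.div (contDiff_id.pow _).contDiffOn fun _ hr => pow_ne_zero _ hr.1.ne'

lemma contDiffOn_balance : ContDiffOn ℝ 1 (balanceFun d) (Ioo 0 R) :=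
  ((((contDiffOn_const.mul h.contDiffOn_quot).sub (contDiff_id.pow 2).contDiffOn).mul
    (contDiff_id.pow d).contDiffOn).div (h.contDiffOn_quot.pow 2)) fun _ hr =>
      pow_ne_zero _ (h.quot_pos ⟨hr.1.le, hr.2⟩).ne'

lemma slope_pos (hr : r ∈ Ioo 0 R) : 0 < radialSlope d r :=
  div_pos (h.quot_pos ⟨hr.1.le, hr.2⟩) (pow_pos hr.1 _)

lemma slope_numerator_pos (hr : r ∈ Ioc 0 R) :
    0 < besselQuot d r ^ 2 - besselQuot d r + r ^ 2 := by
  have h1 := h.quot_defect_pos hr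
  have h2 := h.quot_nonneg ⟨hr.1.le, hr.2⟩
  have h3 : (0 : ℝ) ≤ d := Nat.cast_nonneg d
  nlinarith

lemma hasDerivAt_slope (hr : r ∈ Ioc 0 R) : HasDerivAt (radialSlope d)
    (-((besselQuot d r ^ 2 - besselQuot d r + r ^ 2) / r ^ (d + 2))) r := by
  have hr0 : r ≠ 0 := hr.1.ne'
  refine ((h.hasDerivAt_quot hr).div (hasDerivAt_pow (d + 1) r) (pow_ne_zero _ hr0)).congr_deriv ?_
  rw [Nat.add_sub_cancel]
  push_cast
  field_simp
  ring

lemma slope_strictAntiOn : StrictAntiOn (radialSlope d) (Ioo 0 R) := by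
  have h1 := strictMonoOn_Ioo_of_hasDerivAt_pos (f := fun r => -radialSlope d r) (a := 0) (b := R)
    (fun x hx => (h.hasDerivAt_slope ⟨hx.1, hx.2.le⟩).neg) fun x hx => by
      rw [neg_neg]
      exact div_pos (h.slope_numerator_pos ⟨hx.1, hx.2.le⟩) (pow_pos hx.1 _)
  exact fun x hx y hy hxy => neg_lt_neg_iff.1 (h1 hx hy hxy)

lemma hasDerivAt_defectCoeff (hd : 2 ≤ d) (hr : r ∈ Ioc 0 R) :
    HasDerivAt (defectCoeff d) (-(d * r ^ (d - 1) * radialSlope d r ^ 2)) r := by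
  have hr0 : r ≠ 0 := hr.1.ne'
  refine ((((h.hasDerivAt_quot hr).const_mul (d : ℝ)).sub (hasDerivAt_pow 2 r)).div
    (hasDerivAt_pow (d + 2) r) (pow_ne_zero _ hr0)).congr_deriv ?_
  obtain ⟨k, rfl⟩ : ∃ k, d = k + 1 := ⟨d - 1, by omega⟩
  have e : k + 1 + 2 - 1 = k + 2 := by omega
  simp only [Nat.add_sub_cancel, e, radialSlope, Pi.sub_apply]
  push_cast
  field_simp
  ring

/-- The factor relating the derivative of `balanceFun` to that of the volume. -/
lemma hasDerivAt_balance (hd : 2 ≤ d) (hr : r ∈ Ioo 0 R) :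
    HasDerivAt (balanceFun d) (r ^ (d - 1) * (-d + 2 * (d * besselQuot d r - r ^ 2) *
      (besselQuot d r ^ 2 - besselQuot d r + r ^ 2) / besselQuot d r ^ 3)) r := by
  have hr0 : r ≠ 0 := hr.1.ne'
  have hN := (h.quot_pos ⟨hr.1.le, hr.2⟩).ne'
  have hd1 := h.hasDerivAt_quot ⟨hr.1, hr.2.le⟩
  refine (((((hd1.const_mul (d : ℝ)).sub (hasDerivAt_pow 2 r)).mul (hasDerivAt_pow d r)).div
    (hd1.pow 2) (pow_ne_zero _ hN))).congr_deriv ?_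
  obtain ⟨k, rfl⟩ : ∃ k, d = k + 1 := ⟨d - 1, by omega⟩
  simp only [Nat.add_sub_cancel, Pi.sub_apply, Pi.mul_apply, Pi.pow_apply]
  push_cast
  field_simp
  ring

lemma defectCoeff_eq_balance_mul (hr : r ∈ Ioo 0 R) :
    defectCoeff d r = balanceFun d r * radialSlope d r ^ 2 := by
  have hr0 : r ≠ 0 := hr.1.ne'
  have hN := (h.quot_pos ⟨hr.1.le, hr.2⟩).ne'
  simp only [defectCoeff, balanceFun, radialSlope]
  field_simp
  ring

/-- The defect coefficient plus a multiple of the volume is minimal where the slopes match. -/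
lemma defectCoeff_add_le (hd : 2 ≤ d) (ha : a ∈ Ioo 0 R) (hr : r ∈ Ioo 0 R) :
    defectCoeff d a + radialSlope d a ^ 2 * a ^ d ≤
      defectCoeff d r + radialSlope d a ^ 2 * r ^ d := by
  set p := radialSlope d a
  have hF : ∀ x ∈ Ioo 0 R, HasDerivAt (fun x => defectCoeff d x + p ^ 2 * x ^ d)
      (d * x ^ (d - 1) * (p ^ 2 - radialSlope d x ^ 2)) x := fun x hx =>
    ((h.hasDerivAt_defectCoeff hd ⟨hx.1, hx.2.le⟩).add
      ((hasDerivAt_pow d x).const_mul (p ^ 2))).congr_deriv (by ring)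
  have hp := h.slope_pos ha
  rcases le_total a r with har | hra
  · have hsub : Icc a r ⊆ Ioo 0 R := fun x hx => ⟨ha.1.trans_le hx.1, hx.2.trans_lt hr.2⟩
    refine monotoneOn_Icc_of_hasDerivAt_nonneg
      (fun x hx => (hF x (hsub hx)).continuousAt.continuousWithinAt)
      (fun x hx => hF x (hsub (Ioo_subset_Icc_self hx))) (fun x hx => ?_) (left_mem_Icc.2 har)
      (right_mem_Icc.2 har) har
    have hx' := hsub (Ioo_subset_Icc_self hx)
    have h1 := h.slope_strictAntiOn.antitoneOn ha hx' hx.1.le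
    have h2 := h.slope_pos hx'
    have h3 := hx'.1
    have h4 := pow_le_pow_left₀ h2.le h1 2
    exact mul_nonneg (by positivity) (sub_nonneg.2 h4)
  · have hsub : Icc r a ⊆ Ioo 0 R := fun x hx => ⟨hr.1.trans_le hx.1, hx.2.trans_lt ha.2⟩
    have h5 := monotoneOn_Icc_of_hasDerivAt_nonneg
      (f := fun x => -(defectCoeff d x + p ^ 2 * x ^ d))
      (fun x hx => (hF x (hsub hx)).neg.continuousAt.continuousWithinAt)
      (fun x hx => (hF x (hsub (Ioo_subset_Icc_self hx))).neg) (fun x hx => ?_)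
      (left_mem_Icc.2 hra) (right_mem_Icc.2 hra) hra
    · exact neg_le_neg_iff.1 h5
    have hx' := hsub (Ioo_subset_Icc_self hx)
    have h1 := h.slope_strictAntiOn.antitoneOn hx' ha hx.2.le
    have h3 := hx'.1
    have h4 := pow_le_pow_left₀ hp.le h1 2
    rw [← mul_neg, neg_sub]
    exact mul_nonneg (by positivity) (sub_nonneg.2 h4)

lemma critical_volume_le (hd : 2 ≤ d) (hc : IsCriticalPair d R α a b) {a' b' : ℝ}
    (ha' : a' ∈ Ioo 0 R) (hb' : b' ∈ Ioo 0 R) :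
    radialSlope d a ^ 2 * ((a ^ d + b ^ d) - (a' ^ d + b' ^ d)) ≤
      defectCoeff d a' + α ^ 2 * defectCoeff d b' := by
  have h1 := h.defectCoeff_add_le hd hc.left_mem ha'
  have h2 := mul_le_mul_of_nonneg_left (h.defectCoeff_add_le hd hc.right_mem hb') (sq_nonneg α)
  have h3 : α ^ 2 * radialSlope d b ^ 2 = radialSlope d a ^ 2 := by rw [hc.slope_eq]; ring
  have h4 := hc.defect_eq
  linear_combination h1 + h2 - h4 + (b' ^ d - b ^ d) * h3

lemma defectCoeff_add_pos (hd : 2 ≤ d) (hc : IsCriticalPair d R α a b) {a' b' : ℝ}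
    (ha' : a' ∈ Ioo 0 R) (hb' : b' ∈ Ioo 0 R) (hlt : a' ^ d + b' ^ d < a ^ d + b ^ d) :
    0 < defectCoeff d a' + α ^ 2 * defectCoeff d b' :=
  (mul_pos (pow_pos (h.slope_pos hc.left_mem) 2) (sub_pos.2 hlt)).trans_le
    (h.critical_volume_le hd hc ha' hb')

end IsFirstZero

end CriticalCurve

section OptimalRatio

variable {d : ℕ} {R r r₀ a b α : ℝ}

/-- The radius at which the defect coefficient vanishes. -/
structure IsBalanced (d : ℕ) (R r₀ : ℝ) : Prop where
  mem : r₀ ∈ Ioo 0 R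
  eq_sq : d * besselQuot d r₀ = r₀ ^ 2
  sq_lt : ∀ r ∈ Ico 0 r₀, r ^ 2 < d * besselQuot d r
  lt_sq : ∀ r ∈ Ioc r₀ R, d * besselQuot d r < r ^ 2

lemma IsBalanced.balance_eq_zero (hr₀ : IsBalanced d R r₀) : balanceFun d r₀ = 0 := by
  simp [balanceFun, hr₀.eq_sq]

namespace IsFirstZero

variable (h : IsFirstZero d R) (hr₀ : IsBalanced d R r₀)
include h

lemma quot_pos_of_mem (hr : r ∈ Ioo 0 R) : 0 < besselQuot d r := h.quot_pos ⟨hr.1.le, hr.2⟩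

include hr₀

lemma balance_pos (hr : r ∈ Ioo 0 r₀) : 0 < balanceFun d r :=
  div_pos (mul_pos (sub_pos.2 (hr₀.sq_lt r ⟨hr.1.le, hr.2⟩)) (pow_pos hr.1 _))
    (pow_pos (h.quot_pos_of_mem ⟨hr.1, hr.2.trans hr₀.mem.2⟩) _)

/-- Beyond the balanced radius, `balanceFun` decreases at least as fast as the volume. -/
lemma deriv_balance_le (hd : 2 ≤ d) (hr : r ∈ Ioo r₀ R) :
    deriv (balanceFun d) r < -(d * r ^ (d - 1)) := by
  have hr0 : 0 < r := hr₀.mem.1.trans hr.1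
  rw [(h.hasDerivAt_balance hd ⟨hr0, hr.2⟩).deriv]
  have h1 := hr₀.lt_sq r ⟨hr.1, hr.2.le⟩
  have h2 := h.slope_numerator_pos ⟨hr0, hr.2.le⟩
  have h3 := h.quot_pos_of_mem ⟨hr0, hr.2⟩
  have h4 : 2 * (d * besselQuot d r - r ^ 2) *
      (besselQuot d r ^ 2 - besselQuot d r + r ^ 2) / besselQuot d r ^ 3 < 0 :=
    div_neg_of_neg_of_pos (mul_neg_of_neg_of_pos (by linarith) h2) (by positivity)
  have h5 : 0 < r ^ (d - 1) := by positivity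
  nlinarith

omit hr₀ in
/-- `balanceFun` increases more slowly than the volume. -/
lemma deriv_balance_lt (hd : 2 ≤ d) (hr : r ∈ Ioo 0 R) :
    deriv (balanceFun d) r < d * r ^ (d - 1) := by
  rw [(h.hasDerivAt_balance hd hr).deriv, mul_comm (d : ℝ) (r ^ (d - 1))]
  have hr0 := hr.1
  have h1 := h.quot_defect_pos ⟨hr.1, hr.2.le⟩
  have h3 := h.quot_pos_of_mem hr
  refine mul_lt_mul_of_pos_left ?_ (pow_pos hr0 _)
  have h4 : 2 * (d * besselQuot d r - r ^ 2) *
      (besselQuot d r ^ 2 - besselQuot d r + r ^ 2) / besselQuot d r ^ 3 < 2 * d := by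
    rw [div_lt_iff₀ (by positivity)]
    set N := besselQuot d r
    have hd0 : (0 : ℝ) < d := by positivity
    have h5 : 0 < d * N ^ 2 := by positivity
    have h6 : 0 < r ^ 2 * (N ^ 2 - (d + 1) * N + r ^ 2) :=
      mul_pos (by positivity) (by linarith)
    linarith
  linarith

lemma balance_strictAntiOn (hd : 2 ≤ d) : StrictMonoOn (fun r => -balanceFun d r) (Ioo r₀ R) := by
  refine strictMonoOn_Ioo_of_hasDerivAt_pos (f' := fun r => -deriv (balanceFun d) r)
    (fun x hx => ?_) fun x hx => ?_
  · exact (h.hasDerivAt_balance hd ⟨hr₀.mem.1.trans hx.1, hx.2⟩).differentiableAt.hasDerivAt.neg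
  · have h1 := h.deriv_balance_le hr₀ hd hx
    have h2 := hr₀.mem.1.trans hx.1
    have h3 : 0 < (d : ℝ) * x ^ (d - 1) := by positivity
    linarith

lemma image_neg_balance : (fun r => -balanceFun d r) '' Ioo r₀ R = Ioi 0 := by
  refine Subset.antisymm ?_ fun y hy => ?_
  · rintro _ ⟨r, hr, rfl⟩
    have hr0 : 0 < r := hr₀.mem.1.trans hr.1
    exact neg_pos.2 (div_neg_of_neg_of_pos (mul_neg_of_neg_of_pos
      (sub_neg.2 (hr₀.lt_sq r ⟨hr.1, hr.2.le⟩)) (by positivity))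
      (pow_pos (h.quot_pos_of_mem ⟨hr0, hr.2⟩) _))
  · have hc : ContinuousOn (fun r => (r ^ 2 - d * besselQuot d r) * r ^ d -
        y * besselQuot d r ^ 2) (Icc r₀ R) := by
      have := h.continuousOn_quot.mono (Icc_subset_Icc_left hr₀.mem.1.le)
      fun_prop
    have hy0 : (0 : ℝ) < y := hy
    have h1 := h.quot_pos_of_mem hr₀.mem
    have h2 := h.quot_self
    have h3 := h.pos
    obtain ⟨r, hr, hr'⟩ := intermediate_value_Ioo hr₀.mem.2.le hc (show (0 : ℝ) ∈ Ioo _ _ by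
      refine ⟨?_, ?_⟩
      · simp only [hr₀.eq_sq, sub_self, zero_mul, zero_sub]
        exact neg_neg_of_pos (by positivity)
      · simp only [h2]
        rw [mul_zero, sub_zero, zero_pow two_ne_zero, mul_zero, sub_zero]
        positivity)
    refine ⟨r, hr, ?_⟩
    have h4 := h.quot_pos_of_mem ⟨hr₀.mem.1.trans hr.1, hr.2⟩
    simp only [balanceFun]
    simp only at hr'
    rw [← neg_div, div_eq_iff (by positivity)]
    linarith

/-- The radius of the larger ball as a function of the radius of the smaller one. -/
lemma exists_partner_radius (hd : 2 ≤ d) : ∃ X : ℝ → ℝ,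
    (∀ y ∈ Ioo 0 r₀, X y ∈ Ioo r₀ R ∧ balanceFun d (X y) = -balanceFun d y) ∧
    ContDiffOn ℝ 1 X (Ioo 0 r₀) ∧ Tendsto X (𝓝[<] r₀) (𝓝[>] r₀) := by
  have hsub : Ioo r₀ R ⊆ Ioo 0 R := Ioo_subset_Ioo_left hr₀.mem.1.le
  have hsub' : Ioo 0 r₀ ⊆ Ioo 0 R := Ioo_subset_Ioo_right hr₀.mem.2.le
  obtain ⟨Y, hY, hYc⟩ := exists_contDiffOn_inverse isOpen_Ioo isOpen_Ioi
    (h.balance_strictAntiOn hr₀ hd) (h.image_neg_balance hr₀)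
    (h.contDiffOn_balance.mono hsub).neg fun x hx => by
      rw [deriv.fun_neg]
      have h1 := h.deriv_balance_le hr₀ hd hx
      have h2 := hr₀.mem.1.trans hx.1
      have h3 : 0 < (d : ℝ) * x ^ (d - 1) := by positivity
      exact (neg_pos.2 (by linarith)).ne'
  have hmaps : MapsTo (balanceFun d) (Ioo 0 r₀) (Ioi 0) := fun y hy => h.balance_pos hr₀ hy
  refine ⟨fun y => Y (balanceFun d y), fun y hy => ?_, ?_, ?_⟩
  · obtain ⟨h1, h2⟩ := hY _ (hmaps hy)
    exact ⟨h1, neg_eq_iff_eq_neg.1 h2⟩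
  · exact hYc.comp (h.contDiffOn_balance.mono hsub') hmaps
  · refine (tendsto_inverse_nhdsGT (c := 0) hr₀.mem.2 (h.balance_strictAntiOn hr₀ hd)
      (fun x hx => ?_) self_mem_nhdsWithin hY).comp ?_
    · have : -balanceFun d x ∈ Ioi (0 : ℝ) := h.image_neg_balance hr₀ ▸ ⟨x, hx, rfl⟩
      exact this
    · refine tendsto_nhdsWithin_iff.2 ⟨?_, ?_⟩
      · rw [← hr₀.balance_eq_zero]
        exact (h.hasDerivAt_balance hd hr₀.mem).continuousAt.tendsto.mono_left nhdsWithin_le_nhds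
      · filter_upwards [Ioo_mem_nhdsLT hr₀.mem.1] with y hy using hmaps hy

omit hr₀ in
lemma deriv_balance_mul_slope (hd : 2 ≤ d) (hr : r ∈ Ioo 0 R) :
    deriv (balanceFun d) r * radialSlope d r =
      -(d * r ^ (d - 1)) * radialSlope d r - 2 * balanceFun d r * deriv (radialSlope d) r := by
  rw [(h.hasDerivAt_balance hd hr).deriv, (h.hasDerivAt_slope ⟨hr.1, hr.2.le⟩).deriv]
  have hr0 : r ≠ 0 := hr.1.ne'
  have hN := (h.quot_pos_of_mem hr).ne'
  obtain ⟨k, rfl⟩ : ∃ k, d = k + 1 := ⟨d - 1, by omega⟩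
  simp only [Nat.add_sub_cancel, radialSlope, balanceFun]
  push_cast
  field_simp
  ring

omit hr₀ in
lemma deriv_slope_neg (hr : r ∈ Ioo 0 R) : deriv (radialSlope d) r < 0 := by
  rw [(h.hasDerivAt_slope ⟨hr.1, hr.2.le⟩).deriv]
  exact neg_neg_of_pos (div_pos (h.slope_numerator_pos ⟨hr.1, hr.2.le⟩) (pow_pos hr.1 _))

lemma exists_increasing_curve (hd : 2 ≤ d) : ∃ X : ℝ → ℝ,
    (∀ y ∈ Ioo 0 r₀, X y ∈ Ioo r₀ R ∧ balanceFun d (X y) = -balanceFun d y) ∧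
    ContDiffOn ℝ 1 X (Ioo 0 r₀) ∧ Tendsto X (𝓝[<] r₀) (𝓝[>] r₀) ∧
    (∀ y ∈ Ioo 0 r₀, 0 < deriv (fun y => radialSlope d (X y) / radialSlope d y) y) ∧
    ∀ y ∈ Ioo 0 r₀, 0 < deriv (fun y => y / X y) y := by
  obtain ⟨X, hX, hXc, hXt⟩ := h.exists_partner_radius hr₀ hd
  refine ⟨X, hX, hXc, hXt, ?_⟩
  rw [← forall₂_and]
  intro y hy
  have hy' : y ∈ Ioo 0 R := ⟨hy.1, hy.2.trans hr₀.mem.2⟩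
  obtain ⟨hXy, hbal⟩ := hX y hy
  have hX' : X y ∈ Ioo 0 R := ⟨hr₀.mem.1.trans hXy.1, hXy.2⟩
  have hyX : y < X y := hy.2.trans hXy.1
  have hy0 := hy.1
  have hX0 := hX'.1
  have hd0 : (0 : ℝ) < d := by positivity
  have hdX : HasDerivAt X (deriv X y) y :=
    ((hXc.differentiableOn one_ne_zero).differentiableAt (Ioo_mem_nhds hy.1 hy.2)).hasDerivAt
  have hP : ∀ r ∈ Ioo 0 R, HasDerivAt (radialSlope d) (deriv (radialSlope d) r) r := fun r hr =>
    (h.hasDerivAt_slope ⟨hr.1, hr.2.le⟩).differentiableAt.hasDerivAt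
  have hK : ∀ r ∈ Ioo 0 R, HasDerivAt (balanceFun d) (deriv (balanceFun d) r) r := fun r hr =>
    (h.hasDerivAt_balance hd hr).differentiableAt.hasDerivAt
  have hchain : deriv (balanceFun d) (X y) * deriv X y = -deriv (balanceFun d) y := by
    refine HasDerivAt.unique ((hK _ hX').comp y hdX) ((hK _ hy').neg.congr_of_eventuallyEq ?_)
    filter_upwards [Ioo_mem_nhds hy.1 hy.2] with z hz using (hX z hz).2
  have h1 := h.deriv_balance_le hr₀ hd hXy
  have h2 := h.deriv_balance_lt hd hy'
  have h3 := h.slope_pos hX'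
  have h4 := h.slope_pos hy'
  have h5 := h.deriv_slope_neg hX'
  have h6 := h.deriv_slope_neg hy'
  have h7 := h.deriv_balance_mul_slope hd hX'
  have h8 := h.deriv_balance_mul_slope hd hy'
  have hkx : 0 < -deriv (balanceFun d) (X y) := by
    have : 0 < (d : ℝ) * X y ^ (d - 1) := by positivity
    linarith
  rw [hbal] at h7
  have e1 : deriv (fun y => radialSlope d (X y) / radialSlope d y) y =
      (deriv (radialSlope d) (X y) * deriv X y * radialSlope d y -
        radialSlope d (X y) * deriv (radialSlope d) y) / radialSlope d y ^ 2 :=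
    (((hP _ hX').comp y hdX).div (hP y hy') h4.ne').deriv
  have e2 : deriv (fun y => y / X y) y = (1 * X y - y * deriv X y) / X y ^ 2 :=
    ((hasDerivAt_id y).div hdX hX0.ne').deriv
  rw [e1, e2, one_mul]
  refine ⟨div_pos (pos_of_mul_pos_right ?_ hkx.le) (by positivity),
    div_pos (pos_of_mul_pos_right ?_ hkx.le) (by positivity)⟩
  · have h9 : -deriv (balanceFun d) (X y) * (deriv (radialSlope d) (X y) * deriv X y *
        radialSlope d y - radialSlope d (X y) * deriv (radialSlope d) y) =
        d * y ^ (d - 1) * (-deriv (radialSlope d) (X y)) * radialSlope d y +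
        d * X y ^ (d - 1) * radialSlope d (X y) * (-deriv (radialSlope d) y) := by
      linear_combination (-deriv (radialSlope d) (X y) * radialSlope d y) * hchain +
        deriv (radialSlope d) (X y) * h8 + deriv (radialSlope d) y * h7
    rw [h9]
    have h10 := neg_pos.2 h5
    have h11 := neg_pos.2 h6
    positivity
  · have h9 : -deriv (balanceFun d) (X y) * (X y - y * deriv X y) =
        -deriv (balanceFun d) (X y) * X y - y * deriv (balanceFun d) y := by
      linear_combination y * hchain
    rw [h9, sub_pos]
    have hpow : d * y ^ (d - 1) ≤ d * X y ^ (d - 1) := by gcongr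
    calc y * deriv (balanceFun d) y < y * (d * y ^ (d - 1)) := by gcongr
      _ ≤ X y * (d * X y ^ (d - 1)) := by gcongr
      _ < X y * -deriv (balanceFun d) (X y) := by gcongr; linarith
      _ = _ := mul_comm _ _

omit hr₀ in
lemma isCriticalPair_of_balance (ha : a ∈ Ioo 0 R) (hb : b ∈ Ioo 0 R)
    (hab : balanceFun d a = -balanceFun d b) (hα : radialSlope d a = α * radialSlope d b) :
    IsCriticalPair d R α a b where
  left_mem := ha
  right_mem := hb
  slope_eq := hα
  defect_eq := by
    rw [h.defectCoeff_eq_balance_mul ha, h.defectCoeff_eq_balance_mul hb, hab, hα]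
    ring

/-- The optimal volume ratio, as a function of the parameter. -/
theorem exists_optimal_ratio (hd : 2 ≤ d) : ∃ m : ℝ → ℝ,
    (∀ α ∈ Ioc (0 : ℝ) 1, m α ∈ Ioc (0 : ℝ) 1) ∧ StrictMonoOn m (Ioc 0 1) ∧
    (∃ m' : ℝ → ℝ, ContinuousOn m' (Ioo 0 1) ∧ ∀ α ∈ Ioo (0 : ℝ) 1, HasDerivAt m (m' α) α) ∧
    m 1 = 1 ∧ Tendsto m (𝓝[<] 1) (𝓝 1) ∧ Tendsto m (𝓝[>] 0) (𝓝 0) ∧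
    ∀ α ∈ Ioc (0 : ℝ) 1, ∃ a b, IsCriticalPair d R α a b ∧ m α = (b / a) ^ d := by
  obtain ⟨X, hX, hXc, hXt, hal', hnu'⟩ := h.exists_increasing_curve hr₀ hd
  set al : ℝ → ℝ := fun y => radialSlope d (X y) / radialSlope d y
  set nu : ℝ → ℝ := fun y => y / X y
  have hsub : ∀ y ∈ Ioo 0 r₀, y ∈ Ioo 0 R := fun y hy => ⟨hy.1, hy.2.trans hr₀.mem.2⟩
  have hXR : ∀ y ∈ Ioo 0 r₀, X y ∈ Ioo 0 R := fun y hy =>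
    ⟨hr₀.mem.1.trans (hX y hy).1.1, (hX y hy).1.2⟩
  have halc : ContDiffOn ℝ 1 al (Ioo 0 r₀) :=
    (h.contDiffOn_slope.comp hXc hXR).div (h.contDiffOn_slope.mono hsub)
      fun y hy => (h.slope_pos (hsub y hy)).ne'
  have hnuc : ContDiffOn ℝ 1 nu (Ioo 0 r₀) :=
    contDiffOn_id.div hXc fun y hy => (hXR y hy).1.ne'
  have halm : StrictMonoOn al (Ioo 0 r₀) := strictMonoOn_Ioo_of_hasDerivAt_pos
    (fun y hy => ((halc.differentiableOn one_ne_zero).differentiableAt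
      (Ioo_mem_nhds hy.1 hy.2)).hasDerivAt) hal'
  have hnum : StrictMonoOn nu (Ioo 0 r₀) := strictMonoOn_Ioo_of_hasDerivAt_pos
    (fun y hy => ((hnuc.differentiableOn one_ne_zero).differentiableAt
      (Ioo_mem_nhds hy.1 hy.2)).hasDerivAt) hnu'
  have halpos : ∀ y ∈ Ioo 0 r₀, 0 < al y := fun y hy =>
    div_pos (h.slope_pos (hXR y hy)) (h.slope_pos (hsub y hy))
  have hallt : ∀ y ∈ Ioo 0 r₀, al y < 1 := fun y hy => by
    rw [div_lt_one (h.slope_pos (hsub y hy))]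
    exact h.slope_strictAntiOn (hsub y hy) (hXR y hy) (hy.2.trans (hX y hy).1.1)
  have hnupos : ∀ y ∈ Ioo 0 r₀, 0 < nu y := fun y hy => div_pos hy.1 (hXR y hy).1
  have hnult : ∀ y ∈ Ioo 0 r₀, nu y < 1 := fun y hy => by
    rw [div_lt_one (hXR y hy).1]
    exact hy.2.trans (hX y hy).1.1
  have hXt' : Tendsto X (𝓝[<] r₀) (𝓝 r₀) := hXt.mono_right nhdsWithin_le_nhds
  have hid : Tendsto (fun y : ℝ => y) (𝓝[<] r₀) (𝓝 r₀) := nhdsWithin_le_nhds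
  have hPt : Tendsto (radialSlope d) (𝓝 r₀) (𝓝 (radialSlope d r₀)) :=
    (h.hasDerivAt_slope ⟨hr₀.mem.1, hr₀.mem.2.le⟩).continuousAt
  have hP0 := h.slope_pos hr₀.mem
  have hal1 : Tendsto al (𝓝[<] r₀) (𝓝 1) := by
    have := (hPt.comp hXt').div (hPt.comp hid) hP0.ne'
    rwa [div_self hP0.ne'] at this
  have hnu1 : Tendsto nu (𝓝[<] r₀) (𝓝 1) := by
    have := hid.div hXt' hr₀.mem.1.ne'
    rwa [div_self hr₀.mem.1.ne'] at this
  have hid0 : Tendsto (fun y : ℝ => y) (𝓝[>] 0) (𝓝 0) := nhdsWithin_le_nhds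
  have hnu0 : Tendsto nu (𝓝[>] 0) (𝓝 0) := by
    have h1 : Tendsto (fun y => y / r₀) (𝓝[>] 0) (𝓝 0) := by
      simpa using hid0.div_const r₀
    refine squeeze_zero' ?_ ?_ h1
    · filter_upwards [Ioo_mem_nhdsGT hr₀.mem.1] with y hy using (hnupos y hy).le
    · filter_upwards [Ioo_mem_nhdsGT hr₀.mem.1] with y hy
      exact div_le_div_of_nonneg_left hy.1.le hr₀.mem.1 (hX y hy).1.1.le
  have hal0 : Tendsto al (𝓝[>] 0) (𝓝 0) := by
    have hN0 : Tendsto (besselQuot d) (𝓝[>] 0) (𝓝 (d + 2)) := by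
      have h1 := h.continuousOn_quot 0 (left_mem_Icc.2 h.pos.le)
      rw [ContinuousWithinAt, quot_zero] at h1
      exact h1.mono_left (nhdsWithin_le_of_mem
        (mem_of_superset (Ioo_mem_nhdsGT h.pos) Ioo_subset_Icc_self))
    have h1 : Tendsto (fun y => radialSlope d r₀ * (y ^ (d + 1) / besselQuot d y)) (𝓝[>] 0)
        (𝓝 0) := by
      have := ((hid0.pow (d + 1)).div hN0 (by positivity)).const_mul (radialSlope d r₀)
      simpa using this
    refine squeeze_zero' ?_ ?_ h1
    · filter_upwards [Ioo_mem_nhdsGT hr₀.mem.1] with y hy using (halpos y hy).le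
    · filter_upwards [Ioo_mem_nhdsGT hr₀.mem.1] with y hy
      have h2 := h.slope_strictAntiOn.antitoneOn hr₀.mem (hXR y hy) (hX y hy).1.1.le
      have h3 : radialSlope d r₀ * (y ^ (d + 1) / besselQuot d y) =
          radialSlope d r₀ / radialSlope d y := by
        rw [radialSlope, radialSlope, div_eq_mul_inv _ (besselQuot d y / _), inv_div]
      rw [h3]
      exact div_le_div_of_nonneg_right h2 (h.slope_pos (hsub y hy)).le
  have himg : al '' Ioo 0 r₀ = Ioo 0 1 := by
    refine Subset.antisymm ?_ ?_
    · rintro _ ⟨y, hy, rfl⟩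
      exact ⟨halpos y hy, hallt y hy⟩
    · exact isPreconnected_Ioo.intermediate_value_Ioo
        (le_principal_iff.2 (Ioo_mem_nhdsGT hr₀.mem.1))
        (le_principal_iff.2 (Ioo_mem_nhdsLT hr₀.mem.1)) halc.continuousOn hal0 hal1
  obtain ⟨β, hβ, hβc⟩ := exists_contDiffOn_inverse isOpen_Ioo isOpen_Ioo halm himg halc
    fun y hy => (hal' y hy).ne'
  have hβ0 : Tendsto β (𝓝[>] 0) (𝓝[>] 0) :=
    tendsto_inverse_nhdsGT hr₀.mem.1 halm halpos (Ioo_mem_nhdsGT one_pos) hβ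
  have hβ1 : Tendsto β (𝓝[<] 1) (𝓝[<] r₀) :=
    tendsto_inverse_nhdsLT hr₀.mem.1 halm hallt (Ioo_mem_nhdsLT one_pos) hβ
  have hmc : ContDiffOn ℝ 1 (fun α => nu (β α) ^ d) (Ioo 0 1) :=
    (hnuc.comp hβc fun α hα => (hβ α hα).1).pow d
  have hm1 : ∀ α ∈ Ioo (0 : ℝ) 1, nu (β α) ^ d ∈ Ioo (0 : ℝ) 1 := fun α hα =>
    ⟨pow_pos (hnupos _ (hβ α hα).1) d, pow_lt_one₀ (hnupos _ (hβ α hα).1).le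
      (hnult _ (hβ α hα).1) (by omega)⟩
  set m : ℝ → ℝ := fun α => if α < 1 then nu (β α) ^ d else 1
  have hm : ∀ α < 1, m α = nu (β α) ^ d := fun α hα => if_pos hα
  have hmone : m 1 = 1 := if_neg (lt_irrefl 1)
  refine ⟨m, fun α hα => ?_, fun x hx y hy hxy => ?_, ⟨deriv fun α => nu (β α) ^ d,
    hmc.continuousOn_deriv_of_isOpen isOpen_Ioo le_rfl, fun α hα => ?_⟩, hmone, ?_, ?_,
    fun α hα => ?_⟩
  · rcases hα.2.lt_or_eq with h1 | rfl
    · rw [hm α h1]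
      exact Ioo_subset_Ioc_self (hm1 α ⟨hα.1, h1⟩)
    · rw [hmone]
      exact ⟨one_pos, le_rfl⟩
  · have hx1 : x < 1 := hxy.trans_le hy.2
    rw [hm x hx1]
    rcases hy.2.lt_or_eq with h1 | rfl
    · rw [hm y h1]
      obtain ⟨h2, h3⟩ := hβ x ⟨hx.1, hx1⟩
      obtain ⟨h4, h5⟩ := hβ y ⟨hy.1, h1⟩
      refine pow_lt_pow_left₀ (hnum h2 h4 ?_) (hnupos _ h2).le (by omega)
      rwa [← halm.lt_iff_lt h2 h4, h3, h5]
    · rw [hmone]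
      exact (hm1 x ⟨hx.1, hx1⟩).2
  · refine HasDerivAt.congr_of_eventuallyEq ((hmc.differentiableOn one_ne_zero).differentiableAt
      (Ioo_mem_nhds hα.1 hα.2)).hasDerivAt ?_
    filter_upwards [gt_mem_nhds hα.2] with z hz using hm z hz
  · have h1 : Tendsto (fun α => nu (β α) ^ d) (𝓝[<] 1) (𝓝 1) := by
      simpa using (hnu1.comp hβ1).pow d
    refine h1.congr' ?_
    filter_upwards [self_mem_nhdsWithin] with z hz using (hm z hz).symm
  · have h1 : Tendsto (fun α => nu (β α) ^ d) (𝓝[>] 0) (𝓝 0) := by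
      simpa [show d ≠ 0 by omega] using (hnu0.comp hβ0).pow d
    refine h1.congr' ?_
    filter_upwards [Ioo_mem_nhdsGT one_pos] with z hz using (hm z hz.2).symm
  · rcases hα.2.lt_or_eq with h1 | rfl
    · obtain ⟨h2, h3⟩ := hβ α ⟨hα.1, h1⟩
      refine ⟨X (β α), β α, h.isCriticalPair_of_balance (hXR _ h2) (hsub _ h2) (hX _ h2).2 ?_,
        hm α h1⟩
      exact (div_eq_iff (h.slope_pos (hsub _ h2)).ne').1 h3
    · refine ⟨r₀, r₀, h.isCriticalPair_of_balance hr₀.mem hr₀.mem ?_ (one_mul _).symm, ?_⟩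
      · rw [hr₀.balance_eq_zero, neg_zero]
      · rw [hmone, div_self hr₀.mem.1.ne', one_pow]

end IsFirstZero

end OptimalRatio

section LowerBound

variable {d : ℕ} {R r₀ a b α : ℝ} {L : ℝ≥0}

lemma gradient_congr_nhds {f g : EuclideanSpace ℝ (Fin d) → ℝ} {x : EuclideanSpace ℝ (Fin d)}
    (h : f =ᶠ[𝓝 x] g) : gradient f x = gradient g x := by
  rw [gradient, gradient, h.fderiv_eq]

lemma gradient_neg_apply (f : EuclideanSpace ℝ (Fin d) → ℝ) (x : EuclideanSpace ℝ (Fin d)) :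
    gradient (fun y => -f y) x = -gradient f x := by
  rw [gradient, gradient, fderiv_fun_neg, map_neg]

/-- The positive part of a trial function. -/
def positiveTrunc (u : EuclideanSpace ℝ (Fin d) → ℝ) (x : EuclideanSpace ℝ (Fin d)) : ℝ := max (u x) 0

lemma LipschitzWith.positiveTrunc {u : EuclideanSpace ℝ (Fin d) → ℝ} (hu : LipschitzWith L u) :
    LipschitzWith L (positiveTrunc u) := hu.max_const 0

lemma norm_gradient_posPart_sq_add_le {u : EuclideanSpace ℝ (Fin d) → ℝ} (hu : Continuous u)
    (x : EuclideanSpace ℝ (Fin d)) :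
    ‖gradient (positiveTrunc u) x‖ ^ 2 + ‖gradient (positiveTrunc fun y => -u y) x‖ ^ 2 ≤
      ‖gradient u x‖ ^ 2 := by
  have h0 : ∀ (v : EuclideanSpace ℝ (Fin d) → ℝ) y, 0 ≤ positiveTrunc v y := fun v y => le_max_right _ _
  have hz : ∀ v : EuclideanSpace ℝ (Fin d) → ℝ, v x ≤ 0 → gradient (positiveTrunc v) x = 0 :=
    fun v hv => gradient_eq_zero_of_nonneg (h0 v) (max_eq_right hv)
  have hp : ∀ v : EuclideanSpace ℝ (Fin d) → ℝ, Continuous v → 0 < v x →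
      gradient (positiveTrunc v) x = gradient v x := fun v hv hx => gradient_congr_nhds (by
    filter_upwards [hv.continuousAt.eventually (lt_mem_nhds hx)] with y hy
    exact max_eq_left hy.le)
  rcases lt_trichotomy (u x) 0 with hx | hx | hx
  · rw [hz u hx.le, hp (fun y => -u y) hu.neg (neg_pos.2 hx), gradient_neg_apply]
    simp
  · rw [hz u hx.le, hz _ (by simp [hx])]
    simp
  · rw [hp u hu hx, hz _ (by simpa using hx.le)]
    simp

lemma integrable_norm_gradient_sq_of_support {u : EuclideanSpace ℝ (Fin d) → ℝ}
    (hu : LipschitzWith L u) {ρ : ℝ} (hρ : ∀ x, ρ ≤ ‖x‖ → u x = 0) :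
    Integrable fun x => ‖gradient u x‖ ^ 2 := by
  refine integrable_of_le_of_support (C := L ^ 2) (ρ := ρ + 1)
    ((measurable_norm_gradient u).pow_const 2) (fun x => ?_) (fun x hx => ?_)
  · rw [abs_of_nonneg (by positivity)]
    exact pow_le_pow_left₀ (norm_nonneg _) (norm_gradient_le_of_lipschitz hu x) 2
  · have : u =ᶠ[𝓝 x] fun _ => 0 := by
      filter_upwards [continuous_norm.continuousAt.eventually
        (lt_mem_nhds (show ρ < ‖x‖ by linarith))] with y hy using hρ y hy.le
    rw [gradient_congr_nhds this]
    simp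

lemma exists_bound_of_support {u : EuclideanSpace ℝ (Fin d) → ℝ} (hu : Continuous u) {ρ : ℝ}
    (hρ : ∀ x, ρ ≤ ‖x‖ → u x = 0) : ∃ C, ∀ x, |u x| ≤ C := by
  have hc : HasCompactSupport u := HasCompactSupport.intro (isCompact_closedBall 0 ρ) fun x hx =>
    hρ x (by rw [mem_closedBall_zero_iff, not_le] at hx; exact hx.le)
  obtain ⟨C, hC⟩ := hc.exists_bound_of_continuous hu
  exact ⟨C, hC⟩

lemma integrable_mul_of_support {u g : EuclideanSpace ℝ (Fin d) → ℝ} (hu : Continuous u) {ρ : ℝ}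
    (hρ : ∀ x, ρ ≤ ‖x‖ → u x = 0) (hg : Measurable g) (hg1 : ∀ᵐ x, |g x| ≤ 1) :
    Integrable fun x => u x * g x := by
  obtain ⟨C, hC⟩ := exists_bound_of_support hu hρ
  exact (integrable_of_le_of_support hu.measurable hC hρ).mul_bdd (c := 1) hg.aestronglyMeasurable hg1

lemma quadratic_nonneg {s t G H : ℝ} (hα : 0 < α) (hst : α * s ≤ t) (hts : α * t ≤ s)
    (hs : 0 ≤ s) (ht : 0 ≤ t) (h1 : 0 < G + α ^ 2 * H) (h2 : 0 < H + α ^ 2 * G) :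
    0 ≤ G * s ^ 2 + H * t ^ 2 := by
  have h3 : (α * s) ^ 2 ≤ t ^ 2 := by gcongr
  have h4 : (α * t) ^ 2 ≤ s ^ 2 := by gcongr
  refine nonneg_of_mul_nonneg_right (a := α ^ 2) ?_ (by positivity)
  rcases le_total 0 G with hG | hG
  · rcases le_total 0 H with hH | hH
    · positivity
    · nlinarith [sq_nonneg s]
  · nlinarith [sq_nonneg t]

/-- The sharp lower bound for the Rayleigh quotient of an admissible function. -/
theorem le_rayleigh_of_isDirTrial (hd : 2 ≤ d) (h : IsFirstZero d R) (hr₀ : IsBalanced d R r₀)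
    (hα : 0 < α) (hc : IsCriticalPair d R α a b)
    {Ω : Set (EuclideanSpace ℝ (Fin d))} (hΩ : Bornology.IsBounded Ω)
    {g : EuclideanSpace ℝ (Fin d) → ℝ} (hg : Measurable g) (hgα : ∀ᵐ x, α ≤ g x ∧ g x ≤ 1)
    {u : EuclideanSpace ℝ (Fin d) → ℝ} (hu : IsDirTrial d Ω u) (hug : ∫ x, u x * g x = 0) :
    (volume.real (ball (0 : EuclideanSpace ℝ (Fin d)) 1) * (a ^ d + b ^ d)) ^ ((2 : ℝ) / d) ≤
      (volume Ω).toReal ^ ((2 : ℝ) / d) * rayleigh d u := by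
  obtain ⟨⟨L, huL⟩, hu0, hune⟩ := hu
  obtain ⟨ρ, hρΩ⟩ := hΩ.subset_ball 0
  have hρ : ∀ x, ρ ≤ ‖x‖ → u x = 0 := fun x hx => hu0 x fun hxΩ => by
    have := hρΩ hxΩ
    rw [mem_ball_zero_iff] at this
    linarith
  have hnL : LipschitzWith L fun x => -u x := huL.neg
  have hpρ : ∀ x, ρ ≤ ‖x‖ → positiveTrunc u x = 0 := fun x hx => by simp [positiveTrunc, hρ x hx]
  have hnρ : ∀ x, ρ ≤ ‖x‖ → positiveTrunc (fun y => -u y) x = 0 := fun x hx => by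
    simp [positiveTrunc, hρ x hx]
  have hp0 : ∀ x, 0 ≤ positiveTrunc u x := fun x => le_max_right _ _
  have hn0 : ∀ x, 0 ≤ positiveTrunc (fun y => -u y) x := fun x => le_max_right _ _
  have hupn : ∀ x, u x = positiveTrunc u x - positiveTrunc (fun y => -u y) x := fun x => by
    simp only [positiveTrunc]
    rcases le_total (u x) 0 with hx | hx
    · rw [max_eq_right hx, max_eq_left (neg_nonneg.2 hx)]; ring
    · rw [max_eq_left hx, max_eq_right (neg_nonpos.2 hx)]; ring
  have hpn : ∀ x, u x ^ 2 = positiveTrunc u x ^ 2 + positiveTrunc (fun y => -u y) x ^ 2 := fun x => by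
    simp only [positiveTrunc]
    rcases le_total (u x) 0 with hx | hx
    · rw [max_eq_right hx, max_eq_left (neg_nonneg.2 hx)]; ring
    · rw [max_eq_left hx, max_eq_right (neg_nonpos.2 hx)]; ring
  have hpL := huL.positiveTrunc
  have hnL' := hnL.positiveTrunc
  have hgrad := norm_gradient_posPart_sq_add_le huL.continuous
  have hpsub : ∀ x, 0 < positiveTrunc u x → x ∈ Ω ∧ 0 < u x := fun x hx => by
    have h1 : 0 < u x := by
      by_contra hcon
      rw [positiveTrunc, max_eq_right (not_lt.1 hcon)] at hx
      exact lt_irrefl _ hx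
    exact ⟨by_contra fun h2 => h1.ne' (hu0 x h2), h1⟩
  have hnsub : ∀ x, 0 < positiveTrunc (fun y => -u y) x → x ∈ Ω ∧ u x < 0 := fun x hx => by
    have h1 : u x < 0 := by
      by_contra hcon
      rw [positiveTrunc, max_eq_right (neg_nonpos.2 (not_lt.1 hcon))] at hx
      exact lt_irrefl _ hx
    exact ⟨by_contra fun h2 => h1.ne (hu0 x h2), h1⟩
  set p := positiveTrunc u
  set n := positiveTrunc fun y => -u y
  have hg1 : ∀ᵐ x, |g x| ≤ 1 := by
    filter_upwards [hgα] with x hx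
    exact abs_le.2 ⟨by linarith, hx.2⟩
  have hinteg : ∀ {v : EuclideanSpace ℝ (Fin d) → ℝ}, LipschitzWith L v →
      (∀ x, ρ ≤ ‖x‖ → v x = 0) → Integrable v := fun hv hvρ => by
    obtain ⟨C, hC⟩ := exists_bound_of_support hv.continuous hvρ
    exact integrable_of_le_of_support hv.continuous.measurable hC hvρ
  have hint2 : ∀ {v : EuclideanSpace ℝ (Fin d) → ℝ}, LipschitzWith L v →
      (∀ x, ρ ≤ ‖x‖ → v x = 0) → Integrable fun x => v x ^ 2 := fun {v} hv hvρ => by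
    have hc2 : Continuous fun x => v x ^ 2 := hv.continuous.pow 2
    have hρ2 : ∀ x, ρ ≤ ‖x‖ → v x ^ 2 = 0 := fun x hx => by simp [hvρ x hx]
    obtain ⟨C, hC⟩ := exists_bound_of_support hc2 hρ2
    exact integrable_of_le_of_support hc2.measurable hC hρ2
  have hpi := hinteg hpL hpρ
  have hni := hinteg hnL' hnρ
  have hpg := integrable_mul_of_support hpL.continuous hpρ hg hg1
  have hng := integrable_mul_of_support hnL'.continuous hnρ hg hg1
  have hbalance : ∫ x, p x * g x = ∫ x, n x * g x := by
    rw [← sub_eq_zero, ← integral_sub hpg hng, ← hug]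
    exact integral_congr_ae (ae_of_all _ fun x => by simp only [hupn x]; ring)
  have hweight : ∀ {v : EuclideanSpace ℝ (Fin d) → ℝ}, Integrable v → (∀ x, 0 ≤ v x) →
      Integrable (fun x => v x * g x) → α * ∫ x, v x ≤ ∫ x, v x * g x ∧
        ∫ x, v x * g x ≤ ∫ x, v x := fun {v} hv hv0 hvg => by
    rw [← integral_const_mul]
    refine ⟨integral_mono_ae (hv.const_mul α) hvg ?_, integral_mono_ae hvg hv ?_⟩
    · filter_upwards [hgα] with x hx
      rw [mul_comm]
      exact mul_le_mul_of_nonneg_left hx.1 (hv0 x)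
    · filter_upwards [hgα] with x hx
      exact mul_le_of_le_one_right (hv0 x) hx.2
  obtain ⟨hp1, hp2⟩ := hweight hpi hp0 hpg
  obtain ⟨hn1, hn2⟩ := hweight hni hn0 hng
  have hs0 : 0 ≤ ∫ x, p x := integral_nonneg hp0
  have ht0 : 0 ≤ ∫ x, n x := integral_nonneg hn0
  have hst : 0 < ∫ x, p x ∧ 0 < ∫ x, n x := by
    by_contra hcon
    have h1 : ∫ x, p x = 0 ∧ ∫ x, n x = 0 := by
      rw [not_and_or, not_lt, not_lt] at hcon
      rcases hcon with h1 | h1 <;> constructor <;> nlinarith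
    rw [integral_eq_zero_iff_of_nonneg hp0 hpi, integral_eq_zero_iff_of_nonneg hn0 hni] at h1
    refine hune ?_
    filter_upwards [h1.1, h1.2] with x hx hx'
    rw [hupn x, hx, hx']
    simp
  have hΩfin : volume Ω ≠ ∞ := ne_top_of_le_ne_top measure_ball_lt_top.ne (measure_mono hρΩ)
  have hpm : MeasurableSet {x | 0 < p x} := measurableSet_lt measurable_const hpL.continuous.measurable
  have hvolle : volume {x | 0 < p x} + volume {x | 0 < n x} ≤ volume Ω := by
    rw [← measure_union' _ hpm]
    · exact measure_mono (union_subset (fun x hx => (hpsub x hx).1) fun x hx => (hnsub x hx).1)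
    · rw [Set.disjoint_left]
      exact fun x hx hx' => lt_asymm (hpsub x hx).2 (hnsub x hx').2
  have hpfin : volume {x | 0 < p x} ≠ ∞ := ne_top_of_le_ne_top hΩfin (le_self_add.trans hvolle)
  have hnfin : volume {x | 0 < n x} ≠ ∞ := ne_top_of_le_ne_top hΩfin (le_add_self.trans hvolle)
  have hradius : ∀ {v : EuclideanSpace ℝ (Fin d) → ℝ}, Integrable v → (∀ x, 0 ≤ v x) →
      0 < ∫ x, v x → volume {x | 0 < v x} ≠ ∞ → ∃ r, 0 < r ∧
        volume (ball (0 : EuclideanSpace ℝ (Fin d)) r) = volume {x | 0 < v x} :=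
    fun {v} hv hv0 hv1 hfin => by
      obtain ⟨r, hr, hr'⟩ := exists_radius_of_volume hd hfin
      refine ⟨r, hr.lt_of_ne ?_, hr'⟩
      rintro rfl
      rw [ball_zero] at hr'
      rw [integral_pos_iff_support_of_nonneg hv0 hv] at hv1
      have : Function.support v = {x | 0 < v x} := by
        ext x
        exact ⟨fun hx => (hv0 x).lt_of_ne' hx, fun hx => ne_of_gt hx⟩
      rw [this, ← hr', measure_empty] at hv1
      exact lt_irrefl _ hv1
  obtain ⟨Rp, hRp, hVp⟩ := hradius hpi hp0 hst.1 hpfin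
  obtain ⟨Rn, hRn, hVn⟩ := hradius hni hn0 hst.2 hnfin
  have hd0 : (0 : ℝ) < d := by positivity
  have hω : 0 < volume.real (ball (0 : EuclideanSpace ℝ (Fin d)) 1) := by
    have : Nonempty (Fin d) := ⟨⟨0, by omega⟩⟩
    exact ENNReal.toReal_pos (measure_ball_pos _ _ one_pos).ne' measure_ball_lt_top.ne
  have hballvol : ∀ {r : ℝ}, 0 < r → (volume (ball (0 : EuclideanSpace ℝ (Fin d)) r)).toReal =
      r ^ d * volume.real (ball (0 : EuclideanSpace ℝ (Fin d)) 1) := fun {r} hr => by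
    rw [volume_ball_eq hd hr.le, ENNReal.toReal_mul, ENNReal.toReal_ofReal (by positivity),
      Measure.real]
  have hsum : (Rp ^ d + Rn ^ d) * volume.real (ball (0 : EuclideanSpace ℝ (Fin d)) 1) ≤
      (volume Ω).toReal := by
    rw [add_mul, ← hballvol hRp, ← hballvol hRn, hVp, hVn, ← ENNReal.toReal_add hpfin hnfin]
    exact ENNReal.toReal_mono hΩfin hvolle
  set ω := volume.real (ball (0 : EuclideanSpace ℝ (Fin d)) 1)
  set W := (volume Ω).toReal
  have hW : 0 < W := lt_of_lt_of_le (by positivity) hsum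
  have hQ : 0 < ∫ x, u x ^ 2 := by
    have h1 : (fun x => u x ^ 2) = fun x => p x ^ 2 + n x ^ 2 := funext hpn
    refine (integral_nonneg fun x => sq_nonneg _).lt_of_ne fun h0 => hune ?_
    have h2 := (integral_eq_zero_iff_of_nonneg (fun x => sq_nonneg (u x))
      (hint2 huL hρ)).1 h0.symm
    filter_upwards [h2] with x hx
    exact pow_eq_zero_iff two_ne_zero |>.1 hx
  have hQeq : ∫ x, u x ^ 2 = (∫ x, p x ^ 2) + ∫ x, n x ^ 2 := by
    rw [← integral_add (hint2 hpL hpρ) (hint2 hnL' hnρ)]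
    exact integral_congr_ae (ae_of_all _ hpn)
  have hEle : (∫ x, ‖gradient p x‖ ^ 2) + ∫ x, ‖gradient n x‖ ^ 2 ≤ ∫ x, ‖gradient u x‖ ^ 2 := by
    rw [← integral_add (integrable_norm_gradient_sq hpL hp0 hpρ)
      (integrable_norm_gradient_sq hnL' hn0 hnρ)]
    exact integral_mono ((integrable_norm_gradient_sq hpL hp0 hpρ).add
      (integrable_norm_gradient_sq hnL' hn0 hnρ))
      (integrable_norm_gradient_sq_of_support huL hρ) hgrad
  have hlam0 : 0 ≤ rayleigh d u :=
    div_nonneg (integral_nonneg fun x => by positivity) hQ.le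
  by_contra! hcon
  have ha0 := hc.left_mem.1
  have hb0 := hc.right_mem.1
  set V := a ^ d + b ^ d
  have hV : 0 < V := by positivity
  obtain ⟨k, hk1, hk2⟩ : ∃ k, √(rayleigh d u) < k ∧ k < (ω * V / W) ^ ((1 : ℝ) / d) := by
    refine exists_between ((Real.sqrt_lt' (by positivity)).2 ?_)
    rw [← Real.rpow_natCast, ← Real.rpow_mul (by positivity), Real.div_rpow (by positivity) hW.le]
    rw [show (1 : ℝ) / d * (2 : ℕ) = 2 / d by push_cast; ring, lt_div_iff₀ (by positivity)]
    rwa [mul_comm]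
  have hk0 : 0 < k := (Real.sqrt_nonneg _).trans_lt hk1
  have hk3 : rayleigh d u < k ^ 2 := (Real.sqrt_lt' hk0).1 hk1
  have hk4 : k ^ d * W < ω * V := by
    rw [← lt_div_iff₀ hW]
    have h1 := pow_lt_pow_left₀ hk2 hk0.le (show d ≠ 0 by omega)
    rwa [← Real.rpow_natCast (_ ^ _), ← Real.rpow_mul (by positivity),
      one_div_mul_cancel hd0.ne', Real.rpow_one] at h1
  have hlt : (k * Rp) ^ d + (k * Rn) ^ d < V := by
    rw [mul_pow, mul_pow, ← mul_add]
    refine lt_of_mul_lt_mul_left ?_ hω.le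
    calc ω * (k ^ d * (Rp ^ d + Rn ^ d)) = k ^ d * ((Rp ^ d + Rn ^ d) * ω) := by ring
      _ ≤ k ^ d * W := by gcongr
      _ < ω * V := hk4
  have hVR : V ≤ R ^ d := by
    have h1 := h.critical_volume_le hd hc hr₀.mem hr₀.mem
    have h2 : defectCoeff d r₀ = 0 := by simp [defectCoeff, hr₀.eq_sq]
    rw [h2, mul_zero, add_zero] at h1
    have h3 := pow_pos (h.slope_pos hc.left_mem) 2
    have h4 : V - (r₀ ^ d + r₀ ^ d) ≤ 0 := nonpos_of_mul_nonpos_right h1 h3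
    have h5 := h.two_mul_balanced_pow_le hd hr₀.mem hr₀.eq_sq hr₀.lt_sq
    linarith
  have hmem : ∀ {r r' : ℝ}, 0 < r → 0 < r' → r ^ d + r' ^ d < V → r ∈ Ioo 0 R :=
    fun {r r'} hr hr' hlt' => by
      refine ⟨hr, lt_of_pow_lt_pow_left₀ d h.pos.le ?_⟩
      have := pow_pos hr' d
      linarith
  have hkp : 0 < k * Rp := by positivity
  have hkn : 0 < k * Rn := by positivity
  have hmp := hmem hkp hkn hlt
  have hmn := hmem hkn hkp (by rwa [add_comm])
  have hEp := mul_sq_integral_le_of_volume hd h (Ioo_subset_Ioc_self hmp) hk0 hpL hp0 hpρ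
    (by rw [mul_div_cancel_left₀ _ hk0.ne', hVp])
  have hEn := mul_sq_integral_le_of_volume hd h (Ioo_subset_Ioc_self hmn) hk0 hnL' hn0 hnρ
    (by rw [mul_div_cancel_left₀ _ hk0.ne', hVn])
  have hquad := quadratic_nonneg hα (hp1.trans (hbalance.le.trans hn2))
    (hn1.trans (hbalance.ge.trans hp2)) hs0 ht0 (h.defectCoeff_add_pos hd hc hmp hmn hlt)
    (h.defectCoeff_add_pos hd hc hmn hmp (by rwa [add_comm]))
  have hdef : ∀ r, (d * besselQuot d r - r ^ 2) / r ^ (d + 2) = defectCoeff d r := fun r => rfl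
  rw [hdef, mul_assoc] at hEp hEn
  have hkω : 0 ≤ k ^ (d + 2) / ω := by positivity
  have h1 := mul_nonneg hkω hquad
  have h2 : ∫ x, ‖gradient u x‖ ^ 2 < k ^ 2 * ∫ x, u x ^ 2 := (div_lt_iff₀ hQ).1 hk3
  rw [hQeq] at h2
  linarith

end LowerBound

section RadialBump

variable {d : ℕ} {R a k : ℝ} {c x : EuclideanSpace ℝ (Fin d)}

/-- The radial profile of the extremal function on a ball, vanishing at distance `a / k`. -/
def radialBump (d : ℕ) (a k : ℝ) (c x : EuclideanSpace ℝ (Fin d)) : ℝ :=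
  besselPhi d (min (k * ‖x - c‖) a) - besselPhi d a

lemma radialBump_eq_zero (hx : a ≤ k * ‖x - c‖) : radialBump d a k c x = 0 := by
  rw [radialBump, min_eq_right hx, sub_self]

lemma integral_comp_norm_sub (F : ℝ → ℝ) (c : EuclideanSpace ℝ (Fin d)) :
    ∫ x, F ‖x - c‖ = ∫ x : EuclideanSpace ℝ (Fin d), F ‖x‖ :=
  integral_sub_right_eq_self (fun x => F ‖x‖) c

lemma exists_lipschitzWith_radialBump (hd : 2 ≤ d) (ha : 0 ≤ a) (hk : 0 ≤ k)
    (c : EuclideanSpace ℝ (Fin d)) : ∃ L, LipschitzWith L (radialBump d a k c) := by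
  have hd1 : (1 : ℝ) ≤ d := by exact_mod_cast (show 1 ≤ d by omega)
  have hc : Continuous fun r : ℝ => -(r / d) * besselPhi (d + 2) r := by
    have := continuous_besselPhi (n := (d : ℝ) + 2) (by linarith)
    fun_prop
  obtain ⟨C, hC⟩ := (isCompact_Icc (a := (0 : ℝ)) (b := a)).exists_bound_of_continuousOn
    hc.continuousOn
  have h1 : LipschitzOnWith C.toNNReal (besselPhi d) (Icc 0 a) :=
    Convex.lipschitzOnWith_of_nnnorm_hasDerivWithin_le (convex_Icc 0 a)
      (fun r _ => (hasDerivAt_besselPhi hd1 r).hasDerivWithinAt) fun r hr => by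
        rw [← NNReal.coe_le_coe, coe_nnnorm]
        exact (hC r hr).trans (Real.le_coe_toNNReal C)
  have h2 : LipschitzWith (‖k‖₊ * 1) fun x : EuclideanSpace ℝ (Fin d) => k * ‖x - c‖ := by
    have h3 : LipschitzWith 1 fun x : EuclideanSpace ℝ (Fin d) => ‖x - c‖ := by
      simpa only [dist_eq_norm] using LipschitzWith.dist_left c
    exact (lipschitzWith_smul k).comp h3
  have h3 := h1.comp (h2.min_const a).lipschitzOnWith (s := univ) fun x _ =>
    ⟨le_min (by positivity) ha, min_le_right _ _⟩
  obtain ⟨L, hL⟩ : ∃ L, LipschitzWith L fun x => besselPhi d (min (k * ‖x - c‖) a) :=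
    ⟨_, lipschitzOnWith_univ.1 h3⟩
  exact ⟨L, fun x y => by simpa [radialBump] using hL x y⟩

lemma hasDerivAt_pow_mul_besselPhi (hd : 2 ≤ d) (r : ℝ) :
    HasDerivAt (fun r => r ^ d / d * besselPhi (d + 2) r) (besselPhi d r * r ^ (d - 1)) r := by
  have hd1 : (1 : ℝ) ≤ d := by exact_mod_cast (show 1 ≤ d by omega)
  refine (((hasDerivAt_pow d r).div_const (d : ℝ)).mul (hasDerivAt_besselPhi_add_two r)).congr_deriv
    ?_
  rw [besselPhi_rec hd1 r]
  obtain ⟨n, rfl⟩ : ∃ n, d = n + 1 := ⟨d - 1, by omega⟩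
  rw [Nat.add_sub_cancel, pow_succ]
  field_simp
  ring

/-- The integral of the radial profile on `(0, a)` with weight `s ^ (d - 1)`. -/
def bumpMass (d : ℕ) (a : ℝ) : ℝ := a ^ (d + 2) * besselPhi (d + 4) a / (d ^ 2 * (d + 2))

lemma integral_bump (hd : 2 ≤ d) (a : ℝ) :
    ∫ s in 0..a, (besselPhi d s - besselPhi d a) * s ^ (d - 1) = bumpMass d a := by
  have hd1 : (1 : ℝ) ≤ d := by exact_mod_cast (show 1 ≤ d by omega)
  have hA := continuous_besselPhi hd1
  have hder : ∀ s ∈ uIcc 0 a, HasDerivAt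
      (fun s => s ^ d / d * besselPhi (d + 2) s - besselPhi d a * (s ^ d / d))
      ((besselPhi d s - besselPhi d a) * s ^ (d - 1)) s := fun s _ => by
    refine ((hasDerivAt_pow_mul_besselPhi hd s).sub
      (((hasDerivAt_pow d s).div_const (d : ℝ)).const_mul (besselPhi d a))).congr_deriv ?_
    field_simp
  rw [intervalIntegral.integral_eq_sub_of_hasDerivAt hder
    (Continuous.intervalIntegrable (by fun_prop) _ _), bumpMass, besselPhi_rec hd1 a,
    zero_pow (by omega)]
  field_simp
  ring

lemma integral_bump_energy (hd : 2 ≤ d) (hφ : besselPhi (d + 4) a ≠ 0) :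
    ∫ s in 0..a, ((s / d * besselPhi (d + 2) s) ^ 2 - (besselPhi d s - besselPhi d a) ^ 2) *
      s ^ (d - 1) = d * defectCoeff d a * bumpMass d a ^ 2 := by
  have hd1 : (1 : ℝ) ≤ d := by exact_mod_cast (show 1 ≤ d by omega)
  have hA := continuous_besselPhi hd1
  have hB := continuous_besselPhi (n := (d : ℝ) + 2) (by linarith)
  have hder : ∀ s ∈ uIcc 0 a, HasDerivAt
      (fun s => besselPhi d a * (s ^ d / d * besselPhi (d + 2) s - besselPhi d a * (s ^ d / d)) -
        (besselPhi d s - besselPhi d a) * (s ^ d / d * besselPhi (d + 2) s))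
      (((s / d * besselPhi (d + 2) s) ^ 2 - (besselPhi d s - besselPhi d a) ^ 2) * s ^ (d - 1))
      s := fun s _ => by
    have h1 := hasDerivAt_pow_mul_besselPhi hd s
    refine (((h1.sub (((hasDerivAt_pow d s).div_const (d : ℝ)).const_mul (besselPhi d a))).const_mul
      (besselPhi d a)).sub (((hasDerivAt_besselPhi hd1 s).sub_const (besselPhi d a)).mul
        h1)).congr_deriv ?_
    obtain ⟨n, rfl⟩ : ∃ n, d = n + 1 := ⟨d - 1, by omega⟩
    rw [Nat.add_sub_cancel, pow_succ]
    field_simp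
    ring
  rw [intervalIntegral.integral_eq_sub_of_hasDerivAt hder
    (Continuous.intervalIntegrable (by fun_prop) _ _), bumpMass, defectCoeff, besselQuot,
    besselPhi_rec hd1 a, zero_pow (by omega)]
  have : (d : ℝ) + 2 ≠ 0 := by positivity
  field_simp
  ring

namespace IsFirstZero

variable (h : IsFirstZero d R)
include h

lemma besselPhi_add_two_nonneg {r : ℝ} (hr : r ∈ Icc 0 R) : 0 ≤ besselPhi (d + 2) r := by
  have h1 := h.quot_nonneg hr
  have h2 := h.besselPhi_add_four_pos hr
  rw [besselQuot] at h1
  by_contra! hcon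
  exact absurd h1 (not_le.2 (div_neg_of_neg_of_pos (mul_neg_of_pos_of_neg (by positivity) hcon) h2))

lemma besselPhi_antitoneOn (hd : 2 ≤ d) : AntitoneOn (besselPhi d) (Icc 0 R) := by
  have hd1 : (1 : ℝ) ≤ d := by exact_mod_cast (show 1 ≤ d by omega)
  have h1 := monotoneOn_Icc_of_hasDerivAt_nonneg (f := fun r => -besselPhi d r) (a := 0) (b := R)
    (continuous_besselPhi hd1).neg.continuousOn (fun x _ => (hasDerivAt_besselPhi hd1 x).neg)
    fun x hx => by
      have h2 := h.besselPhi_add_two_nonneg (Ioo_subset_Icc_self hx)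
      have h3 := hx.1
      rw [neg_mul, neg_neg]
      positivity
  exact fun x hx y hy hxy => neg_le_neg_iff.1 (h1 hx hy hxy)

lemma radialBump_nonneg (hd : 2 ≤ d) (ha : a ∈ Ioo 0 R) (hk : 0 < k) (x : EuclideanSpace ℝ (Fin d)) :
    0 ≤ radialBump d a k c x :=
  sub_nonneg.2 (h.besselPhi_antitoneOn hd ⟨le_min (by positivity) ha.1.le,
    (min_le_right _ _).trans ha.2.le⟩ ⟨ha.1.le, ha.2.le⟩ (min_le_right _ _))

lemma norm_gradient_radialBump_le (hd : 2 ≤ d) (ha : a ∈ Ioo 0 R) (hk : 0 < k) (hx : x ≠ c) :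
    ‖gradient (radialBump d a k c) x‖ ^ 2 ≤ if k * ‖x - c‖ ≤ a then
      k ^ 2 * (k * ‖x - c‖ / d * besselPhi (d + 2) (k * ‖x - c‖)) ^ 2 else 0 := by
  have hd1 : (1 : ℝ) ≤ d := by exact_mod_cast (show 1 ≤ d by omega)
  rcases lt_or_ge (k * ‖x - c‖) a with hlt | hle
  · rw [if_pos hlt.le]
    have hN : DifferentiableAt ℝ (fun y : EuclideanSpace ℝ (Fin d) => ‖y - c‖) x :=
      (differentiableAt_id.sub_const c).norm ℝ (sub_ne_zero.2 hx)
    have hNL : LipschitzWith 1 fun y : EuclideanSpace ℝ (Fin d) => ‖y - c‖ := by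
      simpa only [dist_eq_norm] using LipschitzWith.dist_left c
    have hder := ((hasDerivAt_besselPhi hd1 (k * ‖x - c‖)).comp_hasFDerivAt x
      (hN.hasFDerivAt.const_mul k)).sub_const (besselPhi d a)
    have heq : radialBump d a k c =ᶠ[𝓝 x] fun y => besselPhi d (k * ‖y - c‖) - besselPhi d a := by
      have hcont : Continuous fun y : EuclideanSpace ℝ (Fin d) => k * ‖y - c‖ := by fun_prop
      filter_upwards [hcont.continuousAt.eventually (gt_mem_nhds hlt)] with y hy
      rw [radialBump, min_eq_left hy.le]
    rw [norm_gradient_eq, heq.fderiv_eq]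
    have h1 : ‖fderiv ℝ (fun y => besselPhi d (k * ‖y - c‖) - besselPhi d a) x‖ ≤
        |k * ‖x - c‖ / d * besselPhi (d + 2) (k * ‖x - c‖)| * k := by
      have h2 := norm_fderiv_le_of_lipschitz ℝ (x₀ := x) hNL
      have e : fderiv ℝ (fun y => besselPhi d (k * ‖y - c‖) - besselPhi d a) x =
          (-(k * ‖x - c‖ / d) * besselPhi (d + 2) (k * ‖x - c‖)) •
            k • fderiv ℝ (fun y : EuclideanSpace ℝ (Fin d) => ‖y - c‖) x := hder.fderiv
      rw [e, norm_smul, norm_smul, neg_mul, norm_neg, Real.norm_eq_abs,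
        Real.norm_of_nonneg hk.le]
      refine mul_le_mul_of_nonneg_left ?_ (abs_nonneg _)
      exact mul_le_of_le_one_right hk.le h2
    refine (pow_le_pow_left₀ (norm_nonneg _) h1 2).trans_eq ?_
    rw [mul_pow, sq_abs, mul_comm]
  · rw [gradient_eq_zero_of_nonneg (h.radialBump_nonneg hd ha hk) (radialBump_eq_zero hle)]
    rw [norm_zero, zero_pow two_ne_zero]
    split_ifs
    · positivity
    · exact le_rfl

lemma bumpMass_pos (hd : 2 ≤ d) (ha : a ∈ Ioo 0 R) : 0 < bumpMass d a := by
  have h1 := h.besselPhi_add_four_pos ⟨ha.1.le, ha.2.le⟩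
  have h2 := ha.1
  have h3 : (0 : ℝ) < d := by exact_mod_cast (show 0 < d by omega)
  rw [bumpMass]
  positivity

lemma integral_norm_gradient_radialBump_le (hd : 2 ≤ d) (ha : a ∈ Ioo 0 R) (hk : 0 < k)
    (c : EuclideanSpace ℝ (Fin d)) :
    k ^ d * ((∫ x, ‖gradient (radialBump d a k c) x‖ ^ 2) -
      k ^ 2 * ∫ x, radialBump d a k c x ^ 2) ≤
      k ^ 2 * (d * volume.real (ball (0 : EuclideanSpace ℝ (Fin d)) 1)) *
        (d * defectCoeff d a * bumpMass d a ^ 2) := by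
  have hd1 : (1 : ℝ) ≤ d := by exact_mod_cast (show 1 ≤ d by omega)
  have hA := continuous_besselPhi hd1
  have hB := continuous_besselPhi (n := (d : ℝ) + 2) (by linarith)
  have : Nonempty (Fin d) := ⟨⟨0, by omega⟩⟩
  have ha0 := ha.1.le
  set B : ℝ → ℝ := fun r => if k * r ≤ a then
      k ^ 2 * (k * r / d * besselPhi (d + 2) (k * r)) ^ 2 else 0 with hBdef
  set W : ℝ → ℝ := fun r => (besselPhi d (min (k * r) a) - besselPhi d a) ^ 2 with hWdef
  have hBint : Integrable fun x : EuclideanSpace ℝ (Fin d) => B ‖x - c‖ := by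
    have hset : {x : EuclideanSpace ℝ (Fin d) | k * ‖x - c‖ ≤ a} = closedBall c (a / k) := by
      ext x
      rw [mem_ofPred_eq, mem_closedBall, dist_eq_norm, le_div_iff₀' hk]
    have hcont : Continuous fun x : EuclideanSpace ℝ (Fin d) =>
        k ^ 2 * (k * ‖x - c‖ / d * besselPhi (d + 2) (k * ‖x - c‖)) ^ 2 := by fun_prop
    refine ((integrable_indicator_iff measurableSet_closedBall).2
      (hcont.continuousOn.integrableOn_compact (isCompact_closedBall c (a / k)))).congr
      (ae_of_all _ fun x => ?_)
    rw [← hset]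
    rfl
  have h1 : ∫ x, ‖gradient (radialBump d a k c) x‖ ^ 2 ≤ ∫ x : EuclideanSpace ℝ (Fin d), B ‖x‖ := by
    rw [← integral_comp_norm_sub B c]
    refine integral_mono_of_nonneg (ae_of_all _ fun x => sq_nonneg _) hBint ?_
    filter_upwards [compl_mem_ae_iff.2 (measure_singleton c)] with x hx
    exact h.norm_gradient_radialBump_le hd ha hk hx
  have h2 : ∫ x, radialBump d a k c x ^ 2 = ∫ x : EuclideanSpace ℝ (Fin d), W ‖x‖ :=
    integral_comp_norm_sub W c
  have h3 := integral_norm_scaled hd (f := B) hk ha0 fun r hr => by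
    rw [div_lt_iff₀' hk] at hr
    exact if_neg (not_le.2 hr)
  have h4 := integral_norm_scaled hd (f := W) hk ha0 fun r hr => by
    rw [div_lt_iff₀' hk] at hr
    simp [hWdef, min_eq_right hr.le]
  have h5 : ∫ s in 0..a, B (k⁻¹ * s) * s ^ (d - 1) =
      ∫ s in 0..a, k ^ 2 * ((s / d * besselPhi (d + 2) s) ^ 2 * s ^ (d - 1)) := by
    refine intervalIntegral.integral_congr fun s hs => ?_
    rw [uIcc_of_le ha0] at hs
    simp only [hBdef, mul_inv_cancel_left₀ hk.ne', if_pos hs.2, mul_assoc]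
  have h6 : ∫ s in 0..a, W (k⁻¹ * s) * s ^ (d - 1) =
      ∫ s in 0..a, (besselPhi d s - besselPhi d a) ^ 2 * s ^ (d - 1) := by
    refine intervalIntegral.integral_congr fun s hs => ?_
    rw [uIcc_of_le ha0] at hs
    simp only [hWdef, mul_inv_cancel_left₀ hk.ne', min_eq_left hs.2]
  rw [h5, intervalIntegral.integral_const_mul] at h3
  rw [h6] at h4
  have h7 := integral_bump_energy hd (h.besselPhi_add_four_pos ⟨ha.1.le, ha.2.le⟩).ne'
  simp only [sub_mul] at h7
  rw [intervalIntegral.integral_sub (Continuous.intervalIntegrable (by fun_prop) _ _)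
    (Continuous.intervalIntegrable (by fun_prop) _ _)] at h7
  calc _ ≤ k ^ d * ((∫ x : EuclideanSpace ℝ (Fin d), B ‖x‖) -
        k ^ 2 * ∫ x : EuclideanSpace ℝ (Fin d), W ‖x‖) := by
        rw [h2]; gcongr
    _ = (k ^ d * ∫ x : EuclideanSpace ℝ (Fin d), B ‖x‖) -
        k ^ 2 * (k ^ d * ∫ x : EuclideanSpace ℝ (Fin d), W ‖x‖) := by ring
    _ = _ := by rw [h3, h4, ← h7]; ring

end IsFirstZero

lemma integral_radialBump (hd : 2 ≤ d) (ha : 0 ≤ a) (hk : 0 < k) (c : EuclideanSpace ℝ (Fin d)) :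
    k ^ d * ∫ x, radialBump d a k c x =
      d * volume.real (ball (0 : EuclideanSpace ℝ (Fin d)) 1) * bumpMass d a := by
  set W : ℝ → ℝ := fun r => besselPhi d (min (k * r) a) - besselPhi d a with hWdef
  have h2 : ∫ x, radialBump d a k c x = ∫ x : EuclideanSpace ℝ (Fin d), W ‖x‖ :=
    integral_comp_norm_sub W c
  rw [h2, integral_norm_scaled hd (f := W) hk ha fun r hr => by
    rw [div_lt_iff₀' hk] at hr
    simp [hWdef, min_eq_right hr.le], ← integral_bump hd]
  congr 1
  refine intervalIntegral.integral_congr fun s hs => ?_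
  rw [uIcc_of_le ha] at hs
  simp only [hWdef, mul_inv_cancel_left₀ hk.ne', min_eq_left hs.2]

end RadialBump

section UpperBound

variable {d : ℕ}

lemma norm_gradient_sub_sq_of_disjoint {f g : EuclideanSpace ℝ (Fin d) → ℝ} (hf0 : ∀ x, 0 ≤ f x)
    (hg0 : ∀ x, 0 ≤ g x) (hfg : ∀ x, f x = 0 ∨ g x = 0) (s t : ℝ) {x : EuclideanSpace ℝ (Fin d)}
    (hf : DifferentiableAt ℝ f x) (hg : DifferentiableAt ℝ g x) :
    ‖gradient (fun y => s * f y - t * g y) x‖ ^ 2 =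
      s ^ 2 * ‖gradient f x‖ ^ 2 + t ^ 2 * ‖gradient g x‖ ^ 2 := by
  have e : fderiv ℝ (fun y => s * f y - t * g y) x = s • fderiv ℝ f x - t • fderiv ℝ g x :=
    ((hf.hasFDerivAt.const_mul s).sub (hg.hasFDerivAt.const_mul t)).fderiv
  rw [norm_gradient_eq, e]
  rcases hfg x with hx | hx
  · have h1 : fderiv ℝ f x = 0 := by
      rw [← norm_eq_zero, ← norm_gradient_eq, gradient_eq_zero_of_nonneg hf0 hx, norm_zero]
    rw [norm_gradient_eq, norm_gradient_eq, h1, smul_zero, zero_sub, norm_neg, norm_smul, mul_pow,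
      Real.norm_eq_abs, sq_abs]
    simp
  · have h1 : fderiv ℝ g x = 0 := by
      rw [← norm_eq_zero, ← norm_gradient_eq, gradient_eq_zero_of_nonneg hg0 hx, norm_zero]
    rw [norm_gradient_eq, norm_gradient_eq, h1, smul_zero, sub_zero, norm_smul, mul_pow,
      Real.norm_eq_abs, sq_abs]
    simp

lemma exists_lipschitzWith_sub {f g : EuclideanSpace ℝ (Fin d) → ℝ} (hf : ∃ K, LipschitzWith K f)
    (hg : ∃ K, LipschitzWith K g) (s t : ℝ) : ∃ K, LipschitzWith K fun x => s * f x - t * g x := by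
  obtain ⟨K, hK⟩ := hf
  obtain ⟨L, hL⟩ := hg
  exact ⟨_, ((lipschitzWith_smul s).comp hK).sub ((lipschitzWith_smul t).comp hL)⟩

/-- A combination of two nonnegative bumps with disjoint supports is not almost everywhere zero. -/
lemma not_ae_eq_zero_of_disjoint {f g : EuclideanSpace ℝ (Fin d) → ℝ}
    (hfg : ∀ x, f x = 0 ∨ g x = 0) {s : ℝ} (hs : s ≠ 0) (t : ℝ) (hf : ∫ x, f x ≠ 0) :
    ¬ (fun x => s * f x - t * g x) =ᵐ[volume] fun _ => (0 : ℝ) := by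
  intro h
  refine hf (integral_eq_zero_of_ae ?_)
  filter_upwards [h] with x hx
  rcases hfg x with h0 | h0
  · exact h0
  · rw [h0, mul_zero, sub_zero] at hx
    exact (mul_eq_zero.1 hx).resolve_left hs

variable {R α a b : ℝ}

lemma exists_isDirTrial_two_balls (hd : 2 ≤ d) (h : IsFirstZero d R)
    (hc : IsCriticalPair d R α a b) {k rp rm : ℝ} (hk : 0 < k) (hp : a / k = rp) (hm : b / k = rm)
    {cp cm : EuclideanSpace ℝ (Fin d)} (hdisj : Disjoint (ball cp rp) (ball cm rm)) :
    ∃ u, IsDirTrial d (ball cp rp ∪ ball cm rm) u ∧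
      ∫ x, u x * chiBang d α (ball cm rm) x = 0 ∧ rayleigh d u ≤ k ^ 2 := by
  set ω := volume.real (ball (0 : EuclideanSpace ℝ (Fin d)) 1)
  have ha := hc.left_mem
  have hb := hc.right_mem
  have hω : 0 < ω := ENNReal.toReal_pos (measure_ball_pos volume _ one_pos).ne'
    measure_ball_lt_top.ne
  have hd0 : (0 : ℝ) < d := by exact_mod_cast (show 0 < d by omega)
  have hS := h.bumpMass_pos hd ha
  have hT := h.bumpMass_pos hd hb
  set S := bumpMass d a
  set T := bumpMass d b
  set f := radialBump d a k cp with hfdef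
  set g := radialBump d b k cm with hgdef
  have hfz : ∀ x, x ∉ ball cp rp → f x = 0 := fun x hx => radialBump_eq_zero (by
    rw [mem_ball, dist_eq_norm, not_lt, ← hp, div_le_iff₀' hk] at hx; exact hx)
  have hgz : ∀ x, x ∉ ball cm rm → g x = 0 := fun x hx => radialBump_eq_zero (by
    rw [mem_ball, dist_eq_norm, not_lt, ← hm, div_le_iff₀' hk] at hx; exact hx)
  have hfg : ∀ x, f x = 0 ∨ g x = 0 := fun x => by
    by_cases hx : x ∈ ball cp rp
    · exact Or.inr (hgz x (disjoint_left.1 hdisj hx))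
    · exact Or.inl (hfz x hx)
  have hf0 : ∀ x, 0 ≤ f x := h.radialBump_nonneg hd ha hk
  have hg0 : ∀ x, 0 ≤ g x := h.radialBump_nonneg hd hb hk
  obtain ⟨K, hK⟩ := exists_lipschitzWith_radialBump hd ha.1.le hk.le cp
  obtain ⟨L, hL⟩ := exists_lipschitzWith_radialBump hd hb.1.le hk.le cm
  have hsupp : ∀ (c : EuclideanSpace ℝ (Fin d)) (r : ℝ) x, ‖c‖ + r ≤ ‖x‖ → x ∉ ball c r :=
    fun c r x hx hx' => by
      rw [mem_ball, dist_eq_norm] at hx'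
      linarith [norm_sub_norm_le x c]
  have hfρ : ∀ x, ‖cp‖ + rp ≤ ‖x‖ → f x = 0 := fun x hx => hfz x (hsupp _ _ x hx)
  have hgρ : ∀ x, ‖cm‖ + rm ≤ ‖x‖ → g x = 0 := fun x hx => hgz x (hsupp _ _ x hx)
  have hfi : Integrable f := by
    simpa using integrable_mul_of_support (g := fun _ => 1) hK.continuous hfρ measurable_const
      (by simp)
  have hgi : Integrable g := by
    simpa using integrable_mul_of_support (g := fun _ => 1) hL.continuous hgρ measurable_const
      (by simp)
  obtain ⟨Cf, hCf⟩ := exists_bound_of_support hK.continuous hfρ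
  obtain ⟨Cg, hCg⟩ := exists_bound_of_support hL.continuous hgρ
  have hf2 : Integrable fun x => f x ^ 2 := by
    simp only [sq]
    exact hfi.mul_bdd (c := Cf) hK.continuous.aestronglyMeasurable (ae_of_all _ hCf)
  have hg2 : Integrable fun x => g x ^ 2 := by
    simp only [sq]
    exact hgi.mul_bdd (c := Cg) hL.continuous.aestronglyMeasurable (ae_of_all _ hCg)
  have hfI := integral_radialBump hd ha.1.le hk cp
  have hgI := integral_radialBump hd hb.1.le hk cm
  have hfE := h.integral_norm_gradient_radialBump_le hd ha hk cp
  have hgE := h.integral_norm_gradient_radialBump_le hd hb hk cm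
  rw [← hfdef] at hfI hfE
  rw [← hgdef] at hgI hgE
  have hkd : 0 < k ^ d := by positivity
  refine ⟨fun x => T * f x - α * S * g x, ⟨exists_lipschitzWith_sub ⟨K, hK⟩ ⟨L, hL⟩ _ _,
    fun x hx => ?_, ?_⟩, ?_, ?_⟩
  · rw [mem_union, not_or] at hx
    simp [hfz x hx.1, hgz x hx.2]
  · refine not_ae_eq_zero_of_disjoint hfg hT.ne' _ fun h0 => ?_
    rw [h0, mul_zero] at hfI
    exact absurd hfI (by positivity)
  · have e : ∀ x, (T * f x - α * S * g x) * chiBang d α (ball cm rm) x =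
        T * α * f x - α * S * g x := fun x => by
      rw [chiBang]
      split_ifs with hx
      · rw [hfz x (disjoint_right.1 hdisj hx)]; ring
      · rw [hgz x hx]; ring
    simp only [e]
    rw [integral_sub (hfi.const_mul _) (hgi.const_mul _), integral_const_mul, integral_const_mul]
    have : k ^ d * (T * α * ∫ x, f x) = k ^ d * (α * S * ∫ x, g x) := by
      linear_combination T * α * hfI - α * S * hgI
    exact sub_eq_zero.2 (mul_left_cancel₀ hkd.ne' this)
  · have hgrad : ∫ x, ‖gradient (fun y => T * f y - α * S * g y) x‖ ^ 2 =
        T ^ 2 * (∫ x, ‖gradient f x‖ ^ 2) + (α * S) ^ 2 * ∫ x, ‖gradient g x‖ ^ 2 := by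
      rw [← integral_const_mul, ← integral_const_mul, ← integral_add
        ((integrable_norm_gradient_sq_of_support hK hfρ).const_mul _)
        ((integrable_norm_gradient_sq_of_support hL hgρ).const_mul _)]
      refine integral_congr_ae ?_
      filter_upwards [hK.ae_differentiableAt (μ := volume), hL.ae_differentiableAt (μ := volume)]
        with x hx1 hx2
      exact norm_gradient_sub_sq_of_disjoint hf0 hg0 hfg _ _ hx1 hx2
    have hsq : ∫ x, (T * f x - α * S * g x) ^ 2 =
        T ^ 2 * (∫ x, f x ^ 2) + (α * S) ^ 2 * ∫ x, g x ^ 2 := by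
      rw [← integral_const_mul, ← integral_const_mul, ← integral_add (hf2.const_mul _)
        (hg2.const_mul _)]
      refine integral_congr_ae (ae_of_all _ fun x => ?_)
      simp only
      rcases hfg x with hx | hx <;> rw [hx] <;> ring
    refine div_le_of_le_mul₀ (integral_nonneg fun x => sq_nonneg _) (sq_nonneg _) ?_
    rw [hgrad, hsq]
    refine le_of_mul_le_mul_left ?_ hkd
    have h1 := mul_le_mul_of_nonneg_left hfE (sq_nonneg T)
    have h2 := mul_le_mul_of_nonneg_left hgE (sq_nonneg (α * S))
    have h3 : T ^ 2 * (k ^ 2 * (d * ω) * (d * defectCoeff d a * S ^ 2)) +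
        (α * S) ^ 2 * (k ^ 2 * (d * ω) * (d * defectCoeff d b * T ^ 2)) = 0 := by
      linear_combination T ^ 2 * k ^ 2 * (d * ω) * d * S ^ 2 * hc.defect_eq
    linarith

lemma twistedEV_two_balls_le (hd : 2 ≤ d) (h : IsFirstZero d R)
    (hc : IsCriticalPair d R α a b) {rp rm : ℝ} (hrp : 0 < rp) (hrm : 0 < rm)
    {cp cm : EuclideanSpace ℝ (Fin d)} (hdisj : Disjoint (ball cp rp) (ball cm rm))
    (hvol : (volume (ball cm rm)).toReal = (b / a) ^ d * (volume (ball cp rp)).toReal) :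
    (volume (ball cp rp ∪ ball cm rm)).toReal ^ ((2 : ℝ) / d) *
        twistedEV d (ball cp rp ∪ ball cm rm) (chiBang d α (ball cm rm)) ≤
      (volume.real (ball (0 : EuclideanSpace ℝ (Fin d)) 1) * (a ^ d + b ^ d)) ^ ((2 : ℝ) / d) := by
  have ha := hc.left_mem.1
  have hb := hc.right_mem.1
  have hd0 : d ≠ 0 := by omega
  have hball : ∀ (c : EuclideanSpace ℝ (Fin d)) {r : ℝ}, 0 ≤ r → (volume (ball c r)).toReal =
      r ^ d * volume.real (ball (0 : EuclideanSpace ℝ (Fin d)) 1) := fun c r hr => by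
    rw [volume_ball_eq hd hr, ENNReal.toReal_mul, ENNReal.toReal_ofReal (by positivity), Measure.real]
  have hω : 0 < volume.real (ball (0 : EuclideanSpace ℝ (Fin d)) 1) :=
    ENNReal.toReal_pos (measure_ball_pos volume _ one_pos).ne' measure_ball_lt_top.ne
  set ω := volume.real (ball (0 : EuclideanSpace ℝ (Fin d)) 1)
  have hr : rm = b / a * rp := by
    rw [hball _ hrm.le, hball _ hrp.le, ← mul_assoc, ← mul_pow] at hvol
    exact (pow_left_inj₀ hrm.le (by positivity) hd0).1 (mul_right_cancel₀ hω.ne' hvol)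
  have hk : 0 < a / rp := by positivity
  obtain ⟨u, hu, hu1, hu2⟩ := exists_isDirTrial_two_balls hd h hc hk (rp := rp) (rm := rm)
    (by field_simp) (by rw [hr]; field_simp) hdisj
  have hle : twistedEV d (ball cp rp ∪ ball cm rm) (chiBang d α (ball cm rm)) ≤ (a / rp) ^ 2 := by
    refine le_trans (csInf_le ⟨0, ?_⟩ ⟨u, hu, hu1, rfl⟩) hu2
    rintro _ ⟨v, -, -, rfl⟩
    exact div_nonneg (integral_nonneg fun x => by positivity)
      (integral_nonneg fun x => sq_nonneg _)
  refine (mul_le_mul_of_nonneg_left hle (by positivity)).trans_eq ?_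
  have hV : (volume (ball cp rp ∪ ball cm rm)).toReal * (a / rp) ^ d = ω * (a ^ d + b ^ d) := by
    rw [measure_union hdisj measurableSet_ball, ENNReal.toReal_add measure_ball_lt_top.ne
      measure_ball_lt_top.ne, hball _ hrm.le, hball _ hrp.le, hr]
    simp only [mul_pow, div_pow]
    field_simp
  rw [← hV, Real.mul_rpow (by positivity) (by positivity)]
  congr 1
  rw [← Real.rpow_natCast (a / rp) d, ← Real.rpow_mul hk.le, mul_div_cancel₀ _
    (Nat.cast_ne_zero.2 hd0), Real.rpow_two]

end UpperBound

section Admissible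

variable {d : ℕ}

/-- The cone function with vertex `c` and support in the closed ball of radius `ε`. -/
def cone (ε : ℝ) (c x : EuclideanSpace ℝ (Fin d)) : ℝ := max (ε - ‖x - c‖) 0

lemma lipschitzWith_cone (ε : ℝ) (c : EuclideanSpace ℝ (Fin d)) : LipschitzWith 1 (cone ε c) := by
  have h : LipschitzWith 1 fun x : EuclideanSpace ℝ (Fin d) => ‖x - c‖ := by
    simpa only [dist_eq_norm] using LipschitzWith.dist_left c
  have h2 : LipschitzWith (0 + 1) fun x : EuclideanSpace ℝ (Fin d) => ε - ‖x - c‖ :=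
    (LipschitzWith.const ε).sub h
  rw [zero_add] at h2
  exact h2.max_const 0

lemma cone_pos_iff {ε : ℝ} {c x : EuclideanSpace ℝ (Fin d)} : 0 < cone ε c x ↔ x ∈ ball c ε := by
  rw [cone, lt_max_iff, mem_ball, dist_eq_norm, sub_pos]
  simp

lemma cone_eq_zero {ε : ℝ} {c x : EuclideanSpace ℝ (Fin d)} (hx : x ∉ ball c ε) :
    cone ε c x = 0 :=
  le_antisymm (not_lt.1 (mt cone_pos_iff.1 hx)) (le_max_right _ _)

lemma exists_disjoint_balls (hd : 2 ≤ d) {Ω : Set (EuclideanSpace ℝ (Fin d))} (hΩ : IsOpen Ω)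
    (hne : Ω.Nonempty) : ∃ (c₁ c₂ : EuclideanSpace ℝ (Fin d)) (ε : ℝ), 0 < ε ∧ ball c₁ ε ⊆ Ω ∧
      ball c₂ ε ⊆ Ω ∧ Disjoint (ball c₁ ε) (ball c₂ ε) := by
  obtain ⟨c, hc⟩ := hne
  obtain ⟨δ, hδ, hsub⟩ := Metric.isOpen_iff.1 hΩ c hc
  have : Nontrivial (EuclideanSpace ℝ (Fin d)) := by
    have : Nonempty (Fin d) := ⟨⟨0, by omega⟩⟩
    infer_instance
  obtain ⟨v, hv⟩ := exists_norm_eq (EuclideanSpace ℝ (Fin d)) (c := δ / 2) (by positivity)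
  refine ⟨c, c + v, δ / 4, by positivity, (ball_subset_ball (by linarith)).trans hsub,
    (ball_subset_ball' ?_).trans hsub, ball_disjoint_ball ?_⟩
  · rw [dist_eq_norm, add_sub_cancel_left, hv]; linarith
  · rw [dist_eq_norm, sub_add_cancel_left, norm_neg, hv]; linarith

lemma exists_isDirTrial (hd : 2 ≤ d) {Ω : Set (EuclideanSpace ℝ (Fin d))} (hΩ : IsOpen Ω)
    (hne : Ω.Nonempty) {α : ℝ} (hα : 0 < α) {g : EuclideanSpace ℝ (Fin d) → ℝ} (hg : Measurable g)
    (hgα : ∀ᵐ x, α ≤ g x ∧ g x ≤ 1) :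
    ∃ u, IsDirTrial d Ω u ∧ ∫ x, u x * g x = 0 := by
  obtain ⟨c₁, c₂, ε, hε, h1, h2, hdisj⟩ := exists_disjoint_balls hd hΩ hne
  have hfg : ∀ x, cone ε c₁ x = 0 ∨ cone ε c₂ x = 0 := fun x => by
    by_cases hx : x ∈ ball c₁ ε
    · exact Or.inr (cone_eq_zero (disjoint_left.1 hdisj hx))
    · exact Or.inl (cone_eq_zero hx)
  have hsupp : ∀ c x : EuclideanSpace ℝ (Fin d), ‖c‖ + ε ≤ ‖x‖ → cone ε c x = 0 :=
    fun c x hx => cone_eq_zero fun hx' => by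
      rw [mem_ball, dist_eq_norm] at hx'
      linarith [norm_sub_norm_le x c]
  have hinteg : ∀ {q : EuclideanSpace ℝ (Fin d) → ℝ} c, Measurable q →
      (∀ᵐ x, 0 < q x ∧ q x ≤ 1) → Integrable fun x => cone ε c x * q x := fun c hq hq1 =>
    integrable_mul_of_support (lipschitzWith_cone ε c).continuous (hsupp c) hq (by
      filter_upwards [hq1] with x hx
      rw [abs_of_pos hx.1]
      exact hx.2)
  have hpos : ∀ {q : EuclideanSpace ℝ (Fin d) → ℝ} c, Measurable q →
      (∀ᵐ x, 0 < q x ∧ q x ≤ 1) → 0 < ∫ x, cone ε c x * q x := fun {q} c hq hq1 => by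
    have hn : 0 ≤ᵐ[volume] fun x => cone ε c x * q x := by
      filter_upwards [hq1] with x hx using mul_nonneg (le_max_right _ _) hx.1.le
    rw [integral_pos_iff_support_of_nonneg_ae hn (hinteg c hq hq1)]
    refine (measure_ball_pos volume c hε).trans_le (measure_mono_ae ?_)
    filter_upwards [hq1] with x hx hxc
    exact (mul_pos (cone_pos_iff.2 hxc) hx.1).ne'
  have hg1 : ∀ᵐ x, 0 < g x ∧ g x ≤ 1 := by
    filter_upwards [hgα] with x hx using ⟨hα.trans_le hx.1, hx.2⟩
  have hone : 0 < ∫ x, cone ε c₁ x := by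
    simpa using hpos (q := fun _ => 1) c₁ measurable_const (by simp)
  refine ⟨fun x => (∫ x, cone ε c₂ x * g x) * cone ε c₁ x - (∫ x, cone ε c₁ x * g x) * cone ε c₂ x,
    ⟨exists_lipschitzWith_sub ⟨1, lipschitzWith_cone ε c₁⟩ ⟨1, lipschitzWith_cone ε c₂⟩ _ _,
    fun x hx => ?_, not_ae_eq_zero_of_disjoint hfg (hpos c₂ hg hg1).ne' _ hone.ne'⟩, ?_⟩
  · simp [cone_eq_zero (mt (@h1 x) hx), cone_eq_zero (mt (@h2 x) hx)]
  · simp only [sub_mul, mul_assoc]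
    rw [integral_sub ((hinteg c₁ hg hg1).const_mul _) ((hinteg c₂ hg hg1).const_mul _),
      integral_const_mul, integral_const_mul, mul_comm, sub_self]

variable {R r₀ α a b : ℝ}

lemma goodRatio_of_isCriticalPair (hd : 2 ≤ d) (h : IsFirstZero d R) (hr₀ : IsBalanced d R r₀)
    (hα : 0 < α) (hc : IsCriticalPair d R α a b) : GoodRatio d α ((b / a) ^ d) := by
  intro Ω hΩ hbd hne g hg hgα cp cm rp rm hrp hrm hdisj hvol
  refine (twistedEV_two_balls_le hd h hc hrp hrm hdisj hvol).trans ?_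
  have hΩ0 : 0 < (volume Ω).toReal :=
    ENNReal.toReal_pos (hΩ.measure_pos volume hne).ne' hbd.measure_lt_top.ne
  rw [← div_le_iff₀' (by positivity)]
  obtain ⟨u, hu, hug⟩ := exists_isDirTrial hd hΩ hne hα hg hgα
  refine le_csInf ⟨_, u, hu, hug, rfl⟩ ?_
  rintro _ ⟨v, hv, hvg, rfl⟩
  rw [div_le_iff₀' (by positivity)]
  exact le_rayleigh_of_isDirTrial hd h hr₀ hα hc hbd hg hgα hv hvg

end Admissible

/-- there is a map `α ↦ m(α)` of optimal measure ratios, strictly increasing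
on `(0,1]`, continuously differentiable on `(0,1)`, with `m(1) = 1`, `m(α) → 1` as `α → 1⁻`,
`m(α) → 0` as `α → 0⁺`, and such that the isoperimetric inequality for twisted eigenvalues
holds with optimal balls of measure ratio `m(α)`. -/
theorem stmt17 (d : ℕ) (hd : 2 ≤ d) :
    ∃ m : ℝ → ℝ,
      (∀ α ∈ Set.Ioc (0 : ℝ) 1, m α ∈ Set.Ioc (0 : ℝ) 1) ∧
      StrictMonoOn m (Set.Ioc 0 1) ∧
      (∃ m' : ℝ → ℝ, ContinuousOn m' (Set.Ioo 0 1) ∧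
        ∀ α ∈ Set.Ioo (0 : ℝ) 1, HasDerivAt m (m' α) α) ∧
      m 1 = 1 ∧
      Tendsto m (nhdsWithin 1 (Set.Iio 1)) (nhds 1) ∧
      Tendsto m (nhdsWithin 0 (Set.Ioi 0)) (nhds 0) ∧
      ∀ α ∈ Set.Ioc (0 : ℝ) 1, GoodRatio d α (m α) := by
  obtain ⟨R, h⟩ := exists_isFirstZero d
  obtain ⟨r₀, hmem, heq, hlt, hgt⟩ := h.exists_balanced hd
  have hr₀ : IsBalanced d R r₀ := ⟨hmem, heq, hlt, hgt⟩
  obtain ⟨m, h1, h2, h3, h4, h5, h6, h7⟩ := h.exists_optimal_ratio hr₀ hd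
  refine ⟨m, h1, h2, h3, h4, h5, h6, fun α hα => ?_⟩
  obtain ⟨a, b, hc, hm⟩ := h7 α hα
  rw [hm]
  exact goodRatio_of_isCriticalPair hd h hr₀ hα.1 hc
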